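/- Inverse counting implies cut-closeness via coupling: let U, W be complexons and suppose that for some d ≥ 1 and n ≥ 2 the total variation distance between the laws of the d-skeleta of the sampled complexes satisfies d_var(𝕂_d(n,U), 𝕂_d(n,W)) < 1 − 2 exp(−n/(2 log₂ n)). Then for every finite nonnegative sequence α₁,...,α_d, δ_□(Û, Ŵ; (α_j)) ≤ ((2^{d+4} + 2)/√(log₂ n)) Σ_{j=1}^d α_j. -/

import Mathlib

open MeasureTheory

noncomputable section

/-- The uniform (Lebesgue) measure on `[0,1]`. -/
def unifI : Measure ℝ := volume.restrict (Set.Icc (0:ℝ) 1)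

/-- The product uniform measure on tuples indexed by `ι`. -/
def piUnif (ι : Type*) [Fintype ι] : Measure (ι → ℝ) := Measure.pi fun _ => unifI

/-- A complexon, encoded as a function on finite multisets of points of `[0,1]`
(the multiset encoding makes total symmetry automatic), with values in `[0,1]`,
equal to `1` on the empty multiset and on singletons, and measurable in each
dimension. -/
structure Complexon where
  toFun : Multiset ℝ → ℝ
  mem_Icc : ∀ m, toFun m ∈ Set.Icc (0:ℝ) 1
  empty_eq_one : toFun 0 = 1
  single_eq_one : ∀ x : ℝ, toFun {x} = 1
  measurable : ∀ d : ℕ, Measurable fun v : Fin (d+1) → ℝ =>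
    toFun (Multiset.map v Finset.univ.val)

/-- The multiset of coordinates of a tuple. -/
def mTup {ι : Type*} [Fintype ι] (v : ι → ℝ) : Multiset ℝ :=
  Multiset.map v Finset.univ.val

/-- The faceted version `Ŵ` of a complexon-like function:
`Ŵ(x₁,…,x_{d+1}) = ∏_{∅ ≠ σ ⊆ [d+1]} W(x_σ)`. -/
def facetFun (W : Multiset ℝ → ℝ) : Multiset ℝ → ℝ :=
  fun m => ((m.powerset.filter (· ≠ 0)).map W).prod

/-- An abstract simplicial complex on a vertex type `V`: a finite family of
finite nonempty subsets of `V` closed under taking nonempty subsets. -/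
structure SComplex (V : Type*) [DecidableEq V] where
  faces : Finset (Finset V)
  nonempty_mem : ∀ σ ∈ faces, σ.Nonempty
  down_closed : ∀ σ ∈ faces, ∀ τ ⊆ σ, τ.Nonempty → τ ∈ faces

variable {V : Type*} [DecidableEq V] [Fintype V]

/-- Facets: the inclusion-maximal faces. -/
def SComplex.facets (F : SComplex V) : Finset (Finset V) :=
  F.faces.filter fun σ => ∀ τ ∈ F.faces, σ ⊆ τ → σ = τ

/-- Antifacets: the inclusion-minimal nonempty non-faces. -/
def SComplex.antifacets (F : SComplex V) : Finset (Finset V) :=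
  Finset.univ.filter fun τ =>
    τ.Nonempty ∧ τ ∉ F.faces ∧ ∀ τ' ⊂ τ, τ'.Nonempty → τ' ∈ F.faces

/-- Homomorphism-density-type integral of a family of faces in a
multiset function. -/
def homDensityOn (A : Finset (Finset V)) (W : Multiset ℝ → ℝ) : ℝ :=
  ∫ x : V → ℝ, ∏ σ ∈ A, W (σ.val.map x) ∂(piUnif V)

/-- Homomorphism density `t(F, W)`. -/
def homDensity (F : SComplex V) (W : Multiset ℝ → ℝ) : ℝ := homDensityOn F.faces W

/-- Induced homomorphism density `t_ind(F, W)`. -/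
def indDensity (F : SComplex V) (W : Multiset ℝ → ℝ) : ℝ :=
  ∫ x : V → ℝ,
    (∏ σ ∈ F.faces, W (σ.val.map x)) *
    (∏ τ ∈ F.antifacets, (1 - W (τ.val.map x))) ∂(piUnif V)

/-- `d`-dimensional cut norm of a function on `(d+1)`-tuples. -/
def cutNormD (d : ℕ) (U : (Fin (d+1) → ℝ) → ℝ) : ℝ :=
  sSup { r | ∃ S : Fin (d+1) → Set ℝ, (∀ i, MeasurableSet (S i)) ∧
    r = |∫ x in Set.univ.pi S, U x ∂(piUnif (Fin (d+1)))| }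

/-- `d`-dimensional cut distance between two multiset functions. -/
def cutDistD (d : ℕ) (W₁ W₂ : Multiset ℝ → ℝ) : ℝ :=
  cutNormD d (fun v => W₁ (mTup v) - W₂ (mTup v))

/-- Labeled cut distance with weights `α` (`α j` weights dimension `j`, `j ≥ 1`). -/
def cutDist (α : ℕ → ℝ) (W₁ W₂ : Multiset ℝ → ℝ) : ℝ :=
  ∑' j : ℕ, α (j+1) * cutDistD (j+1) W₁ W₂

/-- Composition of a multiset function with a point transformation `φ`. -/
def compFun (W : Multiset ℝ → ℝ) (φ : ℝ → ℝ) : Multiset ℝ → ℝ :=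
  fun m => W (m.map φ)

/-- Unlabeled cut distance `δ_□(·,·;(α_j))`: infimum over measure-preserving
transformations of `[0,1]`. -/
def uCutDist (α : ℕ → ℝ) (W₁ W₂ : Multiset ℝ → ℝ) : ℝ :=
  sInf { r | ∃ φ : ℝ → ℝ, MeasurePreserving φ unifI unifI ∧
    r = cutDist α W₁ (compFun W₂ φ) }


instance (n : ℕ) : MeasurableSpace (Finset (Finset (Fin n))) := ⊤

open Classical in
/-- The face set of the random complex `𝕂_d(n,W)` (the `d`-skeleton of
`𝕂(n,W)`) as a function of the sample points `x` and the independent uniform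
labels `u`: a nonempty `σ ⊆ [n]` of cardinality at most `d+1` is a face iff
`u τ ≤ W(x_τ)` for every nonempty `τ ⊆ σ`. -/
def skelFaces (W : Multiset ℝ → ℝ) (n d : ℕ) (x : Fin n → ℝ)
    (u : Finset (Fin n) → ℝ) : Finset (Finset (Fin n)) :=
  Finset.univ.filter fun σ => σ.Nonempty ∧ σ.card ≤ d + 1 ∧
    ∀ τ ∈ σ.powerset, τ.Nonempty → u τ ≤ W (τ.val.map x)

/-- The law of `𝕂_d(n,W)`. -/
def skelLaw (W : Multiset ℝ → ℝ) (n d : ℕ) : Measure (Finset (Finset (Fin n))) :=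
  Measure.map (fun p : (Fin n → ℝ) × (Finset (Fin n) → ℝ) =>
      skelFaces W n d p.1 p.2)
    ((piUnif (Fin n)).prod (piUnif (Finset (Fin n))))

/-- Total variation distance between two measures. -/
def tvDist {X : Type*} [MeasurableSpace X] (μ ν : Measure X) : ℝ :=
  sSup { r | ∃ A : Set X, MeasurableSet A ∧ r = |(μ A).toReal - (ν A).toReal| }

section Concentration

variable {ι X : Type*} [Fintype ι] [DecidableEq ι] [MeasurableSpace X]

/-- Resampling one coordinate preserves a product measure. -/
lemma measurePreserving_update_pi (μ : Measure X) [IsProbabilityMeasure μ] (i : ι) :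
    MeasurePreserving (fun p : (ι → X) × X => Function.update p.1 i p.2)
      ((Measure.pi fun _ : ι => μ).prod μ) (Measure.pi fun _ : ι => μ) := by
  have hm : Measurable (fun p : (ι → X) × X => Function.update p.1 i p.2) := by
    rw [measurable_pi_iff]
    intro j
    by_cases h : j = i
    · subst h; simpa using measurable_snd
    · simp only [Function.update_of_ne h]; fun_prop
  refine ⟨hm, (Measure.pi_eq fun s hs => ?_).symm⟩
  rw [Measure.map_apply hm (MeasurableSet.univ_pi hs)]
  have : (fun p : (ι → X) × X => Function.update p.1 i p.2) ⁻¹' (Set.univ.pi s) =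
      (Set.univ.pi (Function.update s i Set.univ)) ×ˢ s i := by
    ext p
    simp only [Set.mem_preimage, Set.mem_pi, Set.mem_univ, true_implies, Set.mem_prod]
    constructor
    · intro h
      refine ⟨fun j => ?_, by simpa using h i⟩
      by_cases hj : j = i
      · subst hj; simp
      · simpa [Function.update_of_ne hj] using h j
    · rintro ⟨h, h'⟩ j
      by_cases hj : j = i
      · subst hj; simpa using h'
      · simpa [Function.update_of_ne hj] using h j
  rw [this, Measure.prod_prod, Measure.pi_pi]
  rw [← Finset.prod_erase_mul _ _ (Finset.mem_univ i), ← Finset.prod_erase_mul _ (fun i => μ (s i)) (Finset.mem_univ i)]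
  simp only [Function.update_self, measure_univ, mul_one]
  congr 1
  refine Finset.prod_congr rfl fun j hj => ?_
  rw [Function.update_of_ne (Finset.ne_of_mem_erase hj)]

/-- Replacing a block of coordinates by independent copies preserves a product measure. -/
lemma measurePreserving_mix_pi (μ : Measure X) [IsProbabilityMeasure μ] (I : Finset ι) :
    MeasurePreserving (fun (p : (ι → X) × (ι → X)) i => if i ∈ I then p.1 i else p.2 i)
      ((Measure.pi fun _ : ι => μ).prod (Measure.pi fun _ : ι => μ))
      (Measure.pi fun _ : ι => μ) := by
  have hm : Measurable (fun (p : (ι → X) × (ι → X)) i => if i ∈ I then p.1 i else p.2 i) := by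
    rw [measurable_pi_iff]
    intro j
    by_cases h : j ∈ I <;> simp only [h, if_true, if_false] <;> fun_prop
  refine ⟨hm, (Measure.pi_eq fun s hs => ?_).symm⟩
  rw [Measure.map_apply hm (MeasurableSet.univ_pi hs)]
  have : (fun (p : (ι → X) × (ι → X)) i => if i ∈ I then p.1 i else p.2 i) ⁻¹' (Set.univ.pi s) =
      (Set.univ.pi fun i => if i ∈ I then s i else Set.univ) ×ˢ
      (Set.univ.pi fun i => if i ∈ I then Set.univ else s i) := by
    ext p
    simp only [Set.mem_preimage, Set.mem_pi, Set.mem_univ, true_implies, Set.mem_prod,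
      ← forall_and]
    refine forall_congr' fun j => ?_
    by_cases hj : j ∈ I <;> simp [hj]
  rw [this, Measure.prod_prod, Measure.pi_pi, Measure.pi_pi, ← Finset.prod_mul_distrib]
  refine Finset.prod_congr rfl fun j _ => ?_
  by_cases hj : j ∈ I <;> simp [hj]

omit [DecidableEq ι] in
lemma integrable_of_bounded {Ω : Type*} [MeasurableSpace Ω] {μ : Measure Ω} [IsFiniteMeasure μ]
    {f : Ω → ℝ} (hf : Measurable f) {B : ℝ} (hB : ∀ x, |f x| ≤ B) : Integrable f μ :=
  Integrable.of_bound hf.aestronglyMeasurable B (Filter.Eventually.of_forall hB)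

lemma integral_pi_update (μ : Measure X) [IsProbabilityMeasure μ] (i : ι) {f : (ι → X) → ℝ}
    (hf : Measurable f) {B : ℝ} (hB : ∀ x, |f x| ≤ B) :
    ∫ x, (∫ v, f (Function.update x i v) ∂μ) ∂(Measure.pi fun _ : ι => μ) =
      ∫ x, f x ∂(Measure.pi fun _ : ι => μ) := by
  have h := measurePreserving_update_pi (ι := ι) μ i
  rw [← h.map_eq, integral_map h.measurable.aemeasurable hf.aestronglyMeasurable, h.map_eq,
    integral_prod]
  exact integrable_of_bounded (hf.comp h.measurable) fun x => hB _

lemma measurable_integral_update (μ : Measure X) [IsProbabilityMeasure μ] (i : ι)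
    {f : (ι → X) → ℝ} (hf : Measurable f) :
    Measurable fun x => ∫ v, f (Function.update x i v) ∂μ := by
  have h := measurePreserving_update_pi (ι := ι) μ i
  exact (StronglyMeasurable.integral_prod_right' (ν := μ)
    (hf.comp h.measurable).stronglyMeasurable).measurable

/-- Hoeffding's lemma for a function whose oscillation is at most `c`. -/
lemma integral_exp_sub_mean_le {μ : Measure X} [IsProbabilityMeasure μ] {g : X → ℝ}
    (hg : Measurable g) {c : ℝ} (hc : ∀ v w, g v - g w ≤ c) (t : ℝ) :
    ∫ v, Real.exp (t * (g v - ∫ w, g w ∂μ)) ∂μ ≤ Real.exp (t ^ 2 * c ^ 2 / 8) := by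
  have hne : Nonempty X := μ.nonempty_of_neZero
  obtain ⟨v₀⟩ := hne
  have hbd : BddBelow (Set.range g) := ⟨g v₀ - c, by rintro _ ⟨w, rfl⟩; linarith [hc v₀ w]⟩
  have hmem : ∀ v, g v ∈ Set.Icc (⨅ w, g w) ((⨅ w, g w) + c) := by
    intro v
    refine ⟨ciInf_le hbd v, ?_⟩
    have : Nonempty X := ⟨v₀⟩
    have : g v - c ≤ ⨅ w, g w := le_ciInf fun w => by linarith [hc v w]
    linarith
  have h := (ProbabilityTheory.hasSubgaussianMGF_of_mem_Icc (μ := μ) hg.aemeasurable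
    (Filter.Eventually.of_forall hmem)).mgf_le t
  rw [ProbabilityTheory.mgf] at h
  refine h.trans (le_of_eq ?_)
  congr 1
  have : ((⨅ w, g w) + c) - (⨅ w, g w) = c := by ring
  simp only [this, NNReal.coe_pow, NNReal.coe_div, coe_nnnorm, Real.norm_eq_abs, div_pow, sq_abs]
  simp; ring

omit [MeasurableSpace X] in
lemma abs_sub_le_sum_of_bounded_differences (c : ι → ℝ) {f : (ι → X) → ℝ}
    (hc : ∀ x i v, |f (Function.update x i v) - f x| ≤ c i) (x y : ι → X) :
    |f x - f y| ≤ ∑ i, c i := by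
  have key : ∀ I : Finset ι, |f (fun i => if i ∈ I then x i else y i) - f y| ≤ ∑ i ∈ I, c i := by
    intro I
    induction I using Finset.induction_on with
    | empty => simp
    | insert i I hi ih =>
      rw [Finset.sum_insert hi]
      have hu : (fun j => if j ∈ insert i I then x j else y j) =
          Function.update (fun j => if j ∈ I then x j else y j) i (x i) := by
        ext j
        by_cases hj : j = i
        · subst hj; simp
        · simp [hj, Finset.mem_insert]
      rw [hu]
      have := hc (fun j => if j ∈ I then x j else y j) i (x i)
      exact (abs_sub_le _ (f fun j => if j ∈ I then x j else y j) _).trans (add_le_add this ih)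
  simpa using key Finset.univ

/-- The moment generating function form of McDiarmid's bounded differences inequality. -/
theorem integral_exp_le_of_bounded_differences (μ : Measure X) [IsProbabilityMeasure μ]
    (c : ι → ℝ) {f : (ι → X) → ℝ} (hf : Measurable f)
    (hc : ∀ x i v, |f (Function.update x i v) - f x| ≤ c i) (t : ℝ) :
    ∫ x, Real.exp (t * (f x - ∫ y, f y ∂(Measure.pi fun _ : ι => μ)))
      ∂(Measure.pi fun _ : ι => μ) ≤ Real.exp (t ^ 2 * (∑ i, c i ^ 2) / 8) := by
  have hne : Nonempty X := μ.nonempty_of_neZero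
  obtain ⟨v₀⟩ := hne
  set P : Measure (ι → X) := Measure.pi fun _ : ι => μ with hP
  have key : ∀ I : Finset ι, ∀ f : (ι → X) → ℝ, Measurable f →
      (∀ x i v, |f (Function.update x i v) - f x| ≤ c i) →
      (∀ x y, (∀ i ∈ I, x i = y i) → f x = f y) →
      ∫ x, Real.exp (t * (f x - ∫ y, f y ∂P)) ∂P ≤ Real.exp (t ^ 2 * (∑ i ∈ I, c i ^ 2) / 8) := by
    intro I
    induction I using Finset.induction_on with
    | empty =>
      intro f _ _ hdep
      have : ∀ x, f x = f fun _ => v₀ := fun x => hdep _ _ (by simp)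
      simp [this]
    | insert i I hi ih =>
      intro f hf hc hdep
      have hB : ∀ x, |f x| ≤ |f fun _ => v₀| + ∑ i, c i := by
        intro x
        have h1 := abs_sub_le_sum_of_bounded_differences c hc x (fun _ => v₀)
        have h2 := abs_sub_abs_le_abs_sub (f x) (f fun _ => v₀)
        linarith
      set B := |f fun _ => v₀| + ∑ i, c i with hBdef
      set g : (ι → X) → ℝ := fun x => ∫ v, f (Function.update x i v) ∂μ with hg
      have hgm : Measurable g := measurable_integral_update μ i hf
      have hint : ∀ x, Integrable (fun v => f (Function.update x i v)) μ := fun x =>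
        integrable_of_bounded (hf.comp (measurable_update x)) fun v => hB _
      have hgc : ∀ x j v, |g (Function.update x j v) - g x| ≤ c j := by
        intro x j v
        simp only [hg]
        rw [← integral_sub (hint _) (hint _)]
        have : ∀ w, ‖f (Function.update (Function.update x j v) i w) -
            f (Function.update x i w)‖ ≤ c j := by
          intro w
          by_cases hj : j = i
          · subst hj
            simpa using (abs_nonneg _).trans (hc x j v)
          · rw [Function.update_comm hj]
            exact hc _ _ _
        simpa using norm_integral_le_of_norm_le_const (μ := μ) (Filter.Eventually.of_forall this)
      have hgdep : ∀ x y, (∀ j ∈ I, x j = y j) → g x = g y := by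
        intro x y hxy
        simp only [hg]
        congr 1
        ext v
        refine hdep _ _ fun j hj => ?_
        by_cases hji : j = i
        · subst hji; simp
        · rw [Function.update_of_ne hji, Function.update_of_ne hji]
          exact hxy j ((Finset.mem_insert.1 hj).resolve_left hji)
      have hgB : ∀ x, |g x| ≤ B := by
        intro x
        simpa using norm_integral_le_of_norm_le_const (μ := μ)
          (f := fun v => f (Function.update x i v)) (Filter.Eventually.of_forall fun v => hB _)
      have hgmean : ∫ x, g x ∂P = ∫ x, f x ∂P := integral_pi_update μ i hf hB
      set m := ∫ x, f x ∂P with hm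
      have hEm : Measurable fun x => Real.exp (t * (f x - m)) := by fun_prop
      have hEB : ∀ (h : (ι → X) → ℝ), (∀ x, |h x| ≤ B) → ∀ x, |Real.exp (t * (h x - m))| ≤
          Real.exp (|t| * (B + |m|)) := by
        intro h hh x
        rw [abs_of_pos (Real.exp_pos _), Real.exp_le_exp]
        calc t * (h x - m) ≤ |t * (h x - m)| := le_abs_self _
          _ = |t| * |h x - m| := abs_mul _ _
          _ ≤ |t| * (B + |m|) := by
            gcongr
            exact (abs_sub _ _).trans (by gcongr; exact hh x)
      rw [← integral_pi_update μ i hEm (hEB f hB)]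
      have hstep : ∀ x, ∫ v, Real.exp (t * (f (Function.update x i v) - m)) ∂μ ≤
          Real.exp (t * (g x - m)) * Real.exp (t ^ 2 * c i ^ 2 / 8) := by
        intro x
        have h1 := integral_exp_sub_mean_le (μ := μ) (g := fun v => f (Function.update x i v))
          (hf.comp (measurable_update x)) (c := c i) (fun v w => by
            have := hc (Function.update x i w) i v
            rw [Function.update_idem] at this
            exact (le_abs_self _).trans this) t
        calc ∫ v, Real.exp (t * (f (Function.update x i v) - m)) ∂μ
            = ∫ v, Real.exp (t * (g x - m)) *
                Real.exp (t * (f (Function.update x i v) - g x)) ∂μ := by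
              congr 1; ext v; rw [← Real.exp_add]; ring_nf
          _ = Real.exp (t * (g x - m)) *
                ∫ v, Real.exp (t * (f (Function.update x i v) - g x)) ∂μ := by
              rw [integral_const_mul]
          _ ≤ _ := by gcongr
      have hgE : Integrable (fun x => Real.exp (t * (g x - m))) P :=
        integrable_of_bounded (by fun_prop) (hEB g hgB)
      calc ∫ x, (∫ v, Real.exp (t * (f (Function.update x i v) - m)) ∂μ) ∂P
          ≤ ∫ x, Real.exp (t * (g x - m)) * Real.exp (t ^ 2 * c i ^ 2 / 8) ∂P := by
            refine integral_mono ?_ (hgE.mul_const _) hstep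
            refine integrable_of_bounded (measurable_integral_update μ i hEm)
              (B := Real.exp (|t| * (B + |m|))) fun x => ?_
            simpa using norm_integral_le_of_norm_le_const (μ := μ)
              (f := fun v => Real.exp (t * (f (Function.update x i v) - m)))
              (Filter.Eventually.of_forall fun v => hEB f hB _)
        _ = (∫ x, Real.exp (t * (g x - m)) ∂P) * Real.exp (t ^ 2 * c i ^ 2 / 8) := by
            rw [integral_mul_const]
        _ ≤ Real.exp (t ^ 2 * (∑ i ∈ I, c i ^ 2) / 8) * Real.exp (t ^ 2 * c i ^ 2 / 8) := by
            gcongr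
            have := ih g hgm hgc hgdep
            rwa [hgmean] at this
        _ = _ := by
            rw [← Real.exp_add, Finset.sum_insert hi]; ring_nf
  exact key Finset.univ f hf hc fun x y h => by rw [funext fun i => h i (Finset.mem_univ i)]

/-- McDiarmid's inequality. -/
theorem measure_gt_le_of_bounded_differences (μ : Measure X) [IsProbabilityMeasure μ]
    (c : ι → ℝ) {f : (ι → X) → ℝ} (hf : Measurable f)
    (hc : ∀ x i v, |f (Function.update x i v) - f x| ≤ c i) {σ s : ℝ}
    (hσ : ∑ i, c i ^ 2 ≤ σ) (hσ0 : 0 < σ) (hs : 0 ≤ s) :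
    (Measure.pi fun _ : ι => μ).real
      {x | ∫ y, f y ∂(Measure.pi fun _ : ι => μ) + s < f x} ≤ Real.exp (-2 * s ^ 2 / σ) := by
  have hne : Nonempty X := μ.nonempty_of_neZero
  obtain ⟨v₀⟩ := hne
  set P : Measure (ι → X) := Measure.pi fun _ : ι => μ with hP
  set m := ∫ y, f y ∂P with hm
  have hB : ∀ x, |f x| ≤ |f fun _ => v₀| + ∑ i, c i := by
    intro x
    have h1 := abs_sub_le_sum_of_bounded_differences c hc x (fun _ => v₀)
    have h2 := abs_sub_abs_le_abs_sub (f x) (f fun _ => v₀)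
    linarith
  set B := |f fun _ => v₀| + ∑ i, c i
  set t := 4 * s / σ with ht
  have ht0 : 0 ≤ t := by positivity
  have hint : Integrable (fun x => Real.exp (t * (f x - m))) P := by
    refine integrable_of_bounded (by fun_prop) (B := Real.exp (|t| * (B + |m|))) fun x => ?_
    rw [abs_of_pos (Real.exp_pos _), Real.exp_le_exp]
    calc t * (f x - m) ≤ |t * (f x - m)| := le_abs_self _
      _ = |t| * |f x - m| := abs_mul _ _
      _ ≤ |t| * (B + |m|) := by
        gcongr
        exact (abs_sub _ _).trans (by gcongr; exact hB x)
  have h1 := ProbabilityTheory.measure_ge_le_exp_mul_mgf (μ := P) (X := fun x => f x - m) s ht0 hint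
  have h2 := integral_exp_le_of_bounded_differences μ c hf hc t
  calc P.real {x | m + s < f x} ≤ P.real {x | s ≤ f x - m} := by
        refine measureReal_mono ?_
        intro x hx
        simp only [Set.mem_ofPred_eq] at hx ⊢
        linarith
    _ ≤ Real.exp (-t * s) * Real.exp (t ^ 2 * (∑ i, c i ^ 2) / 8) := by
        refine h1.trans ?_
        gcongr
        exact h2
    _ ≤ Real.exp (-t * s) * Real.exp (t ^ 2 * σ / 8) := by gcongr
    _ = Real.exp (-2 * s ^ 2 / σ) := by
        rw [← Real.exp_add]
        congr 1
        rw [ht]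
        field_simp
        ring

end Concentration

/-- The expectation of a pointwise maximum of `N` subgaussian variables. -/
lemma integral_le_of_forall_exists_le {Ω κ : Type*} [MeasurableSpace Ω] [Fintype κ]
    {P : Measure Ω} [IsProbabilityMeasure P] {M : Ω → ℝ} {Y : κ → Ω → ℝ} {B b σ ℓ : ℝ}
    (hM : Measurable M) (hMB : ∀ ω, |M ω| ≤ B)
    (hY : ∀ k, Measurable (Y k)) (hYB : ∀ k ω, |Y k ω| ≤ B)
    (hle : ∀ ω, ∃ k, M ω ≤ Y k ω) (hσ : 0 < σ) (hℓ : 0 < ℓ) (hcard : Real.log (Fintype.card κ) ≤ ℓ)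
    (hmgf : ∀ k t, 0 ≤ t → ∫ ω, Real.exp (t * (Y k ω - b)) ∂P ≤ Real.exp (t ^ 2 * σ / 8)) :
    ∫ ω, M ω ∂P ≤ b + Real.sqrt (ℓ * σ / 2) := by
  have hne : Nonempty Ω := P.nonempty_of_neZero
  have hκ : Nonempty κ := by obtain ⟨ω⟩ := hne; exact ⟨(hle ω).choose⟩
  have hexp : ∀ (t : ℝ) (h : Ω → ℝ), Measurable h → (∀ x, |h x| ≤ B) →
      Integrable (fun x => Real.exp (t * (h x - b))) P := by
    intro t h hmeas hh
    refine integrable_of_bounded (by fun_prop) (B := Real.exp (|t| * (B + |b|))) fun x => ?_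
    rw [abs_of_pos (Real.exp_pos _), Real.exp_le_exp]
    calc t * (h x - b) ≤ |t * (h x - b)| := le_abs_self _
      _ = |t| * |h x - b| := abs_mul _ _
      _ ≤ |t| * (B + |b|) := by
        gcongr
        exact (abs_sub _ _).trans (by gcongr; exact hh x)
  have hMint : Integrable M P := integrable_of_bounded hM hMB
  set t := Real.sqrt (8 * ℓ / σ) with ht
  have htpos : 0 < t := Real.sqrt_pos.2 (by positivity)
  have ht2 : t ^ 2 = 8 * ℓ / σ := Real.sq_sqrt (by positivity)
  have hjensen : Real.exp (t * (∫ ω, M ω ∂P - b)) ≤ ∫ ω, Real.exp (t * (M ω - b)) ∂P := by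
    have h := convexOn_exp.map_integral_le (μ := P) (f := fun ω => t * (M ω - b))
      Real.continuous_exp.continuousOn isClosed_univ (by simp)
      ((hMint.sub (integrable_const b)).const_mul t) (hexp t M hM hMB)
    rwa [integral_const_mul, integral_sub hMint (integrable_const b), integral_const,
      probReal_univ, one_smul] at h
  have hsum : ∫ ω, Real.exp (t * (M ω - b)) ∂P ≤ Fintype.card κ * Real.exp (t ^ 2 * σ / 8) := by
    calc ∫ ω, Real.exp (t * (M ω - b)) ∂P ≤ ∫ ω, ∑ k, Real.exp (t * (Y k ω - b)) ∂P := by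
          refine integral_mono (hexp t M hM hMB)
            (integrable_finsetSum _ fun k _ => hexp t _ (hY k) (hYB k)) fun ω => ?_
          obtain ⟨k, hk⟩ := hle ω
          calc Real.exp (t * (M ω - b)) ≤ Real.exp (t * (Y k ω - b)) := by gcongr
            _ ≤ _ := Finset.single_le_sum (f := fun k => Real.exp (t * (Y k ω - b)))
              (fun k _ => (Real.exp_pos _).le) (Finset.mem_univ k)
      _ = ∑ k, ∫ ω, Real.exp (t * (Y k ω - b)) ∂P :=
          integral_finsetSum _ fun k _ => hexp t _ (hY k) (hYB k)
      _ ≤ ∑ _k : κ, Real.exp (t ^ 2 * σ / 8) := Finset.sum_le_sum fun k _ => hmgf k t htpos.le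
      _ = _ := by simp
  have hcpos : (0 : ℝ) < Fintype.card κ := by exact_mod_cast Fintype.card_pos
  have h3 : t * (∫ ω, M ω ∂P - b) ≤ ℓ + t ^ 2 * σ / 8 := by
    have := hjensen.trans hsum
    have h4 := Real.log_le_log (Real.exp_pos _) this
    rw [Real.log_exp, Real.log_mul hcpos.ne' (Real.exp_pos _).ne', Real.log_exp] at h4
    linarith
  have h5 : ℓ + t ^ 2 * σ / 8 = t * Real.sqrt (ℓ * σ / 2) := by
    have : t * Real.sqrt (ℓ * σ / 2) = Real.sqrt ((2 * ℓ) ^ 2) := by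
      rw [ht, ← Real.sqrt_mul (by positivity)]
      congr 1
      field_simp
      ring
    rw [this, Real.sqrt_sq (by positivity), ht2]
    field_simp
    ring
  rw [h5] at h3
  have := le_of_mul_le_mul_left h3 htpos
  linarith

instance : IsProbabilityMeasure unifI := ⟨by simp [unifI]⟩

instance : NullSingletonClass unifI := by unfold unifI; infer_instance

instance (ι : Type*) [Fintype ι] : IsProbabilityMeasure (piUnif ι) := by
  unfold piUnif; infer_instance

/-- The `r`-ary function `f` has cut norm at most `ε` with respect to the base measure `μ`. -/
def CutLE {X : Type*} [MeasurableSpace X] (μ : Measure X) {r : ℕ} (f : (Fin r → X) → ℝ)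
    (ε : ℝ) : Prop :=
  ∀ S : Fin r → Set X, (∀ i, MeasurableSet (S i)) →
    |∫ x in Set.univ.pi S, f x ∂(Measure.pi fun _ => μ)| ≤ ε

section CutLE

variable {X Y : Type*} [MeasurableSpace X] [MeasurableSpace Y] {r : ℕ}

lemma CutLE.nonneg {μ : Measure X} {f : (Fin r → X) → ℝ} {ε : ℝ} (h : CutLE μ f ε) : 0 ≤ ε :=
  (abs_nonneg _).trans (h (fun _ => Set.univ) fun _ => MeasurableSet.univ)

lemma CutLE.mono {μ : Measure X} {f : (Fin r → X) → ℝ} {ε ε' : ℝ} (h : CutLE μ f ε)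
    (hε : ε ≤ ε') : CutLE μ f ε' := fun S hS => (h S hS).trans hε

lemma CutLE.neg {μ : Measure X} {f : (Fin r → X) → ℝ} {ε : ℝ} (h : CutLE μ f ε) :
    CutLE μ (fun x => -f x) ε := fun S hS => by
  rw [integral_neg, abs_neg]; exact h S hS

lemma CutLE.add {μ : Measure X} [IsFiniteMeasure μ] {f g : (Fin r → X) → ℝ} {ε δ B C : ℝ}
    (hf : CutLE μ f ε) (hg : CutLE μ g δ) (hfm : Measurable f) (hgm : Measurable g)
    (hfB : ∀ x, |f x| ≤ B) (hgB : ∀ x, |g x| ≤ C) :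
    CutLE μ (fun x => f x + g x) (ε + δ) := fun S hS => by
  rw [integral_add (integrable_of_bounded hfm hfB) (integrable_of_bounded hgm hgB)]
  exact (abs_add_le _ _).trans (add_le_add (hf S hS) (hg S hS))

lemma CutLE.congr_ae {μ : Measure X} [SigmaFinite μ] {f g : (Fin r → X) → ℝ} {ε : ℝ}
    (hf : CutLE μ f ε) (h : f =ᵐ[Measure.pi fun _ => μ] g) : CutLE μ g ε := fun S hS => by
  rw [← integral_congr_ae (ae_restrict_of_ae h)]; exact hf S hS

lemma integral_pi_insertNth {ν : Fin (r + 1) → Measure X} [∀ i, IsFiniteMeasure (ν i)]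
    {f : (Fin (r + 1) → X) → ℝ} (hf : Measurable f) {B : ℝ} (hB : ∀ x, |f x| ≤ B)
    (c : Fin (r + 1)) :
    ∫ x, f x ∂(Measure.pi ν) =
      ∫ v, ∫ y, f (c.insertNth v y) ∂(Measure.pi fun j => ν (c.succAbove j)) ∂(ν c) := by
  have h := (measurePreserving_piFinSuccAbove ν c).symm
  rw [← h.integral_comp', integral_prod]
  · rfl
  · exact integrable_of_bounded (hf.comp (MeasurableEquiv.measurable _)) fun x => hB _

lemma CutLE.integral_pi_le {μ : Measure X} [IsFiniteMeasure μ] {f : (Fin r → X) → ℝ} {ε B : ℝ}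
    (hf : CutLE μ f ε) (hfm : Measurable f) (hB : ∀ x, |f x| ≤ B) {ν : Fin r → Measure X}
    (hν : ∀ i, ν i ≤ μ) : ∫ x, f x ∂(Measure.pi ν) ≤ ε := by
  have key : ∀ J : Finset (Fin r), ∀ ν : Fin r → Measure X, (∀ i, ν i ≤ μ) →
      (∀ i ∉ J, ∃ S, MeasurableSet S ∧ ν i = μ.restrict S) → ∫ x, f x ∂(Measure.pi ν) ≤ ε := by
    intro J
    induction J using Finset.induction_on with
    | empty =>
      intro ν _ h
      choose S hS hνS using fun i => h i (by simp)
      have : ν = fun i => μ.restrict (S i) := funext hνS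
      subst this
      rw [← Measure.restrict_pi_pi]
      exact (le_abs_self _).trans (hf S hS)
    | insert c J hc ih =>
      intro ν hν hJ
      cases r with
      | zero => exact c.elim0
      | succ r =>
        have : ∀ i, IsFiniteMeasure (ν i) := fun i => isFiniteMeasure_of_le μ (hν i)
        set h : X → ℝ := fun v => ∫ y, f (c.insertNth v y)
          ∂(Measure.pi fun j => ν (c.succAbove j)) with hh
        have hins : Measurable fun p : X × (Fin r → X) => (c.insertNth p.1 p.2 : Fin (r+1) → X) :=
          (MeasurableEquiv.piFinSuccAbove (fun _ => X) c).symm.measurable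
        have hm : Measurable h :=
          (StronglyMeasurable.integral_prod_right'
            (ν := Measure.pi fun j => ν (c.succAbove j))
            (hfm.comp hins).stronglyMeasurable).measurable
        obtain ⟨C, hC⟩ : ∃ C, ∀ v, |h v| ≤ C :=
          ⟨B * (Measure.pi fun j => ν (c.succAbove j)).real Set.univ, fun v =>
            by
            simpa [hh] using norm_integral_le_of_norm_le_const
              (μ := Measure.pi fun j => ν (c.succAbove j)) (f := fun y => f (c.insertNth v y))
              (Filter.Eventually.of_forall fun y => hB _)⟩
        have hpm : Measurable fun v => max (h v) 0 := hm.max measurable_const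
        have hpC : ∀ v, |max (h v) 0| ≤ C := fun v =>
          by
            have h1 := abs_le.1 (hC v)
            rw [abs_of_nonneg (le_max_right _ _)]
            exact max_le h1.2 ((abs_nonneg _).trans (hC v))
        set S : Set X := {v | 0 < h v} with hSdef
        have hS : MeasurableSet S := measurableSet_lt measurable_const hm
        set ν' := Function.update ν c (μ.restrict S) with hν'
        have hν'le : ∀ i, ν' i ≤ μ := by
          intro i
          by_cases hi : i = c
          · subst hi; simpa [hν'] using Measure.restrict_le_self
          · simpa [hν', Function.update_of_ne hi] using hν i
        have : ∀ i, IsFiniteMeasure (ν' i) := fun i => isFiniteMeasure_of_le μ (hν'le i)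
        calc ∫ x, f x ∂(Measure.pi ν) = ∫ v, h v ∂(ν c) := integral_pi_insertNth hfm hB c
          _ ≤ ∫ v, max (h v) 0 ∂(ν c) := integral_mono (integrable_of_bounded hm hC)
              (integrable_of_bounded hpm hpC) fun v => le_max_left _ _
          _ ≤ ∫ v, max (h v) 0 ∂μ := integral_mono_measure (hν c)
              (Filter.Eventually.of_forall fun v => le_max_right _ _)
              (integrable_of_bounded hpm hpC)
          _ = ∫ v in S, h v ∂μ := by
              rw [← integral_indicator hS]
              congr 1
              ext v
              by_cases hv : 0 < h v
              · simp [hSdef, Set.indicator, hv, hv.le]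
              · simp [hSdef, Set.indicator, hv, not_lt.1 hv]
          _ = ∫ x, f x ∂(Measure.pi ν') := by
              rw [integral_pi_insertNth hfm hB c]
              simp [hν', hh]
          _ ≤ ε := by
              refine ih ν' hν'le fun i hi => ?_
              by_cases hic : i = c
              · exact ⟨S, hS, by simp [hν', hic]⟩
              · simpa [hν', Function.update_of_ne hic] using hJ i (by simp [hic, hi])
  exact key Finset.univ ν hν fun i hi => absurd (Finset.mem_univ i) hi

/-- The cut norm does not increase under measure-preserving maps. -/
lemma CutLE.comp {μ : Measure X} {μ' : Measure Y} [IsFiniteMeasure μ] [IsFiniteMeasure μ']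
    {ψ : X → Y} (hψ : MeasurePreserving ψ μ μ') {f : (Fin r → Y) → ℝ} {ε B : ℝ}
    (hf : CutLE μ' f ε) (hfm : Measurable f) (hB : ∀ x, |f x| ≤ B) :
    CutLE μ (fun x => f (ψ ∘ x)) ε := by
  intro S hS
  have hν : ∀ i, (μ.restrict (S i)).map ψ ≤ μ' := fun i => by
    rw [← hψ.map_eq]
    exact Measure.map_mono Measure.restrict_le_self hψ.measurable
  have hψm := hψ.measurable
  have heq : ∫ x in Set.univ.pi S, f (ψ ∘ x) ∂(Measure.pi fun _ => μ) =
      ∫ y, f y ∂(Measure.pi fun i => (μ.restrict (S i)).map ψ) := by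
    rw [Measure.restrict_pi_pi, ← Measure.pi_map_pi (fun i => hψm.aemeasurable),
      integral_map (φ := fun (x : Fin r → X) i => ψ (x i)) (measurable_pi_lambda _ fun i =>
        hψm.comp (measurable_pi_apply i)).aemeasurable hfm.aestronglyMeasurable]
    rfl
  rw [heq, abs_le]
  refine ⟨?_, hf.integral_pi_le hfm hB hν⟩
  have := hf.neg.integral_pi_le hfm.neg (B := B) (by simpa using hB) hν
  rw [integral_neg] at this
  linarith

end CutLE

section Realization

/-- The distribution function of an atomless law transports it to the uniform law. -/
lemma map_cdf_eq_unifI (μ : Measure ℝ) [IsProbabilityMeasure μ] [NullSingletonClass μ] :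
    μ.map (fun x => ProbabilityTheory.cdf μ x) = unifI := by
  set F : ℝ → ℝ := fun x => ProbabilityTheory.cdf μ x with hF
  have hmono : Monotone F := ProbabilityTheory.monotone_cdf μ
  have hmeas : Measurable F := hmono.measurable
  have hcont : Continuous F := by
    rw [continuous_iff_continuousAt]
    intro x
    rw [hmono.continuousAt_iff_leftLim_eq_rightLim]
    have h1 : Function.rightLim F x = F x := StieltjesFunction.rightLim_eq _ _
    have h2 : μ {x} = ENNReal.ofReal (F x - Function.leftLim F x) := by
      conv_lhs => rw [← ProbabilityTheory.measure_cdf (μ := μ)]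
      exact StieltjesFunction.measure_singleton _ _
    rw [measure_singleton, eq_comm, ENNReal.ofReal_eq_zero] at h2
    have h3 : Function.leftLim F x ≤ F x := hmono.leftLim_le le_rfl
    rw [h1]; linarith
  have : IsProbabilityMeasure (μ.map F) := Measure.isProbabilityMeasure_map hmeas.aemeasurable
  have hex : ∀ t ∈ Set.Ioo (0:ℝ) 1, ∃ x, F x = t := by
    intro t ht
    exact mem_range_of_exists_le_of_exists_ge hcont
      (((ProbabilityTheory.tendsto_cdf_atBot μ).eventually (gt_mem_nhds ht.1)).exists.imp
        fun _ h => le_of_lt h)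
      (((ProbabilityTheory.tendsto_cdf_atTop μ).eventually (lt_mem_nhds ht.2)).exists.imp
        fun _ h => le_of_lt h)
  refine Measure.ext_of_Iic _ _ fun t => ?_
  rw [Measure.map_apply hmeas measurableSet_Iic, unifI, Measure.restrict_apply measurableSet_Iic]
  rcases lt_or_ge t 0 with ht | ht
  · have h1 : F ⁻¹' Set.Iic t = ∅ := by
      ext x; simpa using ht.trans_le (ProbabilityTheory.cdf_nonneg μ x)
    have h2 : Set.Iic t ∩ Set.Icc 0 1 = ∅ := by
      ext x; simp; intro h h'; linarith
    simp [h1, h2]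
  rcases le_or_gt 1 t with ht1 | ht1
  · have h1 : F ⁻¹' Set.Iic t = Set.univ := by
      ext x; simpa using (ProbabilityTheory.cdf_le_one μ x).trans ht1
    have h2 : Set.Iic t ∩ Set.Icc 0 1 = Set.Icc (0:ℝ) 1 := by
      ext x; simp; intro h h'; linarith
    simp [h1, h2]
  have h2 : Set.Iic t ∩ Set.Icc 0 1 = Set.Icc (0:ℝ) t := by
    ext x; simp; constructor
    · rintro ⟨h1, h2, _⟩; exact ⟨h2, h1⟩
    · rintro ⟨h1, h2⟩; exact ⟨h2, h1, by linarith⟩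
  rw [h2, Real.volume_Icc, sub_zero]
  refine le_antisymm ?_ ?_
  · refine le_of_forall_gt_imp_ge_of_dense fun a ha => ?_
    by_cases ha1 : a = ⊤
    · simp [ha1]
    lift a to NNReal using ha1
    have hta : t < a := by
      by_contra hcon
      exact absurd ha (not_lt.2 (by
        rw [← ENNReal.ofReal_coe_nnreal]
        exact ENNReal.ofReal_le_ofReal (not_lt.1 hcon)))
    set t' : ℝ := min a ((t + 1) / 2)
    have ht' : t < t' := lt_min hta (by linarith)
    obtain ⟨x, hx⟩ := hex t' ⟨ht.trans_lt ht', (min_le_right _ _).trans_lt (by linarith)⟩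
    calc μ (F ⁻¹' Set.Iic t) ≤ μ (Set.Iic x) := by
          refine measure_mono fun y hy => ?_
          by_contra hcon
          have h3 := hmono (le_of_lt (not_le.1 hcon))
          simp only [Set.mem_preimage, Set.mem_Iic] at hy
          linarith
      _ = ENNReal.ofReal (F x) := (ProbabilityTheory.ofReal_cdf μ x).symm
      _ ≤ ENNReal.ofReal a := ENNReal.ofReal_le_ofReal (by rw [hx]; exact min_le_left _ _)
      _ = a := ENNReal.ofReal_coe_nnreal
  · rcases eq_or_lt_of_le ht with h0 | h0
    · simp [← h0]
    obtain ⟨x, hx⟩ := hex t ⟨h0, ht1⟩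
    rw [← hx, ProbabilityTheory.ofReal_cdf μ x]
    exact measure_mono fun y hy => hmono hy

/-- A Markov kernel from a finite partition of `[0,1]` is realized by a function of the point. -/
lemma exists_measurable_realizing {κ Y : Type} [Fintype κ] [MeasurableSpace κ]
    [MeasurableSingletonClass κ] [MeasurableSpace Y] [StandardBorelSpace Y] [Nonempty Y]
    {P : ℝ → κ} (hP : Measurable P) (K : ProbabilityTheory.Kernel κ Y)
    [ProbabilityTheory.IsMarkovKernel K] :
    ∃ ψ : ℝ → Y, Measurable ψ ∧ ∀ a B, MeasurableSet B →
      unifI (P ⁻¹' {a} ∩ ψ ⁻¹' B) = unifI (P ⁻¹' {a}) * K a B := by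
  obtain ⟨f, hf, hfK⟩ := K.exists_measurable_map_eq_unitInterval
  set μ : κ → Measure ℝ := fun a => ProbabilityTheory.cond unifI (P ⁻¹' {a}) with hμ
  have hproj : Measurable (Set.projIcc (0:ℝ) 1 zero_le_one) := continuous_projIcc.measurable
  have huni : unifI.map (Set.projIcc (0:ℝ) 1 zero_le_one) = volume := by
    have h1 : (volume : Measure unitInterval).map Subtype.val = unifI :=
      (MeasurePreserving.map_eq (measurePreserving_subtype_coe measurableSet_Icc))
    rw [← h1, Measure.map_map hproj measurable_subtype_coe]
    have : Set.projIcc (0:ℝ) 1 zero_le_one ∘ Subtype.val = id := by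
      ext x; simp
    rw [this, Measure.map_id]
  have hcdf : ∀ a, Measurable (ProbabilityTheory.cdf (μ a)) := fun a =>
    (ProbabilityTheory.monotone_cdf _).measurable
  set g : κ × ℝ → Y := fun p =>
    f p.1 (Set.projIcc (0:ℝ) 1 zero_le_one (ProbabilityTheory.cdf (μ p.1) p.2)) with hg
  have hgm : Measurable g := measurable_from_prod_countable_right fun a => by
    have : Measurable (f a) := hf.of_uncurry_left
    exact this.comp (hproj.comp (hcdf a))
  refine ⟨fun x => g (P x, x), hgm.comp (hP.prodMk measurable_id), fun a B hB => ?_⟩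
  have hPa : MeasurableSet (P ⁻¹' {a}) := hP (measurableSet_singleton a)
  by_cases h0 : unifI (P ⁻¹' {a}) = 0
  · rw [h0, zero_mul]
    exact measure_mono_null Set.inter_subset_left h0
  have hset : P ⁻¹' {a} ∩ (fun x => g (P x, x)) ⁻¹' B =
      P ⁻¹' {a} ∩ (fun x => g (a, x)) ⁻¹' B := by
    ext x
    simp only [Set.mem_inter_iff, Set.mem_preimage, Set.mem_singleton_iff]
    constructor <;> rintro ⟨rfl, h⟩ <;> exact ⟨rfl, h⟩
  have : IsProbabilityMeasure (μ a) := ProbabilityTheory.cond_isProbabilityMeasure h0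
  have : NullSingletonClass (μ a) := ⟨fun x => by
    exact ProbabilityTheory.cond_absolutelyContinuous (measure_singleton x)⟩
  have hfa : Measurable (f a) := hf.of_uncurry_left
  have hKa : (μ a).map (fun x => g (a, x)) = K a := by
    rw [← hfK a, ← huni, ← map_cdf_eq_unifI (μ a), Measure.map_map hproj (hcdf a),
      Measure.map_map hfa (hproj.comp (hcdf a))]
    rfl
  have hga : Measurable fun x => g (a, x) := hgm.comp measurable_prodMk_left
  rw [hset, ← hKa, Measure.map_apply hga hB, hμ, mul_comm]
  exact (ProbabilityTheory.cond_mul_eq_inter hPa _ _).symm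

end Realization

/-- Weak regularity: a bounded function of `r` variables is approximated in cut norm by a
step function with boundedly many steps. -/
theorem exists_step_approximation {r : ℕ} {f : (Fin r → ℝ) → ℝ} (hf : Measurable f)
    (hf1 : ∀ x, |f x| ≤ 1) {ε : ℝ} (hε : 0 < ε) :
    ∃ (k m : ℕ) (P : ℝ → Fin m) (h : (Fin r → Fin m) → ℝ), Measurable P ∧ k * ε ^ 2 ≤ 1 ∧
      m ≤ 2 ^ (r * k) ∧ (∀ a, |h a| ≤ k * ε) ∧ CutLE unifI (fun x => f x - h (P ∘ x)) ε := by
  classical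
  by_contra hcon
  have key : ∀ k : ℕ, ∃ (m : ℕ) (P : ℝ → Fin m) (h : (Fin r → Fin m) → ℝ), Measurable P ∧
      m ≤ 2 ^ (r * k) ∧ (∀ a, |h a| ≤ k * ε) ∧
      ∫ x, (f x - h (P ∘ x)) ^ 2 ∂(piUnif (Fin r)) ≤ 1 - k * ε ^ 2 := by
    intro k
    induction k with
    | zero =>
      refine ⟨1, fun _ => 0, fun _ => 0, measurable_const, by simp, by simp, ?_⟩
      have h1 : ∀ x, ‖(f x - 0) ^ 2‖ ≤ 1 := fun x => by
        rw [sub_zero, Real.norm_eq_abs, abs_pow]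
        exact pow_le_one₀ (abs_nonneg _) (hf1 x)
      have := norm_integral_le_of_norm_le_const (μ := piUnif (Fin r))
        (Filter.Eventually.of_forall h1)
      simp only [probReal_univ, mul_one] at this
      simpa using (le_abs_self _).trans this
    | succ k ih =>
      obtain ⟨m, P, h, hP, hm, hh, hE⟩ := ih
      have hPm : Measurable fun x : Fin r → ℝ => P ∘ x :=
        measurable_pi_lambda _ fun i => hP.comp (measurable_pi_apply i)
      have hhm : Measurable fun x : Fin r → ℝ => h (P ∘ x) :=
        (Measurable.of_discrete (f := h)).comp hPm
      set g : (Fin r → ℝ) → ℝ := fun x => f x - h (P ∘ x) with hg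
      have hgm : Measurable g := hf.sub hhm
      have hgB : ∀ x, |g x| ≤ 1 + k * ε := fun x =>
        (abs_sub _ _).trans (add_le_add (hf1 x) (hh _))
      have hkε : k * ε ^ 2 ≤ 1 := by
        have : 0 ≤ ∫ x, g x ^ 2 ∂(piUnif (Fin r)) := integral_nonneg fun x => sq_nonneg _
        linarith
      have hnot : ¬ CutLE unifI g ε := fun hc => hcon ⟨k, m, P, h, hP, hkε, hm, hh, hc⟩
      simp only [CutLE, not_forall, not_le] at hnot
      obtain ⟨S, hS, hlt⟩ := hnot
      change ε < |∫ x in Set.univ.pi S, g x ∂(piUnif (Fin r))| at hlt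
      obtain ⟨σ, hσ, hσlt⟩ : ∃ σ : ℝ, |σ| = 1 ∧
          ε < σ * ∫ x in Set.univ.pi S, g x ∂(piUnif (Fin r)) := by
        rcases abs_cases (∫ x in Set.univ.pi S, g x ∂(piUnif (Fin r))) with h1 | h1
        · exact ⟨1, by simp, by rw [one_mul, ← h1.1]; exact hlt⟩
        · exact ⟨-1, by simp, by rw [neg_one_mul, ← h1.1]; exact hlt⟩
      have hσ2 : σ ^ 2 = 1 := by rw [← sq_abs, hσ, one_pow]
      set e : Fin m × (Fin r → Bool) ≃ Fin (m * 2 ^ r) :=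
        (Fintype.equivFinOfCardEq (by simp)) with he
      set P' : ℝ → Fin (m * 2 ^ r) := fun x => e (P x, fun c => decide (x ∈ S c)) with hP'
      set h' : (Fin r → Fin (m * 2 ^ r)) → ℝ := fun a =>
        h (fun c => (e.symm (a c)).1) + if ∀ c, (e.symm (a c)).2 c = true then σ * ε else 0
        with hh'
      have hPi : MeasurableSet (Set.univ.pi S) := MeasurableSet.univ_pi hS
      have hval : ∀ x : Fin r → ℝ, f x - h' (P' ∘ x) =
          g x - (Set.univ.pi S).indicator (fun _ => σ * ε) x := by
        intro x
        simp only [hh', hP', hg, Function.comp_apply, Equiv.symm_apply_apply, decide_eq_true_eq,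
          Set.indicator, Set.mem_pi, Set.mem_univ, true_implies]
        have : (fun c => P (x c)) = P ∘ x := rfl
        rw [this]; ring
      refine ⟨m * 2 ^ r, P', h', ?_, ?_, ?_, ?_⟩
      · refine (Measurable.of_discrete (f := e)).comp (hP.prodMk ?_)
        refine measurable_pi_lambda _ fun c => ?_
        exact measurable_to_bool (by simpa [Set.preimage] using hS c)
      · calc m * 2 ^ r ≤ 2 ^ (r * k) * 2 ^ r := Nat.mul_le_mul_right _ hm
          _ = 2 ^ (r * (k + 1)) := by rw [← pow_add]; ring_nf
      · intro a
        simp only [hh']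
        refine (abs_add_le _ _).trans ?_
        push_cast
        rw [add_mul, one_mul]
        refine add_le_add (hh _) ?_
        split_ifs
        · rw [abs_mul, hσ, one_mul, abs_of_pos hε]
        · simpa using hε.le
      · have hsq : ∀ x : Fin r → ℝ, (f x - h' (P' ∘ x)) ^ 2 = g x ^ 2 -
            (Set.univ.pi S).indicator (fun x => 2 * ε * (σ * g x) - ε ^ 2) x := by
          intro x
          rw [hval]
          by_cases hx : x ∈ Set.univ.pi S
          · simp only [Set.indicator_of_mem hx]
            linear_combination ε ^ 2 * hσ2
          · simp only [Set.indicator_of_notMem hx]; ring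
        simp only [hsq]
        have hgi : Integrable g (piUnif (Fin r)) := integrable_of_bounded hgm hgB
        have hg2 : Integrable (fun x => g x ^ 2) (piUnif (Fin r)) :=
          integrable_of_bounded (hgm.pow_const 2) (B := (1 + k * ε) ^ 2) fun x => by
            rw [abs_pow]; exact pow_le_pow_left₀ (abs_nonneg _) (hgB x) 2
        have hi : Integrable (fun x => 2 * ε * (σ * g x) - ε ^ 2) (piUnif (Fin r)) :=
          ((hgi.const_mul σ).const_mul (2 * ε)).sub (integrable_const _)
        rw [integral_sub hg2 (hi.indicator hPi), integral_indicator hPi,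
          integral_sub ((hgi.const_mul σ).const_mul (2 * ε)).integrableOn
            (integrable_const _).integrableOn, integral_const_mul, integral_const_mul,
          setIntegral_const, smul_eq_mul]
        have hle1 : (piUnif (Fin r)).real (Set.univ.pi S) ≤ 1 := measureReal_le_one
        push_cast
        nlinarith [mul_pos hε hε, mul_lt_mul_of_pos_left hσlt hε]
  obtain ⟨k, hk⟩ := exists_nat_gt (1 / ε ^ 2)
  obtain ⟨m, P, h, -, -, -, hE⟩ := key k
  have h0 : 0 ≤ ∫ x, (f x - h (P ∘ x)) ^ 2 ∂(piUnif (Fin r)) := integral_nonneg fun x => sq_nonneg _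
  rw [div_lt_iff₀ (by positivity)] at hk
  linarith

section DiscreteCut

lemma integral_abs_average_sub_le {Ω : Type*} [MeasurableSpace Ω]
    (Λ : Measure Ω) [IsProbabilityMeasure Λ] {q : ℕ} (hq : 0 < q) {g : Ω → ℝ} (hg : Measurable g)
    {K : ℝ} (hK : 0 < K) (hgK : ∀ ω, |g ω| ≤ K) :
    ∫ t : Fin q → Ω, |(∫ ω, g ω ∂Λ) - (q : ℝ)⁻¹ * ∑ l, g (t l)| ∂(Measure.pi fun _ => Λ) ≤
      K / √q := by
  have hq' : (0 : ℝ) < q := by exact_mod_cast hq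
  have hm : MemLp g 2 Λ := MemLp.of_bound hg.aestronglyMeasurable K (ae_of_all _ hgK)
  have hv := ProbabilityTheory.variance_sum_pi (μ := fun _ : Fin q => Λ) (X := fun _ => g)
    fun _ => hm
  have hvg : ProbabilityTheory.variance g Λ ≤ K ^ 2 := by
    refine (ProbabilityTheory.variance_le_expectation_sq hg.aestronglyMeasurable).trans ?_
    calc ∫ ω, (g ^ 2) ω ∂Λ ≤ ∫ _, K ^ 2 ∂Λ := by
          refine integral_mono hm.integrable_sq (integrable_const _) fun ω => ?_
          simpa using sq_le_sq' (abs_le.1 (hgK ω)).1 (abs_le.1 (hgK ω)).2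
      _ = K ^ 2 := by simp
  set Θ : Measure (Fin q → Ω) := Measure.pi fun _ => Λ
  have hsm : Measurable fun t : Fin q → Ω => ∑ l, g (t l) := by fun_prop
  have hgi : ∀ l : Fin q, Integrable (fun t : Fin q → Ω => g (t l)) Θ := fun l =>
    integrable_of_bounded (hg.comp (measurable_pi_apply l)) fun t => hgK _
  have hmean : ∫ t, ∑ l, g (t l) ∂Θ = q * ∫ ω, g ω ∂Λ := by
    rw [integral_finsetSum _ fun l _ => hgi l]
    have : ∀ l : Fin q, ∫ t, g (t l) ∂Θ = ∫ ω, g ω ∂Λ := fun l =>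
      integral_comp_eval (μ := fun _ : Fin q => Λ) (i := l) hg.aestronglyMeasurable
    simp [this]
  have heq : (∑ i : Fin q, fun ω : Fin q → Ω => g (ω i)) = fun t => ∑ l, g (t l) := by
    ext t; simp
  rw [heq, ProbabilityTheory.variance_eq_integral hsm.aemeasurable, hmean] at hv
  set s : ℝ := K / √q
  have hs : 0 < s := by positivity
  have hs2 : s ^ 2 = K ^ 2 / q := by simp [s, div_pow, hq'.le]
  have hsb : ∀ t : Fin q → Ω, |∑ l, g (t l)| ≤ q * K := fun t =>
    (Finset.abs_sum_le_sum_abs _ _).trans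
      ((Finset.sum_le_sum fun l _ => hgK (t l)).trans (by simp))
  set e := ∫ ω, g ω ∂Λ
  have hsq : Integrable (fun t : Fin q → Ω => (∑ l, g (t l) - q * e) ^ 2) Θ := by
    refine integrable_of_bounded (B := (q * K + |q * e|) ^ 2) (by fun_prop) fun t => ?_
    rw [abs_pow]
    gcongr
    exact (abs_sub _ _).trans (by gcongr; exact hsb t)
  calc ∫ t, |e - (q : ℝ)⁻¹ * ∑ l, g (t l)| ∂Θ
      ≤ ∫ t, ((2 * s * q ^ 2)⁻¹ * (∑ l, g (t l) - q * e) ^ 2 + s / 2) ∂Θ := by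
        refine integral_mono ?_ ((hsq.const_mul _).add (integrable_const _)) fun t => ?_
        · refine integrable_of_bounded (B := |e| + (q : ℝ)⁻¹ * (q * K)) (by fun_prop) fun t => ?_
          rw [abs_abs]
          refine (abs_sub _ _).trans ?_
          rw [abs_mul, abs_of_nonneg (inv_nonneg.2 hq'.le)]
          gcongr
          exact hsb t
        · set w := e - (q : ℝ)⁻¹ * ∑ l, g (t l)
          have hw : ∑ l, g (t l) - q * e = -q * w := by
            simp only [w]; field_simp; ring
          have h2 : (2 * s * (q : ℝ) ^ 2)⁻¹ * (-q * w) ^ 2 = w ^ 2 / (2 * s) := by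
            field_simp
          simp only [hw, h2]
          rw [div_add_div _ _ (by positivity) two_ne_zero, le_div_iff₀ (by positivity)]
          nlinarith [sq_nonneg (|w| - s), sq_abs w]
    _ = (2 * s * q ^ 2)⁻¹ * ∑ _i : Fin q, ProbabilityTheory.variance g Λ + s / 2 := by
        rw [integral_add (hsq.const_mul _) (integrable_const _), integral_const_mul, hv]
        simp
    _ ≤ (2 * s * q ^ 2)⁻¹ * (q * K ^ 2) + s / 2 := by
        gcongr; simpa using mul_le_mul_of_nonneg_left hvg hq'.le
    _ = s := by
        have : K ^ 2 = s ^ 2 * q := by rw [hs2]; field_simp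
        rw [this]; field_simp; ring

variable {X : Type*} [Fintype X] [MeasurableSpace X] [MeasurableSingletonClass X] {r : ℕ}

/-- The points `v` for which the sections of `A` at coordinate `c` through the tuples `t l`,
`l ∈ L`, have positive sum. -/
def posSection (A : (Fin r → X) → ℝ) (c : Fin r) {q : ℕ} (t : Fin q → Fin r → X)
    (L : Finset (Fin q)) : Set X :=
  {v | 0 < ∑ l ∈ L, A (Function.update (t l) c v)}

lemma setIntegral_pi_update (lam : Measure X) [IsProbabilityMeasure lam] (A : (Fin r → X) → ℝ)
    (S : Fin r → Set X) (c : Fin r) (B : Set X) :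
    ∫ i in Set.univ.pi (Function.update S c B), A i ∂(Measure.pi fun _ => lam) =
      ∫ v, B.indicator (fun v => ∫ i, {i : Fin r → X | ∀ c' ≠ c, i c' ∈ S c'}.indicator
        (fun i => A (Function.update i c v)) i ∂(Measure.pi fun _ => lam)) v ∂lam := by
  classical
  rw [← integral_indicator (Set.toFinite _).measurableSet]
  have hfin : ∃ K, ∀ i, |(Set.univ.pi (Function.update S c B)).indicator A i| ≤ K := by
    obtain ⟨K, hK⟩ := (Set.finite_range
      fun i => |(Set.univ.pi (Function.update S c B)).indicator A i|).bddAbove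
    exact ⟨K, fun i => hK ⟨i, rfl⟩⟩
  obtain ⟨K, hK⟩ := hfin
  rw [← integral_pi_update lam c (Measurable.of_discrete) hK,
    integral_integral_swap (Integrable.of_finite)]
  congr 1
  ext v
  by_cases hv : v ∈ B
  · rw [Set.indicator_of_mem hv]
    congr 1
    ext i
    simp only [Set.indicator_apply, Set.mem_univ_pi]
    congr 1
    refine propext ⟨fun h c' hc' => ?_, fun h c' => ?_⟩
    · simpa [hc'] using h c'
    · by_cases hc' : c' = c
      · subst hc'; simpa using hv
      · simpa [hc'] using h c' hc'
  · rw [Set.indicator_of_notMem hv]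
    rw [← integral_zero]
    congr 1
    ext i
    refine Set.indicator_of_notMem (fun h => hv ?_) _
    simpa using h c (Set.mem_univ _)

lemma exists_setIntegral_le_posSection (lam : Measure X) [IsProbabilityMeasure lam]
    {A : (Fin r → X) → ℝ} {K : ℝ} (hK : 0 < K) (hA : ∀ i, |A i| ≤ K) {q : ℕ} (hq : 0 < q)
    (S : Fin r → Set X) (c : Fin r) :
    ∃ L : (Fin q → Fin r → X) → Finset (Fin q),
      ∫ i in Set.univ.pi S, A i ∂(Measure.pi fun _ => lam) ≤
        ∫ t, (∫ i in Set.univ.pi (Function.update S c (posSection A c t (L t))), A i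
          ∂(Measure.pi fun _ => lam)) ∂(Measure.pi fun _ : Fin q => Measure.pi fun _ => lam) +
        K / √q := by
  classical
  set Λ : Measure (Fin r → X) := Measure.pi fun _ => lam
  set E : Set (Fin r → X) := {i | ∀ c' ≠ c, i c' ∈ S c'}
  let G : X → (Fin r → X) → ℝ := fun v => E.indicator fun i => A (Function.update i c v)
  let a : X → ℝ := fun v => ∫ i, G v i ∂Λ
  let b : (Fin q → Fin r → X) → X → ℝ := fun t v => (q : ℝ)⁻¹ * ∑ l, G v (t l)
  have hq' : (0 : ℝ) < q := by exact_mod_cast hq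
  refine ⟨fun t => Finset.univ.filter fun l => t l ∈ E, ?_⟩
  have hG : ∀ v i, |G v i| ≤ K := fun v i => by
    by_cases hi : i ∈ E
    · simp only [G, Set.indicator_of_mem hi]; exact hA _
    · simp only [G, Set.indicator_of_notMem hi, abs_zero]; exact hK.le
  have hpos : ∀ t v, v ∈ posSection A c t (Finset.univ.filter fun l => t l ∈ E) ↔
      0 < b t v := fun t v => by
    simp only [posSection, Set.mem_ofPred_eq, b, mul_pos_iff_of_pos_left (inv_pos.2 hq'), G,
      Set.indicator_apply, Finset.sum_filter]
  have hR : ∀ B, ∫ i in Set.univ.pi (Function.update S c B), A i ∂Λ =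
      ∫ v, B.indicator a v ∂lam := setIntegral_pi_update lam A S c
  have hS := hR (S c)
  rw [Function.update_eq_self] at hS
  rw [hS]
  simp only [hR]
  change ∫ v, (S c).indicator a v ∂lam ≤ ∫ t, (∫ v, (posSection A c t
    (Finset.univ.filter fun l => t l ∈ E)).indicator a v ∂lam)
      ∂(Measure.pi fun _ : Fin q => Λ) + K / √q
  have hpt : ∀ t, ∫ v, (S c).indicator a v ∂lam ≤ (∫ v, (posSection A c t
      (Finset.univ.filter fun l => t l ∈ E)).indicator a v ∂lam) + ∫ v, |a v - b t v| ∂lam := by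
    intro t
    rw [← integral_add Integrable.of_finite Integrable.of_finite]
    refine integral_mono Integrable.of_finite Integrable.of_finite fun v => ?_
    by_cases h1 : v ∈ posSection A c t (Finset.univ.filter fun l => t l ∈ E)
    · have h2 := (hpos t v).1 h1
      simp only [Set.indicator_of_mem h1]
      by_cases h3 : v ∈ S c
      · rw [Set.indicator_of_mem h3]; linarith [abs_nonneg (a v - b t v)]
      · rw [Set.indicator_of_notMem h3]; linarith [neg_abs_le (a v - b t v)]
    · have h2 : b t v ≤ 0 := not_lt.1 fun h => h1 ((hpos t v).2 h)
      simp only [Set.indicator_of_notMem h1]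
      by_cases h3 : v ∈ S c
      · rw [Set.indicator_of_mem h3]; linarith [le_abs_self (a v - b t v)]
      · rw [Set.indicator_of_notMem h3]; linarith [abs_nonneg (a v - b t v)]
  set Θ : Measure (Fin q → Fin r → X) := Measure.pi fun _ => Λ
  calc ∫ v, (S c).indicator a v ∂lam = ∫ _, (∫ v, (S c).indicator a v ∂lam) ∂Θ := by simp
    _ ≤ ∫ t, ((∫ v, (posSection A c t
      (Finset.univ.filter fun l => t l ∈ E)).indicator a v ∂lam) + ∫ v, |a v - b t v| ∂lam) ∂Θ :=
        integral_mono Integrable.of_finite Integrable.of_finite hpt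
    _ ≤ _ := by
        rw [integral_add Integrable.of_finite Integrable.of_finite]
        refine add_le_add le_rfl ?_
        rw [integral_integral_swap Integrable.of_finite]
        calc ∫ v, ∫ t, |a v - b t v| ∂Θ ∂lam ≤ ∫ _, K / √q ∂lam :=
              integral_mono Integrable.of_finite Integrable.of_finite fun v =>
                integral_abs_average_sub_le Λ hq Measurable.of_discrete hK (hG v)
          _ = K / √q := by simp

lemma exists_setIntegral_le_integral_posSection (lam : Measure X) [IsProbabilityMeasure lam]
    {A : (Fin r → X) → ℝ} {K : ℝ} (hK : 0 < K) (hA : ∀ i, |A i| ≤ K) {q : ℕ} (hq : 0 < q)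
    (S : Fin r → Set X) :
    ∃ L : (Fin r → Fin q → Fin r → X) → Fin r → Finset (Fin q),
      ∫ i in Set.univ.pi S, A i ∂(Measure.pi fun _ => lam) ≤
        ∫ t, (∫ i in Set.univ.pi (fun c => posSection A c (t c) (L t c)), A i
          ∂(Measure.pi fun _ => lam))
          ∂(Measure.pi fun _ : Fin r => Measure.pi fun _ : Fin q => Measure.pi fun _ => lam) +
        r * (K / √q) := by
  classical
  set Λ : Measure (Fin r → X) := Measure.pi fun _ => lam
  set Θ : Measure (Fin q → Fin r → X) := Measure.pi fun _ => Λ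
  have key : ∀ J : Finset (Fin r), ∃ L : (Fin r → Fin q → Fin r → X) → Fin r → Finset (Fin q),
      ∫ i in Set.univ.pi S, A i ∂Λ ≤
        ∫ t, (∫ i in Set.univ.pi (fun c => if c ∈ J then posSection A c (t c) (L t c) else S c),
          A i ∂Λ) ∂(Measure.pi fun _ : Fin r => Θ) + J.card * (K / √q) := by
    intro J
    induction J using Finset.induction_on with
    | empty => exact ⟨fun _ _ => ∅, by simp⟩
    | insert c J hc ih =>
      obtain ⟨L, hL⟩ := ih
      let S' : (Fin r → Fin q → Fin r → X) → Fin r → Set X := fun t c' =>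
        if c' ∈ J then posSection A c' (t c') (L t c') else S c'
      choose L' hL' using fun t => exists_setIntegral_le_posSection lam hK hA hq (S' t) c
      let Φ : (Fin r → Fin q → Fin r → X) → (Fin r → Finset (Fin q)) → ℝ := fun t k =>
        ∫ i in Set.univ.pi (fun c' => if c' ∈ insert c J then posSection A c' (t c') (k c')
          else S c'), A i ∂Λ
      have hmax : ∀ t, ∃ k, ∀ k', Φ t k' ≤ Φ t k := fun t => Finite.exists_max (Φ t)
      choose k hk using hmax
      refine ⟨k, ?_⟩
      have hstep : ∀ t, (∫ i in Set.univ.pi (S' t), A i ∂Λ) ≤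
          (∫ t', Φ (Function.update t c t') (k (Function.update t c t')) ∂Θ) + K / √q := by
        intro t
        refine (hL' t).trans (add_le_add ?_ le_rfl)
        refine integral_mono Integrable.of_finite Integrable.of_finite fun t' => ?_
        refine le_trans (le_of_eq ?_) (hk _ (Function.update (L t) c (L' t t')))
        simp only [Φ]
        congr 3
        ext1 c'
        by_cases h : c' = c
        · subst h; simp
        · simp [h, S']
      have hb : ∃ B, ∀ t, |Φ t (k t)| ≤ B := by
        obtain ⟨B, hB⟩ := (Set.finite_range fun t => |Φ t (k t)|).bddAbove
        exact ⟨B, fun i => hB ⟨i, rfl⟩⟩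
      obtain ⟨B, hB⟩ := hb
      have h1 := integral_mono (μ := Measure.pi fun _ : Fin r => Θ) Integrable.of_finite
        Integrable.of_finite hstep
      rw [integral_add Integrable.of_finite Integrable.of_finite,
        integral_pi_update Θ c Measurable.of_discrete hB] at h1
      rw [Finset.card_insert_of_notMem hc]
      push_cast
      have h2 : ∫ _t : Fin r → Fin q → Fin r → X, K / √q ∂(Measure.pi fun _ : Fin r => Θ) =
        K / √q := by simp
      rw [h2] at h1
      change _ ≤ ∫ t, Φ t (k t) ∂_ + _
      change _ ≤ (∫ t, (∫ i in Set.univ.pi (S' t), A i ∂Λ) ∂_) + _ at hL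
      linarith
  obtain ⟨L, hL⟩ := key Finset.univ
  exact ⟨L, by simpa using hL⟩

/-- The integral of `±A` over the box of `posSection`s of `±A`. -/
def boxValue (lam : Measure X) (A : (Fin r → X) → ℝ) {q : ℕ} (t : Fin r → Fin q → Fin r → X)
    (k : Bool × (Fin r → Finset (Fin q))) : ℝ :=
  ∫ i in Set.univ.pi (fun c => posSection (fun i => (if k.1 then 1 else -1) * A i) c (t c) (k.2 c)),
    (if k.1 then 1 else -1) * A i ∂(Measure.pi fun _ => lam)

/-- The cut norm of a bounded function on a finite space is controlled by boxes defined from few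
random samples. -/
theorem abs_setIntegral_le_integral_iSup_boxValue (lam : Measure X) [IsProbabilityMeasure lam]
    {A : (Fin r → X) → ℝ} {K : ℝ} (hK : 0 < K) (hA : ∀ i, |A i| ≤ K) {q : ℕ} (hq : 0 < q)
    (S : Fin r → Set X) :
    |∫ i in Set.univ.pi S, A i ∂(Measure.pi fun _ => lam)| ≤
      ∫ t, (⨆ k : Bool × (Fin r → Finset (Fin q)), boxValue lam A t k)
          ∂(Measure.pi fun _ : Fin r => Measure.pi fun _ : Fin q => Measure.pi fun _ => lam) +
        r * (K / √q) := by
  have main : ∀ b : Bool, (if b then 1 else -1) * ∫ i in Set.univ.pi S, A i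
      ∂(Measure.pi fun _ => lam) ≤
      ∫ t, (⨆ k : Bool × (Fin r → Finset (Fin q)), boxValue lam A t k)
          ∂(Measure.pi fun _ : Fin r => Measure.pi fun _ : Fin q => Measure.pi fun _ => lam) +
        r * (K / √q) := by
    intro b
    have hA' : ∀ i, |(if b then 1 else -1) * A i| ≤ K := fun i => by
      cases b <;> simpa using hA i
    obtain ⟨L, hL⟩ := exists_setIntegral_le_integral_posSection lam hK hA' hq S
    rw [integral_const_mul] at hL
    refine hL.trans (add_le_add ?_ le_rfl)
    refine integral_mono Integrable.of_finite Integrable.of_finite fun t => ?_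
    exact le_ciSup (f := fun k => boxValue lam A t k) (Set.finite_range _).bddAbove (b, L t)
  have h1 := main true
  have h2 := main false
  simp only [if_true, Bool.false_eq_true, if_false] at h1 h2
  exact abs_le.2 ⟨by linarith, by linarith⟩

end DiscreteCut

lemma integral_le_of_bounded_differences_family {ι X κ : Type*} [Fintype ι] [DecidableEq ι]
    [MeasurableSpace X] (μ : Measure X) [IsProbabilityMeasure μ] [Fintype κ] (c : ι → ℝ)
    {M : (ι → X) → ℝ} {Y : κ → (ι → X) → ℝ} {B b σ ℓ : ℝ} (hM : Measurable M)
    (hMB : ∀ x, |M x| ≤ B) (hY : ∀ k, Measurable (Y k)) (hYB : ∀ k x, |Y k x| ≤ B)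
    (hle : ∀ x, ∃ k, M x ≤ Y k x)
    (hc : ∀ k x i v, |Y k (Function.update x i v) - Y k x| ≤ c i)
    (hmean : ∀ k, ∫ x, Y k x ∂(Measure.pi fun _ => μ) ≤ b)
    (hσ : 0 < σ) (hcσ : ∑ i, c i ^ 2 ≤ σ) (hℓ : 0 < ℓ) (hcard : Real.log (Fintype.card κ) ≤ ℓ) :
    ∫ x, M x ∂(Measure.pi fun _ => μ) ≤ b + √(ℓ * σ / 2) := by
  refine integral_le_of_forall_exists_le hM hMB hY hYB hle hσ hℓ hcard fun k t ht => ?_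
  set m := ∫ x, Y k x ∂(Measure.pi fun _ => μ)
  have hm : |m| ≤ B := by
    have := norm_integral_le_of_norm_le_const (μ := Measure.pi fun _ : ι => μ)
      (f := Y k) (C := B) (ae_of_all _ (hYB k))
    simpa using this
  have hb : ∀ b' x, |Real.exp (t * (Y k x - b'))| ≤ Real.exp (t * (B - b')) := fun b' x => by
    rw [Real.abs_exp]
    gcongr
    exact (abs_le.1 (hYB k x)).2
  have hYk := hY k
  calc ∫ x, Real.exp (t * (Y k x - b)) ∂(Measure.pi fun _ => μ)
      ≤ ∫ x, Real.exp (t * (Y k x - m)) ∂(Measure.pi fun _ => μ) := by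
        refine integral_mono (integrable_of_bounded (by fun_prop) (hb b))
          (integrable_of_bounded (by fun_prop) (hb m)) fun x => ?_
        have := hmean k
        dsimp only
        gcongr
    _ ≤ Real.exp ((t ^ 2 * ∑ i, c i ^ 2) / 8) :=
        integral_exp_le_of_bounded_differences μ c hYk (hc k) t
    _ ≤ _ := by gcongr

section UnifFin

/-- The uniform measure on `Fin n`. -/
def unifFin (n : ℕ) : Measure (Fin n) := (n : ENNReal)⁻¹ • Measure.count

variable {n : ℕ} [NeZero n]

instance : IsProbabilityMeasure (unifFin n) := ⟨by
  simp only [unifFin, Measure.smul_apply, Measure.count_univ, smul_eq_mul, ENat.card_eq_coe_fintype_card,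
    Fintype.card_fin]
  exact ENNReal.inv_mul_cancel (by simp [NeZero.ne n]) (by simp)⟩

omit [NeZero n] in
lemma unifFin_singleton (a : Fin n) : unifFin n {a} = (n : ENNReal)⁻¹ := by
  simp [unifFin]

omit [NeZero n] in
lemma unifFin_real_singleton (a : Fin n) : (unifFin n).real {a} = (n : ℝ)⁻¹ := by
  simp [Measure.real, unifFin_singleton]

variable {r : ℕ}

lemma unifFin_pi_eq_real (c : Fin r) (g : (Fin r → Fin n) → Fin n)
    (hg : ∀ i v, g (Function.update i c v) = g i) :
    (Measure.pi fun _ : Fin r => unifFin n).real {i | i c = g i} = (n : ℝ)⁻¹ := by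
  classical
  rw [← integral_indicator_one (Set.toFinite _).measurableSet,
    ← integral_pi_update (B := 1) (unifFin n) c Measurable.of_discrete]
  · have : ∀ i : Fin r → Fin n, ∫ v, {i : Fin r → Fin n | i c = g i}.indicator (1 : (Fin r → Fin n) → ℝ)
        (Function.update i c v) ∂(unifFin n) = (n : ℝ)⁻¹ := fun i => by
      rw [← unifFin_real_singleton (g i), ← integral_indicator_one (Set.toFinite _).measurableSet]
      congr 1
      ext v
      simp [Set.indicator_apply, hg]
    simp [this]
  · intro i
    by_cases h : i c = g i <;> simp [h]

lemma unifFin_pi_hit_le (a : Fin n) :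
    (Measure.pi fun _ : Fin r => unifFin n).real {i | ∃ c, i c = a} ≤ r / n := by
  rw [show {i : Fin r → Fin n | ∃ c, i c = a} = ⋃ c, {i | i c = a} by ext; simp]
  refine (measureReal_iUnion_fintype_le _).trans (le_of_eq ?_)
  simp [unifFin_pi_eq_real _ (fun _ => a), div_eq_mul_inv]

lemma unifFin_pi_bad_le (I : Finset (Fin n)) :
    (Measure.pi fun _ : Fin r => unifFin n).real
      {i | ¬ (Function.Injective i ∧ ∀ c, i c ∉ I)} ≤ (r ^ 2 + r * I.card) / n := by
  have hsub : {i : Fin r → Fin n | ¬ (Function.Injective i ∧ ∀ c, i c ∉ I)} ⊆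
      (⋃ p ∈ (Finset.univ : Finset (Fin r × Fin r)).filter (fun p => p.1 ≠ p.2),
        {i | i p.1 = i p.2}) ∪ ⋃ a ∈ I, {i | ∃ c, i c = a} := by
    intro i hi
    simp only [Set.mem_ofPred_eq, not_and_or, not_forall, not_not, Function.Injective] at hi
    rcases hi with ⟨c, c', h, hne⟩ | ⟨c, hc⟩
    · left
      simp only [Set.mem_iUnion]
      exact ⟨(c, c'), by simpa using hne, h⟩
    · right
      simp only [Set.mem_iUnion]
      exact ⟨i c, hc, c, rfl⟩
  refine (measureReal_mono hsub).trans ((measureReal_union_le _ _).trans ?_)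
  rw [add_div]
  refine add_le_add ?_ ?_
  · refine (measureReal_biUnion_finset_le _ _).trans ?_
    refine (Finset.sum_le_sum (g := fun _ => (n : ℝ)⁻¹) fun p hp => ?_).trans ?_
    · refine (unifFin_pi_eq_real p.1 (fun i => i p.2) fun i v => ?_).le
      have : p.2 ≠ p.1 := fun h => (Finset.mem_filter.1 hp).2 h.symm
      simp [this]
    · rw [Finset.sum_const, nsmul_eq_mul, div_eq_mul_inv]
      gcongr
      refine (Nat.cast_le.2 (Finset.card_filter_le _ _)).trans ?_
      simp [pow_two]
  · refine (measureReal_biUnion_finset_le _ _).trans ?_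
    refine (Finset.sum_le_sum fun a _ => unifFin_pi_hit_le a).trans ?_
    rw [Finset.sum_const, nsmul_eq_mul]
    exact le_of_eq (by ring)

/-- Averages over index tuples have small differences when the integrands agree away from one
index. -/
lemma abs_integral_sub_integral_le_of_eq_off {F G : (Fin r → Fin n) → ℝ} {K : ℝ}
    {E : Set (Fin r → Fin n)} (h : ∀ i ∉ E, F i = G i) (hF : ∀ i, |F i - G i| ≤ K) :
    |(∫ i, F i ∂(Measure.pi fun _ => unifFin n)) - ∫ i, G i ∂(Measure.pi fun _ => unifFin n)| ≤
      K * (Measure.pi fun _ : Fin r => unifFin n).real E := by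
  classical
  rw [← integral_sub Integrable.of_finite Integrable.of_finite]
  refine (abs_integral_le_integral_abs).trans ?_
  calc ∫ i, |F i - G i| ∂(Measure.pi fun _ => unifFin n)
      ≤ ∫ i, E.indicator (fun _ => K) i ∂(Measure.pi fun _ : Fin r => unifFin n) := by
        refine integral_mono Integrable.of_finite Integrable.of_finite fun i => ?_
        by_cases hi : i ∈ E
        · simpa [hi] using hF i
        · simp [hi, h i hi]
    _ = _ := by
        rw [integral_indicator (Set.toFinite _).measurableSet]
        simp [mul_comm]

end UnifFin

lemma map_comp_injective_pi {ι κ X : Type*} [Fintype ι] [Fintype κ] [MeasurableSpace X]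
    (μ : Measure X) [IsProbabilityMeasure μ] {i : ι → κ} (hi : Function.Injective i) :
    MeasurePreserving (fun y : κ → X => y ∘ i) (Measure.pi fun _ => μ) (Measure.pi fun _ => μ) := by
  classical
  have hm : Measurable fun y : κ → X => y ∘ i := measurable_pi_lambda _ fun a =>
    measurable_pi_apply _
  refine ⟨hm, (Measure.pi_eq fun s hs => ?_).symm⟩
  rw [Measure.map_apply hm (MeasurableSet.univ_pi hs)]
  have : (fun y : κ → X => y ∘ i) ⁻¹' Set.univ.pi s =
      Set.univ.pi (Function.extend i s fun _ => Set.univ) := by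
    ext y
    simp only [Set.mem_preimage, Set.mem_univ_pi, Function.comp_apply]
    refine ⟨fun h b => ?_, fun h a => by simpa [hi.extend_apply] using h (i a)⟩
    by_cases hb : ∃ a, i a = b
    · obtain ⟨a, rfl⟩ := hb; simpa [hi.extend_apply] using h a
    · simp [Function.extend_apply' _ _ _ hb]
  rw [this, Measure.pi_pi]
  refine (Fintype.prod_of_injective i hi _ _ (fun b hb => ?_) fun a => ?_).symm
  · rw [Function.extend_apply' _ _ _ (by simpa using hb)]; simp
  · rw [hi.extend_apply]

section SamplePoints

variable {n r q : ℕ} [NeZero n] {f : (Fin r → ℝ) → ℝ}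

lemma measurable_boxValue (hf : Measurable f) (t : Fin r → Fin q → Fin r → Fin n)
    (k : Bool × (Fin r → Finset (Fin q))) :
    Measurable fun x : Fin n → ℝ => boxValue (unifFin n) (fun i => f (x ∘ i)) t k := by
  classical
  have hcomp : ∀ i : Fin r → Fin n, Measurable fun x : Fin n → ℝ => f (x ∘ i) := fun i =>
    hf.comp (measurable_pi_lambda _ fun c => measurable_pi_apply (i c))
  have : (fun x : Fin n → ℝ => boxValue (unifFin n) (fun i => f (x ∘ i)) t k) = fun x =>
      ∑ i : Fin r → Fin n, (Measure.pi fun _ => unifFin n).real {i} *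
        if ∀ c, 0 < ∑ l ∈ k.2 c, (if k.1 then 1 else -1) * f (x ∘ Function.update (t c l) c (i c))
          then (if k.1 then 1 else -1) * f (x ∘ i) else 0 := by
    ext x
    rw [boxValue, ← integral_indicator (Set.toFinite _).measurableSet,
      integral_fintype Integrable.of_finite]
    simp only [smul_eq_mul, Set.indicator_apply, Set.mem_univ_pi, posSection, Set.mem_ofPred_eq]
  rw [this]
  refine Finset.measurable_sum _ fun i _ => Measurable.const_mul (Measurable.ite ?_ ?_ ?_) _
  · have : {x : Fin n → ℝ | ∀ c, 0 < ∑ l ∈ k.2 c, (if k.1 then 1 else -1) *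
        f (x ∘ Function.update (t c l) c (i c))} = ⋂ c, {x | 0 < ∑ l ∈ k.2 c,
        (if k.1 then 1 else -1) * f (x ∘ Function.update (t c l) c (i c))} := by
      ext; simp
    rw [this]
    exact MeasurableSet.iInter fun c => measurableSet_lt measurable_const
      (Finset.measurable_sum _ fun l _ => (hcomp _).const_mul _)
  · exact (hcomp _).const_mul _
  · exact measurable_const

lemma abs_integral_le_of_abs_le {Ω : Type*} [MeasurableSpace Ω] {μ : Measure Ω}
    [IsProbabilityMeasure μ] {g : Ω → ℝ} {B : ℝ} (h : ∀ x, |g x| ≤ B) : |∫ x, g x ∂μ| ≤ B := by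
  have := norm_integral_le_of_norm_le_const (μ := μ) (f := g) (C := B) (ae_of_all _ h)
  simpa using this

lemma abs_setIntegral_le_of_abs_le {Ω : Type*} [MeasurableSpace Ω] {μ : Measure Ω}
    [IsProbabilityMeasure μ] {g : Ω → ℝ} {B : ℝ} (h : ∀ x, |g x| ≤ B) {s : Set Ω}
    (hs : MeasurableSet s) : |∫ x in s, g x ∂μ| ≤ B := by
  rw [← integral_indicator hs]
  refine abs_integral_le_of_abs_le fun x => ?_
  by_cases hx : x ∈ s
  · simpa [hx] using h x
  · simpa [hx] using (abs_nonneg _).trans (h x)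

lemma abs_ite_mul {b : Bool} {x : ℝ} : |(if b then 1 else -1) * x| = |x| := by
  cases b <;> simp

lemma abs_boxValue_le {A : (Fin r → Fin n) → ℝ} {K : ℝ} (hA : ∀ i, |A i| ≤ K)
    (t : Fin r → Fin q → Fin r → Fin n) (k : Bool × (Fin r → Finset (Fin q))) :
    |boxValue (unifFin n) A t k| ≤ K :=
  abs_setIntegral_le_of_abs_le (fun i => by rw [abs_ite_mul]; exact hA i)
    (Set.toFinite _).measurableSet

lemma integral_average_comp_le {g : (Fin r → ℝ) → ℝ} (hg : Measurable g) {K ε : ℝ}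
    (hgK : ∀ v, |g v| ≤ K) (hgε : ∫ v, g v ∂piUnif (Fin r) ≤ ε) (hε : 0 ≤ ε)
    (I : Finset (Fin n)) (z : Fin n → ℝ) :
    ∫ y, (∫ i, g ((fun a => if a ∈ I then z a else y a) ∘ i) ∂(Measure.pi fun _ => unifFin n))
        ∂piUnif (Fin n) ≤ ε + K * ((r ^ 2 + r * I.card) / n) := by
  classical
  have hK : 0 ≤ K := (abs_nonneg _).trans (hgK 0)
  have hmix : Measurable fun p : (Fin n → ℝ) × (Fin r → Fin n) =>
      (fun a => if a ∈ I then z a else p.1 a) ∘ p.2 := by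
    refine measurable_from_prod_countable_left fun i => measurable_pi_lambda _ fun c => ?_
    by_cases h : i c ∈ I
    · simp [h]
    · simp only [Function.comp_apply, h, if_false]; exact measurable_pi_apply _
  rw [integral_integral_swap (f := fun (y : Fin n → ℝ) (i : Fin r → Fin n) => g ((fun a => if a ∈ I then z a else y a) ∘ i))
    (integrable_of_bounded (hg.comp hmix) fun p => hgK _)]
  set E : Set (Fin r → Fin n) := {i | ¬ (Function.Injective i ∧ ∀ c, i c ∉ I)}
  calc ∫ i, (∫ y, g ((fun a => if a ∈ I then z a else y a) ∘ i) ∂piUnif (Fin n))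
        ∂(Measure.pi fun _ => unifFin n)
      ≤ ∫ i, (ε + E.indicator (fun _ => K) i) ∂(Measure.pi fun _ => unifFin n) := by
        refine integral_mono Integrable.of_finite Integrable.of_finite fun i => ?_
        by_cases hi : i ∈ E
        · simp only [hi, Set.indicator_of_mem]
          have := (abs_le.1 (abs_integral_le_of_abs_le (μ := piUnif (Fin n))
            (g := fun y => g ((fun a => if a ∈ I then z a else y a) ∘ i)) fun y => hgK _)).2
          linarith
        · simp only [hi, not_false_eq_true, Set.indicator_of_notMem, add_zero]
          simp only [E, Set.mem_ofPred_eq, not_not] at hi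
          have h1 : ∀ y : Fin n → ℝ, (fun a => if a ∈ I then z a else y a) ∘ i = y ∘ i := by
            intro y; ext c; simp [hi.2 c]
          simp only [h1]
          have h2 := map_comp_injective_pi unifI hi.1
          refine le_trans (le_of_eq ?_) hgε
          unfold piUnif
          rw [← h2.map_eq, integral_map h2.measurable.aemeasurable hg.aestronglyMeasurable]
    _ = ε + K * (Measure.pi fun _ : Fin r => unifFin n).real E := by
        rw [integral_add Integrable.of_finite Integrable.of_finite,
          integral_indicator (Set.toFinite _).measurableSet]
        simp [mul_comm]
    _ ≤ _ := by gcongr; exact unifFin_pi_bad_le I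

omit [NeZero n] in
lemma card_used_le (t : Fin r → Fin q → Fin r → Fin n) :
    ((Finset.univ : Finset (Fin r × Fin q × Fin r)).image
      fun p => t p.1 p.2.1 p.2.2).card ≤ r * (q * r) := by
  refine Finset.card_image_le.trans ?_
  simp

lemma log_card_le (hr : 0 < r) :
    Real.log (Fintype.card (Bool × (Fin r → Finset (Fin q)))) ≤ r * q + 1 := by
  have h : (Fintype.card (Bool × (Fin r → Finset (Fin q))) : ℝ) = 2 ^ (r * q + 1) := by
    simp only [Fintype.card_prod, Fintype.card_bool, Fintype.card_pi, Fintype.card_finset,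
      Fintype.card_fin, Finset.prod_const, Finset.card_univ]
    push_cast
    rw [← pow_mul]; ring
  rw [h, Real.log_pow]
  have := Real.log_two_lt_d9
  have : Real.log 2 ≤ 1 := by linarith
  push_cast
  have h2 : (0 : ℝ) ≤ r * q + 1 := by positivity
  nlinarith

lemma integral_iSup_boxValue_le (hr : 0 < r) (hf : Measurable f) {K ε : ℝ} (hK : 0 < K)
    (hfK : ∀ v, |f v| ≤ K) (h : CutLE unifI f ε) (t : Fin r → Fin q → Fin r → Fin n) :
    ∫ x, (⨆ k, boxValue (unifFin n) (fun i => f (x ∘ i)) t k) ∂piUnif (Fin n) ≤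
      ε + K * ((r ^ 2 + r * (r * (q * r))) / n) + √((r * q + 1) * (4 * K ^ 2 * r ^ 2 / n) / 2) := by
  classical
  have hn : (0 : ℝ) < n := by exact_mod_cast Nat.pos_of_ne_zero (NeZero.ne n)
  have hr' : (0 : ℝ) < r := by exact_mod_cast hr
  set I : Finset (Fin n) := (Finset.univ : Finset (Fin r × Fin q × Fin r)).image
      fun p => t p.1 p.2.1 p.2.2
  have hI : ∀ c l c', t c l c' ∈ I := fun c l c' =>
    Finset.mem_image_of_mem (fun p : Fin r × Fin q × Fin r => t p.1 p.2.1 p.2.2)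
      (Finset.mem_univ (c, l, c'))
  let mix : (Fin n → ℝ) → (Fin n → ℝ) → Fin n → ℝ := fun z y a => if a ∈ I then z a else y a
  let M : (Fin n → ℝ) → ℝ := fun x => ⨆ k, boxValue (unifFin n) (fun i => f (x ∘ i)) t k
  have hMm : Measurable M := Measurable.iSup fun k => measurable_boxValue hf t k
  have hMB : ∀ x, |M x| ≤ K := fun x => by
    have hk : ∀ k, |boxValue (unifFin n) (fun i => f (x ∘ i)) t k| ≤ K := fun k =>
      abs_boxValue_le (fun i => hfK _) t k
    refine abs_le.2 ⟨?_, ciSup_le fun k => (abs_le.1 (hk k)).2⟩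
    exact (abs_le.1 (hk (true, fun _ => ∅))).1.trans
      (le_ciSup (f := fun k => boxValue (unifFin n) (fun i => f (x ∘ i)) t k)
        (Set.finite_range _).bddAbove (true, fun _ => ∅))
  have hmp := measurePreserving_mix_pi unifI I
  have hmixm : Measurable fun p : (Fin n → ℝ) × (Fin n → ℝ) => mix p.1 p.2 := hmp.measurable
  have hfub : ∫ x, M x ∂piUnif (Fin n) =
      ∫ z, (∫ y, M (mix z y) ∂piUnif (Fin n)) ∂piUnif (Fin n) := by
    unfold piUnif
    rw [← integral_prod (fun p : (Fin n → ℝ) × (Fin n → ℝ) => M (mix p.1 p.2))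
      (integrable_of_bounded (hMm.comp hmixm) fun p => hMB _)]
    conv_lhs => rw [← hmp.map_eq]
    rw [integral_map hmp.measurable.aemeasurable hMm.aestronglyMeasurable]
  change ∫ x, M x ∂piUnif (Fin n) ≤ _
  rw [hfub]
  suffices hz : ∀ z, ∫ y, M (mix z y) ∂piUnif (Fin n) ≤
      ε + K * ((r ^ 2 + r * (r * (q * r))) / n) +
        √((r * q + 1) * (4 * K ^ 2 * r ^ 2 / n) / 2) by
    calc ∫ z, (∫ y, M (mix z y) ∂piUnif (Fin n)) ∂piUnif (Fin n)
        ≤ ∫ _, (ε + K * ((r ^ 2 + r * (r * (q * r))) / n) +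
        √((r * q + 1) * (4 * K ^ 2 * r ^ 2 / n) / 2)) ∂piUnif (Fin n) := by
          refine integral_mono ?_ (integrable_const _) hz
          exact (integrable_of_bounded (μ := (piUnif (Fin n)).prod (piUnif (Fin n)))
            (hMm.comp hmixm) fun p => hMB _).integral_prod_left
      _ = _ := by simp
  intro z
  let S : (Bool × (Fin r → Finset (Fin q))) → Fin r → Set ℝ := fun k c =>
    {w | 0 < ∑ l ∈ k.2 c, (if k.1 then 1 else -1) * f (Function.update (z ∘ t c l) c w)}
  have hSm : ∀ k c, MeasurableSet (S k c) := fun k c =>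
    measurableSet_lt measurable_const (Finset.measurable_sum _ fun l _ =>
      (hf.comp (measurable_update _)).const_mul _)
  let g : (Bool × (Fin r → Finset (Fin q))) → (Fin r → ℝ) → ℝ := fun k =>
    (Set.univ.pi (S k)).indicator fun v => (if k.1 then 1 else -1) * f v
  have hgm : ∀ k, Measurable (g k) := fun k =>
    (hf.const_mul _).indicator (MeasurableSet.univ_pi (hSm k))
  have hgK : ∀ k v, |g k v| ≤ K := fun k v => by
    by_cases hv : v ∈ Set.univ.pi (S k)
    · simp only [g, Set.indicator_of_mem hv, abs_ite_mul]; exact hfK v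
    · simp only [g, Set.indicator_of_notMem hv, abs_zero]; exact hK.le
  have hgε : ∀ k, ∫ v, g k v ∂piUnif (Fin r) ≤ ε := fun k => by
    simp only [g]
    rw [integral_indicator (MeasurableSet.univ_pi (hSm k)), integral_const_mul]
    refine (le_abs_self _).trans ?_
    rw [abs_ite_mul]
    exact h (S k) (hSm k)
  have hbox : ∀ k y, boxValue (unifFin n) (fun i => f (mix z y ∘ i)) t k =
      ∫ i, g k (mix z y ∘ i) ∂(Measure.pi fun _ => unifFin n) := by
    intro k y
    rw [boxValue, ← integral_indicator (Set.toFinite _).measurableSet]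
    congr 1
    ext i
    have hu : ∀ c l, mix z y ∘ Function.update (t c l) c (i c) =
        Function.update (z ∘ t c l) c ((mix z y ∘ i) c) := by
      intro c l
      ext c'
      by_cases hc : c' = c
      · subst hc; simp
      · simp [hc, mix, hI]
    simp only [g, Set.indicator_apply, Set.mem_univ_pi, posSection, Set.mem_ofPred_eq, S, hu]
  have hmz : Measurable (mix z) := by
    refine measurable_pi_lambda _ fun a => ?_
    by_cases ha : a ∈ I
    · simp [mix, ha]
    · simp only [mix, ha, if_false]; exact measurable_pi_apply a
  have hcard : (I.card : ℝ) ≤ r * (q * r) := by exact_mod_cast card_used_le t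
  have hb := integral_le_of_bounded_differences_family unifI (ι := Fin n)
    (fun _ => 2 * K * (r / n)) (M := fun y => M (mix z y))
    (Y := fun k y => boxValue (unifFin n) (fun i => f (mix z y ∘ i)) t k) (B := K)
    (b := ε + K * ((r ^ 2 + r * (r * (q * r))) / n)) (σ := 4 * K ^ 2 * r ^ 2 / n)
    (ℓ := r * q + 1) (hMm.comp hmz) (fun y => hMB _)
    (fun k => (measurable_boxValue hf t k).comp hmz)
    (fun k y => abs_boxValue_le (fun i => hfK _) t k)
    (fun y => ?_) (fun k y a v => ?_) (fun k => ?_) (by positivity) ?_ (by positivity)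
    (log_card_le hr)
  · exact hb
  · obtain ⟨k, hk⟩ := exists_eq_ciSup_of_finite
      (f := fun k => boxValue (unifFin n) (fun i => f (mix z y ∘ i)) t k)
    exact ⟨k, hk.ge⟩
  · simp only [hbox]
    refine (abs_integral_sub_integral_le_of_eq_off (E := {i | ∃ c, i c = a}) (K := 2 * K)
      (fun i hi => ?_) fun i => ?_).trans ?_
    · congr 1
      ext c
      have : i c ≠ a := fun h => hi ⟨c, h⟩
      simp [mix, this]
    · have h1 := hgK k (mix z (Function.update y a v) ∘ i)
      have h2 := hgK k (mix z y ∘ i)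
      exact (abs_sub _ _).trans (by linarith)
    · gcongr
      exact unifFin_pi_hit_le a
  · simp only [hbox]
    refine (integral_average_comp_le (hgm k) (hgK k) (hgε k) h.nonneg I z).trans ?_
    gcongr
  · simp only [Finset.sum_const, Finset.card_univ, Fintype.card_fin, nsmul_eq_mul]
    exact le_of_eq (by field_simp; ring)

/-- Sampling points preserves the cut norm up to a small error in expectation. -/
theorem exists_sample_cut_bound (hr : 0 < r) (hq : 0 < q) (hf : Measurable f) {K ε : ℝ}
    (hK : 0 < K) (hfK : ∀ v, |f v| ≤ K) (h : CutLE unifI f ε) :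
    ∃ N : (Fin n → ℝ) → ℝ, Measurable N ∧ (∀ x, |N x| ≤ K + r * (K / √q)) ∧
      (∀ x, CutLE (unifFin n) (fun i => f (x ∘ i)) (N x)) ∧
      ∫ x, N x ∂piUnif (Fin n) ≤ ε + K * ((r ^ 2 + r * (r * (q * r))) / n) +
        √((r * q + 1) * (4 * K ^ 2 * r ^ 2 / n) / 2) + r * (K / √q) := by
  set Θ : Measure (Fin r → Fin q → Fin r → Fin n) := Measure.pi fun _ : Fin r =>
    Measure.pi fun _ : Fin q => Measure.pi fun _ => unifFin n
  let M : (Fin n → ℝ) → (Fin r → Fin q → Fin r → Fin n) → ℝ := fun x t =>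
    ⨆ k, boxValue (unifFin n) (fun i => f (x ∘ i)) t k
  have hMm : Measurable (Function.uncurry M) := measurable_from_prod_countable_left fun t =>
    Measurable.iSup fun k => measurable_boxValue hf t k
  have hMB : ∀ x t, |M x t| ≤ K := fun x t => by
    have hk : ∀ k, |boxValue (unifFin n) (fun i => f (x ∘ i)) t k| ≤ K := fun k =>
      abs_boxValue_le (fun i => hfK _) t k
    refine abs_le.2 ⟨?_, ciSup_le fun k => (abs_le.1 (hk k)).2⟩
    exact (abs_le.1 (hk (true, fun _ => ∅))).1.trans
      (le_ciSup (f := fun k => boxValue (unifFin n) (fun i => f (x ∘ i)) t k)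
        (Set.finite_range _).bddAbove (true, fun _ => ∅))
  have hsw : ∫ x, (∫ t, M x t ∂Θ) ∂piUnif (Fin n) = ∫ t, (∫ x, M x t ∂piUnif (Fin n)) ∂Θ :=
    integral_integral_swap (integrable_of_bounded hMm fun p => hMB _ _)
  have hm : Measurable fun x => ∫ t, M x t ∂Θ :=
    (hMm.stronglyMeasurable.integral_prod_right (ν := Θ)).measurable
  have hb : ∀ x, |∫ t, M x t ∂Θ| ≤ K := fun x => abs_integral_le_of_abs_le (hMB x)
  refine ⟨fun x => ∫ t, M x t ∂Θ + r * (K / √q), hm.add_const _, fun x => ?_, fun x S _ => ?_, ?_⟩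
  · refine (abs_add_le _ _).trans (add_le_add (hb x) (le_of_eq (abs_of_nonneg (by positivity))))
  · exact abs_setIntegral_le_integral_iSup_boxValue (unifFin n) hK (fun i => hfK _) hq S
  · rw [integral_add (integrable_of_bounded hm hb) (integrable_const _), hsw]
    refine add_le_add ?_ (by simp)
    calc ∫ t, (∫ x, M x t ∂piUnif (Fin n)) ∂Θ ≤ ∫ _, (ε + K * ((r ^ 2 + r * (r * (q * r))) / n) +
        √((r * q + 1) * (4 * K ^ 2 * r ^ 2 / n) / 2)) ∂Θ :=
          integral_mono Integrable.of_finite Integrable.of_finite fun t =>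
            integral_iSup_boxValue_le hr hf hK hfK h t
      _ = _ := by simp

end SamplePoints

lemma Multiset.powerset_map_eq {α β : Type*} (f : α → β) (m : Multiset α) :
    (m.map f).powerset = m.powerset.map (Multiset.map f) := by
  induction m using Multiset.induction_on with
  | empty => simp
  | cons a m ih =>
    simp only [Multiset.map_cons, Multiset.powerset_cons, ih, Multiset.map_add, Multiset.map_map]
    congr 1
    refine Multiset.map_congr rfl fun t _ => by simp

lemma facetFun_map {ι : Type*} [DecidableEq ι] (W : Multiset ℝ → ℝ) (σ : Finset ι) (x : ι → ℝ) :
    facetFun W (σ.val.map x) = ∏ τ ∈ σ.powerset.filter (·.Nonempty), W (τ.val.map x) := by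
  have h : σ.val.powerset = σ.powerset.val.map Finset.val := by
    simp [Finset.powerset, Multiset.map_pmap, Multiset.pmap_eq_map]
  have h2 : σ.val.powerset.filter (fun t => t.map x ≠ 0) =
      (σ.powerset.filter (·.Nonempty)).val.map Finset.val := by
    rw [h, Multiset.filter_map, Finset.filter_val]
    congr 1
    refine Multiset.filter_congr fun t _ => ?_
    simp [Finset.nonempty_iff_ne_empty]
  rw [facetFun, Multiset.powerset_map_eq, Multiset.filter_map]
  have h3 : Multiset.filter ((fun x => x ≠ 0) ∘ Multiset.map x) σ.val.powerset =
      σ.val.powerset.filter (fun t => t.map x ≠ 0) := rfl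
  rw [h3, h2, Multiset.map_map, Multiset.map_map]
  rfl

lemma Complexon.measurable_map (W : Complexon) {ι : Type*} {τ : Finset ι} (hτ : τ.Nonempty) :
    Measurable fun x : ι → ℝ => W.toFun (τ.val.map x) := by
  obtain ⟨k, hk⟩ := Nat.exists_eq_succ_of_ne_zero (Finset.card_pos.2 hτ).ne'
  let e : Fin (k + 1) ≃ τ := (finCongr hk.symm).trans τ.equivFin.symm
  have hm : ∀ x : ι → ℝ, τ.val.map x =
      Multiset.map (fun c => x (e c)) (Finset.univ : Finset (Fin (k + 1))).val := by
    intro x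
    have h1 : (Finset.univ : Finset (Fin (k + 1))).val.map (fun c => (e c : ι)) = τ.val := by
      have h2 : (Finset.univ : Finset (Fin (k + 1))).map
          (e.toEmbedding.trans (Function.Embedding.subtype (· ∈ τ))) = τ := by
        ext a
        simp only [Finset.mem_map, Finset.mem_univ, true_and]
        refine ⟨?_, fun ha => ⟨e.symm ⟨a, ha⟩, by simp⟩⟩
        rintro ⟨c, rfl⟩
        exact (e c).2
      exact congrArg Finset.val h2
    rw [← h1, Multiset.map_map]
    rfl
  simp only [hm]
  exact (W.measurable k).comp (measurable_pi_lambda _ fun c => measurable_pi_apply _)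

lemma facetFun_mTup {ι : Type*} [Fintype ι] [DecidableEq ι] (W : Multiset ℝ → ℝ) (v : ι → ℝ) :
    facetFun W (mTup v) =
      ∏ τ ∈ (Finset.univ : Finset ι).powerset.filter (·.Nonempty), W (τ.val.map v) :=
  facetFun_map W Finset.univ v

lemma Complexon.measurable_facetFun (W : Complexon) {ι : Type*} [Fintype ι] :
    Measurable fun v : ι → ℝ => facetFun W.toFun (mTup v) := by
  classical
  simp only [facetFun_mTup]
  exact Finset.measurable_prod _ fun τ hτ => W.measurable_map (Finset.mem_filter.1 hτ).2

lemma Complexon.facetFun_mem_Icc (W : Complexon) {ι : Type*} [Fintype ι] (v : ι → ℝ) :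
    facetFun W.toFun (mTup v) ∈ Set.Icc (0 : ℝ) 1 := by
  classical
  rw [facetFun_mTup]
  exact ⟨Finset.prod_nonneg fun τ _ => (W.mem_Icc _).1,
    Finset.prod_le_one (fun τ _ => (W.mem_Icc _).1) fun τ _ => (W.mem_Icc _).2⟩

lemma mem_skelFaces {W : Multiset ℝ → ℝ} {n d : ℕ} {x : Fin n → ℝ} {u : Finset (Fin n) → ℝ}
    {σ : Finset (Fin n)} : σ ∈ skelFaces W n d x u ↔ σ.Nonempty ∧ σ.card ≤ d + 1 ∧
    ∀ τ ∈ σ.powerset, τ.Nonempty → u τ ≤ W (τ.val.map x) := by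
  simp [skelFaces]

lemma Complexon.measurable_skelFaces (W : Complexon) (n d : ℕ) :
    Measurable fun p : (Fin n → ℝ) × (Finset (Fin n) → ℝ) =>
      skelFaces W.toFun n d p.1 p.2 := by
  classical
  have hσ : ∀ σ, MeasurableSet {p : (Fin n → ℝ) × (Finset (Fin n) → ℝ) |
      σ ∈ skelFaces W.toFun n d p.1 p.2} := by
    intro σ
    simp only [mem_skelFaces]
    refine MeasurableSet.inter (MeasurableSet.const _) (MeasurableSet.inter
      (MeasurableSet.const _) ?_)
    have : {p : (Fin n → ℝ) × (Finset (Fin n) → ℝ) | ∀ τ ∈ σ.powerset, τ.Nonempty →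
        p.2 τ ≤ W.toFun (τ.val.map p.1)} = ⋂ τ ∈ σ.powerset.filter (·.Nonempty),
        {p | p.2 τ ≤ W.toFun (τ.val.map p.1)} := by
      ext; simp
    change MeasurableSet {p : (Fin n → ℝ) × (Finset (Fin n) → ℝ) | ∀ τ ∈ σ.powerset, τ.Nonempty →
        p.2 τ ≤ W.toFun (τ.val.map p.1)}
    rw [this]
    refine Finset.measurableSet_biInter _ fun τ hτ => measurableSet_le ?_ ?_
    · exact (measurable_pi_apply τ).comp measurable_snd
    · exact (W.measurable_map (Finset.mem_filter.1 hτ).2).comp measurable_fst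
  refine measurable_to_countable' fun F => ?_
  have : (fun p : (Fin n → ℝ) × (Finset (Fin n) → ℝ) => skelFaces W.toFun n d p.1 p.2) ⁻¹' {F} =
      ⋂ σ, if σ ∈ F then {p | σ ∈ skelFaces W.toFun n d p.1 p.2}
        else {p | σ ∈ skelFaces W.toFun n d p.1 p.2}ᶜ := by
    ext p
    simp only [Set.mem_preimage, Set.mem_singleton_iff, Finset.ext_iff, Set.mem_iInter]
    refine forall_congr' fun σ => ?_
    by_cases h : σ ∈ F <;> simp [h]
  rw [this]
  refine MeasurableSet.iInter fun σ => ?_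
  split_ifs
  exacts [hσ σ, (hσ σ).compl]

/-- The indicator of the tuples of distinct vertices that span a face. -/
def faceTensor {n : ℕ} (F : Finset (Finset (Fin n))) {r : ℕ} (i : Fin r → Fin n) : ℝ :=
  open Classical in if Function.Injective i ∧ Finset.univ.image i ∈ F then 1 else 0

lemma abs_faceTensor_le {n : ℕ} (F : Finset (Finset (Fin n))) {r : ℕ} (i : Fin r → Fin n) :
    |faceTensor F i| ≤ 1 := by
  unfold faceTensor; split_ifs <;> simp

lemma faceTensor_mem_Icc {n : ℕ} (F : Finset (Finset (Fin n))) {r : ℕ} (i : Fin r → Fin n) :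
    faceTensor F i ∈ Set.Icc (0 : ℝ) 1 := by
  unfold faceTensor; split_ifs <;> simp

lemma unifI_Iic {w : ℝ} (hw : w ∈ Set.Icc (0 : ℝ) 1) : unifI (Set.Iic w) = ENNReal.ofReal w := by
  rw [unifI, Measure.restrict_apply measurableSet_Iic]
  have : Set.Iic w ∩ Set.Icc (0 : ℝ) 1 = Set.Icc 0 w := by
    ext y
    simp only [Set.mem_inter_iff, Set.mem_Iic, Set.mem_Icc]
    exact ⟨fun h => ⟨h.2.1, h.1⟩, fun h => ⟨h.2, h.1, h.2.trans hw.2⟩⟩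
  rw [this, Real.volume_Icc, sub_zero]

lemma Complexon.integral_faceTensor (W : Complexon) {n d r : ℕ} (hr : 0 < r) (hrd : r ≤ d + 1)
    (x : Fin n → ℝ) {i : Fin r → Fin n} (hi : Function.Injective i) :
    ∫ u, faceTensor (skelFaces W.toFun n d x u) i ∂piUnif (Finset (Fin n)) =
      facetFun W.toFun (mTup (x ∘ i)) := by
  classical
  set σ : Finset (Fin n) := Finset.univ.image i
  have hσval : σ.val = (Finset.univ : Finset (Fin r)).val.map i :=
    Finset.image_val_of_injOn hi.injOn
  have hσne : σ.Nonempty := by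
    have : Nonempty (Fin r) := ⟨⟨0, hr⟩⟩
    exact Finset.univ_nonempty.image i
  have hσc : σ.card ≤ d + 1 := by
    rw [Finset.card_image_of_injective _ hi]; simpa using hrd
  have hm : mTup (x ∘ i) = σ.val.map x := by
    rw [hσval, Multiset.map_map]; rfl
  let S : Finset (Fin n) → Set ℝ := fun τ =>
    if τ ∈ σ.powerset.filter (·.Nonempty) then Set.Iic (W.toFun (τ.val.map x)) else Set.univ
  have hS1 : ∀ τ ∈ σ.powerset.filter (·.Nonempty), S τ = Set.Iic (W.toFun (τ.val.map x)) :=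
    fun τ hτ => if_pos hτ
  have hS2 : ∀ τ ∉ σ.powerset.filter (·.Nonempty), S τ = Set.univ := fun τ hτ => if_neg hτ
  have hT : ∀ u, faceTensor (skelFaces W.toFun n d x u) i =
      (Set.univ.pi S).indicator (fun _ => (1 : ℝ)) u := by
    intro u
    simp only [faceTensor, Set.indicator_apply, mem_skelFaces]
    congr 1
    refine propext ⟨fun h τ _ => ?_, fun h => ⟨hi, hσne, hσc, fun τ hτ hne => ?_⟩⟩
    · by_cases hτ : τ ∈ σ.powerset.filter (·.Nonempty)
      · rw [hS1 τ hτ]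
        exact h.2.2.2 τ (Finset.mem_filter.1 hτ).1 (Finset.mem_filter.1 hτ).2
      · rw [hS2 τ hτ]; trivial
    · have := h τ (Set.mem_univ _)
      rw [hS1 τ (Finset.mem_filter.2 ⟨hτ, hne⟩)] at this
      exact this
  have hSm : MeasurableSet (Set.univ.pi S) := MeasurableSet.univ_pi fun τ => by
    by_cases hτ : τ ∈ σ.powerset.filter (·.Nonempty)
    · rw [hS1 τ hτ]; exact measurableSet_Iic
    · rw [hS2 τ hτ]; exact MeasurableSet.univ
  simp only [hT]
  rw [integral_indicator hSm, setIntegral_const, smul_eq_mul, mul_one, hm, facetFun_map,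
    Measure.real, piUnif, Measure.pi_pi, ENNReal.toReal_prod,
    ← Finset.prod_subset (Finset.subset_univ (σ.powerset.filter (·.Nonempty)))]
  · refine Finset.prod_congr rfl fun τ hτ => ?_
    rw [hS1 τ hτ, unifI_Iic (W.mem_Icc _), ENNReal.toReal_ofReal (W.mem_Icc _).1]
  · intro τ _ hτ
    rw [hS2 τ hτ]; simp

lemma unifFin_pi_subset_image_le {n r : ℕ} [NeZero n] (τ : Finset (Fin n)) :
    (Measure.pi fun _ : Fin r => unifFin n).real {i | τ ⊆ Finset.univ.image i} ≤
      ((r : ℝ) / n) ^ τ.card := by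
  classical
  have hsub : {i : Fin r → Fin n | τ ⊆ Finset.univ.image i} ⊆
      ⋃ g : τ → Fin r, {i | Function.Injective g ∧ i ∘ g = Subtype.val} := by
    intro i hi
    have : ∀ a : τ, ∃ c, i c = a := fun a => by simpa using hi a.2
    choose g hg using this
    refine Set.mem_iUnion.2 ⟨g, fun a b hab => Subtype.ext ?_, funext hg⟩
    rw [← hg a, ← hg b, hab]
  refine (measureReal_mono hsub).trans ((measureReal_iUnion_fintype_le _).trans ?_)
  refine (Finset.sum_le_sum (g := fun _ => ((n : ℝ)⁻¹) ^ τ.card) fun g _ => ?_).trans ?_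
  · by_cases hg : Function.Injective g
    · have h := (map_comp_injective_pi (unifFin n) hg).measure_preimage
        (s := {(Subtype.val : τ → Fin n)}) (Set.toFinite _).measurableSet.nullMeasurableSet
      rw [Measure.pi_singleton] at h
      have h2 : {i : Fin r → Fin n | Function.Injective g ∧ i ∘ g = Subtype.val} =
        (fun y : Fin r → Fin n => y ∘ g) ⁻¹' {(Subtype.val : τ → Fin n)} := by
        ext i; simp [hg]
      rw [Measure.real, h2, h]
      simp [unifFin_singleton]
    · simp [hg]
  · simp only [Finset.sum_const, Finset.card_univ, Fintype.card_fun, Fintype.card_coe,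
      Fintype.card_fin, nsmul_eq_mul]
    push_cast
    rw [div_eq_mul_inv, mul_pow]

lemma skelFaces_update_label {W : Multiset ℝ → ℝ} {n d : ℕ} {x : Fin n → ℝ}
    {u : Finset (Fin n) → ℝ} {σ τ : Finset (Fin n)} (h : τ.Nonempty → ¬ τ ⊆ σ) (v : ℝ) :
    σ ∈ skelFaces W n d x (Function.update u τ v) ↔ σ ∈ skelFaces W n d x u := by
  simp only [mem_skelFaces]
  refine and_congr_right fun _ => and_congr_right fun _ => forall_congr' fun ρ =>
    forall_congr' fun hρ => forall_congr' fun hne => ?_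
  have : ρ ≠ τ := by
    rintro rfl
    exact h hne (Finset.mem_powerset.1 hρ)
  rw [Function.update_of_ne this]

lemma skelFaces_update_point {W : Multiset ℝ → ℝ} {n d : ℕ} {x : Fin n → ℝ}
    {u : Finset (Fin n) → ℝ} {σ : Finset (Fin n)} {a : Fin n} (h : a ∉ σ) (v : ℝ) :
    σ ∈ skelFaces W n d (Function.update x a v) u ↔ σ ∈ skelFaces W n d x u := by
  simp only [mem_skelFaces]
  refine and_congr_right fun _ => and_congr_right fun _ => forall_congr' fun ρ =>
    forall_congr' fun hρ => forall_congr' fun hne => ?_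
  have : ρ.val.map (Function.update x a v) = ρ.val.map x := by
    refine Multiset.map_congr rfl fun b hb => ?_
    have : b ≠ a := by
      rintro rfl
      exact h (Finset.mem_powerset.1 hρ hb)
    rw [Function.update_of_ne this]
  rw [this]

lemma faceTensor_congr {n r : ℕ} {F F' : Finset (Finset (Fin n))} {i : Fin r → Fin n}
    (h : Finset.univ.image i ∈ F ↔ Finset.univ.image i ∈ F') : faceTensor F i = faceTensor F' i := by
  unfold faceTensor
  congr 1
  refine propext (and_congr_right fun _ => ?_)
  convert h

lemma sum_label_sq_eq (n : ℕ) (y : ℝ) :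
    ∑ τ : Finset (Fin n), y ^ τ.card = (1 + y) ^ n := by
  have := Fintype.sum_pow_mul_eq_add_pow (Fin n) y 1
  simpa [add_comm] using this

lemma one_add_pow_le_exp {n : ℕ} {y : ℝ} (hy : 0 ≤ y) : (1 + y) ^ n ≤ Real.exp (n * y) := by
  rw [mul_comm, Real.exp_mul, Real.rpow_natCast]
  gcongr
  linarith [Real.add_one_le_exp y]

lemma sum_label_sq_le {n r : ℕ} [NeZero n] (hrn : (r : ℝ) ^ 2 ≤ n) :
    ∑ τ : Finset (Fin n), (if τ.Nonempty then ((r : ℝ) / n) ^ τ.card else 0) ^ 2 ≤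
      2 * r ^ 2 / n := by
  classical
  have hn : (0 : ℝ) < n := by exact_mod_cast Nat.pos_of_ne_zero (NeZero.ne n)
  set y : ℝ := ((r : ℝ) / n) ^ 2 with hy
  have hy0 : 0 ≤ y := by positivity
  have h1 : ∀ τ : Finset (Fin n), (if τ.Nonempty then ((r : ℝ) / n) ^ τ.card else 0) ^ 2 =
      y ^ τ.card - if τ = ∅ then 1 else 0 := by
    intro τ
    rcases τ.eq_empty_or_nonempty with rfl | h
    · simp
    · simp [h, h.ne_empty, hy, ← pow_mul, mul_comm]
  simp only [h1]
  rw [Finset.sum_sub_distrib, sum_label_sq_eq]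
  have hz : (n : ℝ) * y = r ^ 2 / n := by rw [hy]; field_simp
  have hz1 : (n : ℝ) * y ≤ 1 := by rw [hz, div_le_one hn]; exact hrn
  have h2 := abs_le.1 (Real.abs_exp_sub_one_sub_id_le (x := n * y)
    (abs_le.2 ⟨by linarith [mul_nonneg hn.le hy0], hz1⟩))
  have h3 := one_add_pow_le_exp (n := n) hy0
  have h4 : 2 * (r : ℝ) ^ 2 / n = 2 * (n * y) := by rw [hz]; ring
  rw [h4]
  have : (n * y) ^ 2 ≤ n * y := by nlinarith [mul_nonneg hn.le hy0]
  simp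
  linarith

lemma sum_label_sq_le' {n r : ℕ} [NeZero n] (hrn : (r : ℝ) ^ 2 ≤ n) :
    ∑ τ : Finset (Fin n), (if 2 ≤ τ.card then ((r : ℝ) / n) ^ τ.card else 0) ^ 2 ≤
      (r ^ 2 / n) ^ 2 := by
  classical
  have hn : (0 : ℝ) < n := by exact_mod_cast Nat.pos_of_ne_zero (NeZero.ne n)
  set y : ℝ := ((r : ℝ) / n) ^ 2 with hy
  have hy0 : 0 ≤ y := by positivity
  have h1 : ∀ τ : Finset (Fin n), (if 2 ≤ τ.card then ((r : ℝ) / n) ^ τ.card else 0) ^ 2 =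
      y ^ τ.card - (if τ = ∅ then 1 else 0) - if τ ∈ Finset.powersetCard 1 Finset.univ
        then y else 0 := by
    intro τ
    by_cases h : 2 ≤ τ.card
    · have h0 : τ ≠ ∅ := by rintro rfl; simp at h
      have h00 : τ.card ≠ 1 := by omega
      simp [h, h0, h00, Finset.mem_powersetCard, hy, ← pow_mul, mul_comm]
    · interval_cases hc : τ.card
      · have : τ = ∅ := Finset.card_eq_zero.1 hc
        subst this; simp
      · have h0 : τ ≠ ∅ := by rintro rfl; simp at hc
        simp [h0, Finset.mem_powersetCard, hc]
  simp only [h1]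
  rw [Finset.sum_sub_distrib, Finset.sum_sub_distrib, sum_label_sq_eq]
  have hz : (n : ℝ) * y = r ^ 2 / n := by rw [hy]; field_simp
  have hz1 : (n : ℝ) * y ≤ 1 := by rw [hz, div_le_one hn]; exact hrn
  have h2 := abs_le.1 (Real.abs_exp_sub_one_sub_id_le (x := n * y)
    (abs_le.2 ⟨by linarith [mul_nonneg hn.le hy0], hz1⟩))
  have h3 := one_add_pow_le_exp (n := n) hy0
  rw [← hz]
  have h5 : (∑ τ : Finset (Fin n), if τ ∈ Finset.powersetCard 1 (Finset.univ : Finset (Fin n))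
      then y else 0) = n * y := by
    rw [← Finset.sum_filter, Finset.sum_const, nsmul_eq_mul, Finset.filter_mem_eq_inter, Finset.univ_inter]
    simp
  rw [h5]
  simp
  linarith

lemma integral_unifI_clip (n : ℕ) {f : (Finset (Fin n) → ℝ) → ℝ} :
    ∫ u, f (fun τ => min (u τ) 1) ∂piUnif (Finset (Fin n)) = ∫ u, f u ∂piUnif (Finset (Fin n)) := by
  refine integral_congr_ae ?_
  have h : ∀ᵐ u ∂piUnif (Finset (Fin n)), ∀ τ, u τ ≤ 1 := by
    rw [ae_all_iff]
    intro τ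
    have h1 : ∀ᵐ v ∂unifI, v ≤ 1 := by
      refine (ae_restrict_mem measurableSet_Icc).mono fun v hv => hv.2
    exact (measurePreserving_eval (fun _ : Finset (Fin n) => unifI) τ).quasiMeasurePreserving.ae h1
  filter_upwards [h] with u hu
  congr 1
  ext τ
  exact min_eq_left (hu τ)

/-- Given the points, the random labels only perturb the cut norm slightly in expectation. -/
theorem Complexon.exists_edge_cut_bound (W : Complexon) {n d r : ℕ} [NeZero n] (hr : 0 < r)
    (hrd : r ≤ d + 1) (hrn : (r : ℝ) ^ 2 ≤ n) (x : Fin n → ℝ) :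
    ∃ N : (Finset (Fin n) → ℝ) → ℝ, Measurable N ∧ (∀ u, |N u| ≤ 1) ∧
      (∀ u, CutLE (unifFin n) (fun i : Fin r → Fin n =>
        facetFun W.toFun (mTup (x ∘ i)) - faceTensor (skelFaces W.toFun n d x u) i) (N u)) ∧
      ∫ u, N u ∂piUnif (Finset (Fin n)) ≤ r ^ 2 / n + √((r * n + 1) * (r ^ 2 / n) ^ 2 / 2) := by
  classical
  have hn : (0 : ℝ) < n := by exact_mod_cast Nat.pos_of_ne_zero (NeZero.ne n)
  have hr' : (0 : ℝ) < r := by exact_mod_cast hr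
  let A : Finset (Finset (Fin n)) → (Fin r → Fin n) → ℝ := fun F i =>
    facetFun W.toFun (mTup (x ∘ i)) - faceTensor F i
  have hA : ∀ F i, |A F i| ≤ 1 := fun F i => by
    have h1 := W.facetFun_mem_Icc (x ∘ i)
    have h2 := faceTensor_mem_Icc F i
    exact abs_le.2 ⟨by linarith [h1.1, h2.2], by linarith [h1.2, h2.1]⟩
  let y : Bool × (Fin r → Finset (Fin n)) → Finset (Finset (Fin n)) → ℝ := fun k F =>
    (if k.1 then 1 else -1) * ∫ i in Set.univ.pi fun c => (k.2 c : Set (Fin n)), A F i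
      ∂(Measure.pi fun _ => unifFin n)
  have hy : ∀ k F, |y k F| ≤ 1 := fun k F => by
    rw [abs_ite_mul]
    exact abs_setIntegral_le_of_abs_le (hA F) (Set.toFinite _).measurableSet
  have hskel : Measurable fun u => skelFaces W.toFun n d x u :=
    (W.measurable_skelFaces n d).comp (measurable_const.prodMk measurable_id)
  have hclip : Measurable fun (u : Finset (Fin n) → ℝ) τ => min (u τ) 1 :=
    measurable_pi_lambda _ fun τ => (measurable_pi_apply τ).min measurable_const
  have hmeas : ∀ φ : Finset (Finset (Fin n)) → ℝ,
      Measurable fun u => φ (skelFaces W.toFun n d x u) := fun φ =>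
    (measurable_from_top (f := φ)).comp hskel
  have hbd : ∀ F, BddAbove (Set.range fun k => y k F) := fun F => (Set.finite_range _).bddAbove
  let N : Finset (Finset (Fin n)) → ℝ := fun F => ⨆ k, y k F
  have hN : ∀ F, |N F| ≤ 1 := fun F => by
    refine abs_le.2 ⟨?_, ciSup_le fun k => (abs_le.1 (hy k F)).2⟩
    exact (abs_le.1 (hy (true, fun _ => ∅) F)).1.trans (le_ciSup (hbd F) (true, fun _ => ∅))
  refine ⟨fun u => N (skelFaces W.toFun n d x u), hmeas N, fun u => hN _, fun u S _ => ?_, ?_⟩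
  · have h1 := le_ciSup (hbd (skelFaces W.toFun n d x u)) (true, fun c => (S c).toFinset)
    have h2 := le_ciSup (hbd (skelFaces W.toFun n d x u)) (false, fun c => (S c).toFinset)
    simp only [y, Set.coe_toFinset, if_true, Bool.false_eq_true, if_false] at h1 h2
    exact abs_le.2 ⟨by linarith, by linarith⟩
  · rw [← integral_unifI_clip (f := fun u => N (skelFaces W.toFun n d x u))]
    refine integral_le_of_bounded_differences_family unifI
      (fun τ : Finset (Fin n) => if 2 ≤ τ.card then ((r : ℝ) / n) ^ τ.card else 0)
      (Y := fun k u => y k (skelFaces W.toFun n d x fun τ => min (u τ) 1)) (B := 1)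
      ((hmeas N).comp hclip) (fun u => hN _) (fun k => (hmeas (y k)).comp hclip) (fun k u => hy k _)
      (fun u => ?_) (fun k u τ v => ?_) (fun k => ?_) (by positivity) (sum_label_sq_le' hrn)
      (by positivity) ?_
    · obtain ⟨k, hk⟩ := exists_eq_ciSup_of_finite
        (f := fun k => y k (skelFaces W.toFun n d x fun τ => min (u τ) 1))
      exact ⟨k, hk.ge⟩
    · have hupd : (fun ρ => min (Function.update u τ v ρ) 1) =
          Function.update (fun ρ => min (u ρ) 1) τ (min v 1) := by
        ext ρ
        by_cases h : ρ = τ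
        · subst h; simp
        · simp [h]
      rw [hupd]
      set u' : Finset (Fin n) → ℝ := fun ρ => min (u ρ) 1
      by_cases hτ : 2 ≤ τ.card
      · rw [if_pos hτ]
        have hint : ∀ F, y k F = (if k.1 then 1 else -1) * ∫ i,
            (Set.univ.pi fun c => (k.2 c : Set (Fin n))).indicator (A F) i
              ∂(Measure.pi fun _ => unifFin n) := fun F => by
          rw [integral_indicator (Set.toFinite _).measurableSet]
        rw [hint, hint, ← mul_sub, abs_ite_mul]
        refine (abs_integral_sub_integral_le_of_eq_off (E := {i | τ ⊆ Finset.univ.image i})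
          (K := 1) (fun i hi => ?_) fun i => ?_).trans ?_
        · have : A (skelFaces W.toFun n d x (Function.update u' τ (min v 1))) i =
              A (skelFaces W.toFun n d x u') i := by
            simp only [A]
            rw [faceTensor_congr (skelFaces_update_label (fun _ => hi) _)]
          simp only [Set.indicator_apply, this]
        · by_cases hi : i ∈ Set.univ.pi fun c => (k.2 c : Set (Fin n))
          · simp only [Set.indicator_of_mem hi, A]
            have h1 := faceTensor_mem_Icc (skelFaces W.toFun n d x u') i
            have h2 := faceTensor_mem_Icc
              (skelFaces W.toFun n d x (Function.update u' τ (min v 1))) i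
            exact abs_le.2 ⟨by linarith [h1.1, h2.2], by linarith [h1.2, h2.1]⟩
          · simp only [Set.indicator_of_notMem hi]; simp
        · rw [one_mul]
          exact unifFin_pi_subset_image_le τ
      · rw [if_neg hτ]
        have : skelFaces W.toFun n d x (Function.update u' τ (min v 1)) =
            skelFaces W.toFun n d x u' := by
          ext σ
          simp only [mem_skelFaces]
          refine and_congr_right fun _ => and_congr_right fun _ => forall_congr' fun ρ =>
            forall_congr' fun hρ => forall_congr' fun hne => ?_
          by_cases h : ρ = τ
          · subst h
            obtain ⟨a, ha⟩ := Finset.card_eq_one.1 (show ρ.card = 1 by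
              have := Finset.card_pos.2 hne; omega)
            subst ha
            simp [W.single_eq_one, u']
          · rw [Function.update_of_ne h]
        rw [this]; simp
    · change ∫ u, y k (skelFaces W.toFun n d x fun τ => min (u τ) 1) ∂piUnif (Finset (Fin n)) ≤ _
      rw [integral_unifI_clip (f := fun u => y k (skelFaces W.toFun n d x u))]
      simp only [y]
      rw [integral_const_mul]
      refine (le_abs_self _).trans ?_
      rw [abs_ite_mul]
      have hjm : Measurable (Function.uncurry fun (u : Finset (Fin n) → ℝ) (i : Fin r → Fin n) =>
          A (skelFaces W.toFun n d x u) i) :=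
        measurable_from_prod_countable_left fun i => hmeas fun F => A F i
      rw [integral_integral_swap (f := fun (u : Finset (Fin n) → ℝ) (i : Fin r → Fin n) =>
          A (skelFaces W.toFun n d x u) i) (integrable_of_bounded hjm fun p => hA _ _),
        ← integral_indicator (Set.toFinite _).measurableSet]
      have hz := abs_integral_sub_integral_le_of_eq_off (n := n) (r := r)
        (F := (Set.univ.pi fun c => (k.2 c : Set (Fin n))).indicator fun i =>
          ∫ u, A (skelFaces W.toFun n d x u) i ∂piUnif (Finset (Fin n))) (G := fun _ => 0) (K := 1)
        (E := {i | ¬ (Function.Injective i ∧ ∀ c, i c ∉ (∅ : Finset (Fin n)))})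
        (fun i hi => ?_) (fun i => ?_)
      · rw [integral_zero, sub_zero, one_mul] at hz
        refine hz.trans ((unifFin_pi_bad_le _).trans ?_)
        simp
      · have hi' : Function.Injective i := by simpa using hi
        simp only [Set.indicator_apply]
        split_ifs
        · simp only [A]
          rw [integral_sub (integrable_const _) (integrable_of_bounded
            (hmeas fun F => faceTensor F i) fun u => abs_faceTensor_le _ i),
            W.integral_faceTensor hr hrd x hi']
          simp
        · rfl
      · rw [sub_zero]
        simp only [Set.indicator_apply]
        split_ifs
        · exact abs_integral_le_of_abs_le fun u => hA _ i
        · simp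
    · exact log_card_le hr

lemma exists_coupling {κ : Type*} [Fintype κ] [DecidableEq κ] {n : ℕ} [NeZero n] (c : Fin n → κ)
    {p : κ → ℝ} (hp : ∀ a, 0 ≤ p a) (hp1 : ∑ a, p a = 1) :
    ∃ π : κ → Fin n → ℝ, (∀ a i, 0 ≤ π a i) ∧ (∀ a, ∑ i, π a i = p a) ∧
      (∀ i, ∑ a, π a i = (n : ℝ)⁻¹) ∧
      ∃ B : Finset κ, 1 - ∑ i, π (c i) i ≤
        ∑ a ∈ B, (p a - ∑ i, if c i = a then (n : ℝ)⁻¹ else 0) := by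
  have hn : (0 : ℝ) < n := by exact_mod_cast Nat.pos_of_ne_zero (NeZero.ne n)
  set w : κ → ℝ := fun a => ∑ i, if c i = a then (n : ℝ)⁻¹ else 0 with hw
  have hw0 : ∀ a, 0 ≤ w a := fun a => Finset.sum_nonneg fun i _ => by split_ifs <;> positivity
  have hfib : ∀ g : κ → ℝ, ∑ i, (n : ℝ)⁻¹ * g (c i) = ∑ b, w b * g b := by
    intro g
    simp only [hw, Finset.sum_mul, ite_mul, zero_mul]
    rw [Finset.sum_comm]
    simp
  have hwpos : ∀ i, 0 < w (c i) := fun i => by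
    have : (n : ℝ)⁻¹ ≤ w (c i) := by
      have := Finset.single_le_sum (f := fun j => if c j = c i then (n : ℝ)⁻¹ else 0)
        (fun j _ => by split_ifs <;> positivity) (Finset.mem_univ i)
      simpa using this
    exact (inv_pos.2 hn).trans_le this
  set m : κ → ℝ := fun a => min (p a) (w a)
  have hm0 : ∀ a, 0 ≤ m a := fun a => le_min (hp a) (hw0 a)
  have hmp : ∀ a, m a ≤ p a := fun a => min_le_left _ _
  have hmw : ∀ a, m a ≤ w a := fun a => min_le_right _ _
  have hwm : ∀ a, w a * (m a / w a) = m a := fun a => by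
    rcases (hw0 a).eq_or_lt with h | h
    · have : m a = 0 := le_antisymm (by rw [h]; exact hmw a) (hm0 a)
      rw [this]; simp
    · field_simp
  have hw1 : ∑ a, w a = 1 := by
    have := hfib fun _ => 1
    simp at this
    rw [← this]
  set δ : ℝ := ∑ a, (p a - m a) with hδ
  have hδ' : ∑ a, (w a - m a) = δ := by
    rw [hδ, Finset.sum_sub_distrib, Finset.sum_sub_distrib, hp1, hw1]
  have hz : δ = 0 → (∀ a, p a - m a = 0) ∧ ∀ a, w a - m a = 0 := fun h => by
    constructor
    · intro a
      exact (Finset.sum_eq_zero_iff_of_nonneg fun a _ => sub_nonneg.2 (hmp a)).1 h a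
        (Finset.mem_univ a)
    · intro a
      exact (Finset.sum_eq_zero_iff_of_nonneg fun a _ => sub_nonneg.2 (hmw a)).1 (hδ'.trans h) a
        (Finset.mem_univ a)
  have hδ0 : 0 ≤ δ := Finset.sum_nonneg fun a _ => sub_nonneg.2 (hmp a)
  have hθ1 : ∀ i, m (c i) / w (c i) ≤ 1 := fun i => (div_le_one (hwpos i)).2 (hmw _)
  have hθ0 : ∀ a, 0 ≤ m a / w a := fun a => div_nonneg (hm0 a) (hw0 a)
  let π : κ → Fin n → ℝ := fun a i =>
    (n : ℝ)⁻¹ * ((if c i = a then m a / w a else 0) +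
      (1 - m (c i) / w (c i)) * ((p a - m a) / δ))
  have hπ0 : ∀ a i, 0 ≤ (1 - m (c i) / w (c i)) * ((p a - m a) / δ) := fun a i =>
    mul_nonneg (sub_nonneg.2 (hθ1 i)) (div_nonneg (sub_nonneg.2 (hmp a)) hδ0)
  refine ⟨π, fun a i => ?_, fun a => ?_, fun i => ?_, Finset.univ.filter fun a => w a < p a, ?_⟩
  · refine mul_nonneg (by positivity) (add_nonneg ?_ (hπ0 a i))
    split_ifs
    exacts [hθ0 a, le_rfl]
  · simp only [π, mul_add, Finset.sum_add_distrib]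
    have h1 := hfib fun b => if b = a then m a / w a else 0
    have h2 := hfib fun b => (1 - m b / w b) * ((p a - m a) / δ)
    rw [h1, h2]
    have h3 : ∀ b, w b * ((1 - m b / w b) * ((p a - m a) / δ)) =
        (w b - m b) * ((p a - m a) / δ) := fun b => by
      rw [← mul_assoc, mul_sub, mul_one, hwm]
    simp only [h3]
    rw [← Finset.sum_mul, hδ']
    simp only [mul_ite, mul_zero, Finset.sum_ite_eq', Finset.mem_univ, if_true, hwm]
    by_cases h : δ = 0
    · have := (hz h).1 a
      rw [h]; simp; linarith
    · field_simp; ring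
  · simp only [π, ← Finset.mul_sum, Finset.sum_add_distrib]
    rw [← Finset.sum_div, ← hδ]
    simp only [Finset.sum_ite_eq, Finset.mem_univ, if_true]
    by_cases h : δ = 0
    · have h1 := (hz h).2 (c i)
      have h2 : m (c i) / w (c i) = 1 := by
        rw [div_eq_one_iff_eq (hwpos i).ne']; linarith
      rw [h2]; simp
    · rw [div_self h]; ring
  · have h1 : ∑ a, m a ≤ ∑ i, π (c i) i := by
      have := hfib fun b => m b / w b
      simp only [hwm] at this
      rw [← this]
      refine Finset.sum_le_sum fun i _ => ?_
      simp only [π, if_true]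
      gcongr
      linarith [hπ0 (c i) i]
    have h2 : ∑ a ∈ Finset.univ.filter (fun a => w a < p a), (p a - w a) = δ := by
      rw [hδ, Finset.sum_filter]
      refine Finset.sum_congr rfl fun a _ => ?_
      by_cases h : w a < p a
      · simp [h, m, h.le]
      · simp [h, m, not_lt.1 h]
    have h3 : δ = 1 - ∑ a, m a := by rw [hδ, Finset.sum_sub_distrib, hp1]
    rw [h2]; linarith

/-- Points colored by `c` can be matched with `[0,1]` colored by `P` up to the discrepancy of the
two color distributions. -/
lemma exists_alignment {κ : Type} [Fintype κ] [MeasurableSpace κ] [MeasurableSingletonClass κ]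
    {n : ℕ} [NeZero n] {P : ℝ → κ} (hP : Measurable P) (c : Fin n → κ) {δ : ℝ}
    (hδ : ∀ B : Finset κ, unifI.real (P ⁻¹' B) - (unifFin n).real (c ⁻¹' B) ≤ δ) :
    ∃ ψ : ℝ → Fin n, MeasurePreserving ψ unifI (unifFin n) ∧
      unifI.real {v | c (ψ v) ≠ P v} ≤ δ := by
  classical
  have hn : (0 : ℝ) < n := by exact_mod_cast Nat.pos_of_ne_zero (NeZero.ne n)
  let p : κ → ℝ := fun a => unifI.real (P ⁻¹' {a})
  have hpB : ∀ B : Finset κ, unifI.real (P ⁻¹' B) = ∑ a ∈ B, p a := fun B => by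
    rw [← sum_measureReal_preimage_singleton B fun a _ => hP (measurableSet_singleton a)]
  have hwB : ∀ B : Finset κ, (unifFin n).real (c ⁻¹' B) =
      ∑ a ∈ B, ∑ i, if c i = a then (n : ℝ)⁻¹ else 0 := fun B => by
    rw [← sum_measureReal_preimage_singleton B fun a _ => (Set.toFinite _).measurableSet]
    refine Finset.sum_congr rfl fun a _ => ?_
    have : c ⁻¹' {a} = ((Finset.univ.filter fun i => c i = a : Finset (Fin n)) : Set (Fin n)) := by
      ext; simp
    rw [this, ← Finset.sum_filter, ← sum_measureReal_singleton]
    simp [unifFin_real_singleton]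
  have hp1 : ∑ a, p a = 1 := by
    rw [← hpB]; simp
  obtain ⟨π, hπ0, hrow, hcol, B, hB⟩ := exists_coupling c (p := p)
    (fun a => measureReal_nonneg) hp1
  rw [Finset.sum_sub_distrib, ← hpB, ← hwB] at hB
  have hKp : ∀ a, ∃ ν : Measure (Fin n), IsProbabilityMeasure ν ∧
      ∀ i, unifI (P ⁻¹' {a}) * ν {i} = ENNReal.ofReal (π a i) := by
    intro a
    rcases (measureReal_nonneg (μ := unifI) (s := P ⁻¹' {a})).eq_or_lt with h | h
    · refine ⟨unifFin n, inferInstance, fun i => ?_⟩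
      have h1 : unifI (P ⁻¹' {a}) = 0 := by
        rwa [eq_comm, measureReal_eq_zero_iff] at h
      have h2 : π a i = 0 := by
        have : ∑ i, π a i = 0 := by rw [hrow a]; exact h.symm
        exact (Finset.sum_eq_zero_iff_of_nonneg fun i _ => hπ0 a i).1 this i (Finset.mem_univ i)
      rw [h1, h2]; simp
    · have hsum : ∑ i, ENNReal.ofReal (π a i / p a) = 1 := by
        rw [← ENNReal.ofReal_sum_of_nonneg fun i _ => div_nonneg (hπ0 a i) h.le,
          ← Finset.sum_div, hrow a, div_self h.ne', ENNReal.ofReal_one]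
      refine ⟨(PMF.ofFintype _ hsum).toMeasure, inferInstance, fun i => ?_⟩
      rw [PMF.toMeasure_apply_singleton _ _ (measurableSet_singleton i), PMF.ofFintype_apply,
        ← ofReal_measureReal (μ := unifI) (s := P ⁻¹' {a}), ← ENNReal.ofReal_mul h.le]
      congr 1
      exact mul_div_cancel₀ _ h.ne'
  choose ν hνp hν using hKp
  let K : ProbabilityTheory.Kernel κ (Fin n) := ⟨ν, Measurable.of_discrete⟩
  have hK : ProbabilityTheory.IsMarkovKernel K := ⟨hνp⟩
  have : Nonempty (Fin n) := ⟨0⟩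
  obtain ⟨ψ, hψ, hψK⟩ := exists_measurable_realizing hP K
  have hjoint : ∀ a i, unifI (P ⁻¹' {a} ∩ ψ ⁻¹' {i}) = ENNReal.ofReal (π a i) := fun a i => by
    rw [hψK a {i} (measurableSet_singleton i)]
    exact hν a i
  have hlaw : ∀ i, unifI (ψ ⁻¹' {i}) = (n : ENNReal)⁻¹ := fun i => by
    have h1 : unifI (ψ ⁻¹' {i}) = ∑ a, unifI (P ⁻¹' {a} ∩ ψ ⁻¹' {i}) := by
      rw [← measure_biUnion_finset]
      · congr 1; ext v; simp
      · intro a _ b _ hab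
        exact Set.disjoint_left.2 fun v hv hv' => hab (hv.1.symm.trans hv'.1)
      · exact fun a _ => (hP (measurableSet_singleton a)).inter (hψ (measurableSet_singleton i))
    rw [h1]
    simp only [hjoint]
    rw [← ENNReal.ofReal_sum_of_nonneg fun a _ => hπ0 a i, hcol, ENNReal.ofReal_inv_of_pos hn,
      ENNReal.ofReal_natCast]
  refine ⟨ψ, ⟨hψ, Measure.ext_of_singleton fun i => ?_⟩, ?_⟩
  · rw [Measure.map_apply hψ (measurableSet_singleton i), hlaw, unifFin_singleton]
  · have hEm : MeasurableSet {v | c (ψ v) = P v} :=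
      measurableSet_eq_fun (Measurable.of_discrete.comp hψ) hP
    have hE : unifI.real {v | c (ψ v) = P v} = ∑ i, π (c i) i := by
      have h1 : {v | c (ψ v) = P v} = ⋃ i ∈ (Finset.univ : Finset (Fin n)),
          (P ⁻¹' {c i} ∩ ψ ⁻¹' {i}) := by
        ext v; simp [eq_comm]
      rw [h1, measureReal_biUnion_finset]
      · refine Finset.sum_congr rfl fun i _ => ?_
        rw [Measure.real, hjoint, ENNReal.toReal_ofReal (hπ0 _ _)]
      · intro i _ j _ hij
        exact Set.disjoint_left.2 fun v hv hv' => hij (hv.2.symm.trans hv'.2)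
      · exact fun i _ => (hP (measurableSet_singleton _)).inter (hψ (measurableSet_singleton i))
    have h2 : {v | c (ψ v) ≠ P v} = {v | c (ψ v) = P v}ᶜ := rfl
    rw [h2, probReal_compl_eq_one_sub hEm, hE]
    exact hB.trans (hδ B)

/-- The coloring of random points aligns with the coloring of `[0,1]` in expectation. -/
theorem exists_alignment_bound {κ : Type} [Fintype κ] [MeasurableSpace κ]
    [MeasurableSingletonClass κ] {n : ℕ} [NeZero n] {P : ℝ → κ} (hP : Measurable P) :
    ∃ δ : (Fin n → ℝ) → ℝ, Measurable δ ∧ (∀ x, |δ x| ≤ 1) ∧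
      (∀ x, ∃ ψ : ℝ → Fin n, MeasurePreserving ψ unifI (unifFin n) ∧
        unifI.real {v | P (x (ψ v)) ≠ P v} ≤ δ x) ∧
      ∫ x, δ x ∂piUnif (Fin n) ≤ √(Fintype.card κ * (n : ℝ)⁻¹ / 2) := by
  classical
  have hn : (0 : ℝ) < n := by exact_mod_cast Nat.pos_of_ne_zero (NeZero.ne n)
  have : Nonempty κ := ⟨P 0⟩
  let Y : Finset κ → (Fin n → ℝ) → ℝ := fun B x =>
    unifI.real (P ⁻¹' B) - (unifFin n).real ((fun i => P (x i)) ⁻¹' B)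
  have hY : ∀ B x, Y B x = unifI.real (P ⁻¹' B) -
      (n : ℝ)⁻¹ * ∑ i, (P ⁻¹' (B : Set κ)).indicator (fun _ => (1 : ℝ)) (x i) := fun B x => by
    simp only [Y]
    congr 1
    rw [← integral_indicator_one (Set.toFinite _).measurableSet,
      integral_fintype Integrable.of_finite, Finset.mul_sum]
    refine Finset.sum_congr rfl fun i _ => ?_
    rw [unifFin_real_singleton]
    rfl
  have hBm : ∀ B : Finset κ, MeasurableSet (P ⁻¹' (B : Set κ)) := fun B =>
    hP (Finset.measurableSet B)
  have hind : ∀ B : Finset κ, Measurable ((P ⁻¹' (B : Set κ)).indicator (fun _ => (1 : ℝ))) :=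
    fun B => measurable_const.indicator (hBm B)
  have hYm : ∀ B, Measurable (Y B) := fun B => by
    simp only [funext (hY B)]
    exact measurable_const.sub ((Finset.measurable_sum _ fun i _ =>
      (hind B).comp (measurable_pi_apply i)).const_mul _)
  have hYb : ∀ B x, |Y B x| ≤ 1 := fun B x => by
    have h1 : unifI.real (P ⁻¹' (B : Set κ)) ≤ 1 := measureReal_le_one
    have h2 : (unifFin n).real ((fun i => P (x i)) ⁻¹' (B : Set κ)) ≤ 1 := measureReal_le_one
    have h3 : 0 ≤ unifI.real (P ⁻¹' (B : Set κ)) := measureReal_nonneg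
    have h4 : 0 ≤ (unifFin n).real ((fun i => P (x i)) ⁻¹' (B : Set κ)) := measureReal_nonneg
    exact abs_le.2 ⟨by simp only [Y]; linarith, by simp only [Y]; linarith⟩
  have hbd : ∀ x, BddAbove (Set.range fun B => Y B x) := fun x => (Set.finite_range _).bddAbove
  have hδb : ∀ x, |⨆ B, Y B x| ≤ 1 := fun x => by
    refine abs_le.2 ⟨?_, ciSup_le fun B => (abs_le.1 (hYb B x)).2⟩
    exact (abs_le.1 (hYb ∅ x)).1.trans (le_ciSup (hbd x) ∅)
  have hδm : Measurable fun x => ⨆ B, Y B x := Measurable.iSup hYm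
  refine ⟨fun x => ⨆ B, Y B x, hδm, hδb, fun x => ?_, ?_⟩
  · exact exists_alignment hP (fun i => P (x i)) fun B => le_ciSup (hbd x) B
  · have := integral_le_of_bounded_differences_family unifI (fun _ : Fin n => (n : ℝ)⁻¹)
      (M := fun x => ⨆ B, Y B x) (Y := Y) (B := 1) (b := 0) (σ := (n : ℝ)⁻¹)
      (ℓ := Fintype.card κ) hδm hδb hYm hYb (fun x => ?_) (fun B x i v => ?_) (fun B => ?_)
      (by positivity) ?_ (by exact_mod_cast Fintype.card_pos) ?_
    · simpa [piUnif] using this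
    · obtain ⟨B, hB⟩ := exists_eq_ciSup_of_finite (f := fun B => Y B x)
      exact ⟨B, hB.ge⟩
    · rw [hY, hY, sub_sub_sub_cancel_left, ← mul_sub, abs_mul, abs_of_pos (inv_pos.2 hn),
        ← Finset.sum_sub_distrib]
      refine mul_le_of_le_one_right (by positivity) ?_
      rw [Finset.sum_eq_single i]
      · simp only [Function.update_self, Set.indicator_apply]
        split_ifs <;> simp
      · intro j _ hj
        simp [hj]
      · simp
    · simp only [hY]
      have hi : ∀ i : Fin n, Integrable (fun x : Fin n → ℝ =>
          (P ⁻¹' (B : Set κ)).indicator (fun _ => (1 : ℝ)) (x i)) (Measure.pi fun _ => unifI) :=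
        fun i => integrable_of_bounded (B := 1) ((hind B).comp (measurable_pi_apply i)) fun x => by
          simp only [Set.indicator_apply]; split_ifs <;> simp
      rw [integral_sub (integrable_const _) ((integrable_finsetSum _ fun i _ => hi i).const_mul _),
        integral_const_mul, integral_finsetSum _ fun i _ => hi i]
      have h1 : ∀ i : Fin n, ∫ x : Fin n → ℝ, (P ⁻¹' (B : Set κ)).indicator (fun _ => (1 : ℝ)) (x i)
          ∂(Measure.pi fun _ => unifI) = unifI.real (P ⁻¹' (B : Set κ)) := fun i => by
        rw [integral_comp_eval (μ := fun _ : Fin n => unifI) (i := i)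
          (hind B).aestronglyMeasurable, integral_indicator (hBm B)]
        simp
      simp only [h1]
      simp only [integral_const, probReal_univ, smul_eq_mul, one_mul, Finset.sum_const,
        Finset.card_univ, Fintype.card_fin, nsmul_eq_mul]
      rw [inv_mul_cancel_left₀ hn.ne', sub_self]
    · simp only [Finset.sum_const, Finset.card_univ, Fintype.card_fin, nsmul_eq_mul]
      exact le_of_eq (by field_simp)
    · rw [Fintype.card_finset]
      push_cast
      rw [Real.log_pow]
      have := Real.log_two_lt_d9
      have h : (0 : ℝ) ≤ Fintype.card κ := by positivity
      nlinarith

section Recoloring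

variable {r : ℕ}

lemma CutLE.of_integral_abs_le {X : Type*} [MeasurableSpace X] {μ : Measure X} [IsFiniteMeasure μ]
    {f : (Fin r → X) → ℝ} {ε B : ℝ} (hf : Measurable f) (hB : ∀ x, |f x| ≤ B)
    (h : ∫ x, |f x| ∂(Measure.pi fun _ => μ) ≤ ε) : CutLE μ f ε := fun S _ =>
  (abs_integral_le_integral_abs.trans (setIntegral_le_integral
    (integrable_of_bounded (B := B) hf.abs fun x => by rw [abs_abs]; exact hB x)
    (ae_of_all _ fun _ => abs_nonneg _))).trans h

lemma cutLE_sub_comp_of_real_ne_le {X κ : Type*} [MeasurableSpace X] [MeasurableSpace κ]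
    [Finite κ] [MeasurableSingletonClass κ] {μ : Measure X} [IsProbabilityMeasure μ]
    {P Q : X → κ} (hP : Measurable P) (hQ : Measurable Q) {δ : ℝ}
    (hδ : μ.real {v | Q v ≠ P v} ≤ δ) {h : (Fin r → κ) → ℝ} {B : ℝ} (hB : ∀ a, |h a| ≤ B) :
    CutLE μ (fun v => h (P ∘ v) - h (Q ∘ v)) (2 * B * (r * δ)) := by
  classical
  have hm : ∀ {R : X → κ}, Measurable R → Measurable fun v : Fin r → X => h (R ∘ v) := fun hR =>
    (measurable_of_finite h).comp
      (measurable_pi_lambda _ fun c => hR.comp (measurable_pi_apply c))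
  have hb : ∀ v : Fin r → X, |h (P ∘ v) - h (Q ∘ v)| ≤ 2 * B := fun v => by
    have := abs_sub (h (P ∘ v)) (h (Q ∘ v)); have := hB (P ∘ v); have := hB (Q ∘ v); linarith
  have hmeas : Measurable fun v : Fin r → X => h (P ∘ v) - h (Q ∘ v) := (hm hP).sub (hm hQ)
  refine CutLE.of_integral_abs_le hmeas hb ?_
  set D : Set X := {v | Q v ≠ P v} with hD
  have hDm : MeasurableSet D := (measurableSet_eq_fun hQ hP).compl
  have hpt : ∀ v : Fin r → X, |h (P ∘ v) - h (Q ∘ v)| ≤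
      ∑ c, D.indicator (fun _ => 2 * B) (v c) := fun v => by
    have h2B : 0 ≤ 2 * B := (abs_nonneg _).trans (hb v)
    by_cases hv : ∃ c, v c ∈ D
    · obtain ⟨c, hc⟩ := hv
      refine (hb v).trans ?_
      have := Finset.single_le_sum (f := fun c => D.indicator (fun _ => 2 * B) (v c))
        (fun c _ => Set.indicator_nonneg (fun _ _ => h2B) _) (Finset.mem_univ c)
      simpa [hc] using this
    · have : P ∘ v = Q ∘ v := by
        ext c
        by_contra hne
        exact hv ⟨c, fun h' => hne h'.symm⟩
      rw [this, sub_self, abs_zero]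
      exact Finset.sum_nonneg fun c _ => Set.indicator_nonneg (fun _ _ => h2B) _
  obtain ⟨x₀⟩ := nonempty_of_isProbabilityMeasure μ
  have h2B : 0 ≤ 2 * B := (abs_nonneg _).trans (hb fun _ => x₀)
  have hint : ∀ c : Fin r, Integrable (fun v : Fin r → X => D.indicator (fun _ => 2 * B) (v c))
      (Measure.pi fun _ => μ) := fun c =>
    integrable_of_bounded (B := 2 * B)
      ((measurable_const.indicator hDm).comp (measurable_pi_apply c)) fun v => by
        by_cases hv : v c ∈ D <;> simp [hv, abs_of_nonneg h2B, h2B]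
  calc _ ≤ ∫ v : Fin r → X, ∑ c, D.indicator (fun _ => 2 * B) (v c) ∂(Measure.pi fun _ => μ) := by
        refine integral_mono (integrable_of_bounded (B := 2 * B) hmeas.abs fun x => ?_)
          (integrable_finsetSum _ fun c _ => hint c) hpt
        rw [abs_abs]; exact hb x
    _ = ∑ c : Fin r, 2 * B * μ.real D := by
        rw [integral_finsetSum _ fun c _ => hint c]
        refine Finset.sum_congr rfl fun c _ => ?_
        have := integral_comp_eval (μ := fun _ : Fin r => μ) (i := c)
          (f := D.indicator fun _ => 2 * B)
          (measurable_const.indicator hDm).aestronglyMeasurable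
        rw [this, integral_indicator hDm]
        simp [mul_comm]
    _ ≤ _ := by
        simp only [Finset.sum_const, Finset.card_univ, Fintype.card_fin, nsmul_eq_mul]
        have : 2 * B * μ.real D ≤ 2 * B * δ := by gcongr
        nlinarith [(Nat.cast_nonneg r : (0:ℝ) ≤ r)]

lemma CutLE.of_sample {κ : Type*} [Finite κ] [MeasurableSpace κ] [MeasurableSingletonClass κ]
    {n : ℕ} [NeZero n] {f : (Fin r → ℝ) → ℝ} (hf : Measurable f) (hf1 : ∀ v, |f v| ≤ 1)
    {P : ℝ → κ} (hP : Measurable P) {h : (Fin r → κ) → ℝ} {B ε : ℝ} (hB : ∀ a, |h a| ≤ B)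
    (hfh : CutLE unifI (fun v => f v - h (P ∘ v)) ε) {x : Fin n → ℝ} {ψ : ℝ → Fin n}
    (hψ : MeasurePreserving ψ unifI (unifFin n)) {δ : ℝ}
    (hδ : unifI.real {v | P (x (ψ v)) ≠ P v} ≤ δ) {ε₁ ε₂ : ℝ}
    (hs : CutLE (unifFin n) (fun i => f (x ∘ i) - h (P ∘ x ∘ i)) ε₁)
    {T : (Fin r → Fin n) → ℝ} (hT : ∀ i, |T i| ≤ 1)
    (hfT : CutLE (unifFin n) (fun i => f (x ∘ i) - T i) ε₂) :
    CutLE unifI (fun v => f v - T (ψ ∘ v)) (ε + 2 * B * (r * δ) + ε₁ + ε₂) := by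
  have hQ : Measurable fun v => P (x (ψ v)) :=
    (measurable_of_finite fun i => P (x i)).comp hψ.measurable
  have hm : ∀ {R : ℝ → κ}, Measurable R → Measurable fun v : Fin r → ℝ => h (R ∘ v) := fun hR =>
    (measurable_of_finite h).comp
      (measurable_pi_lambda _ fun c => hR.comp (measurable_pi_apply c))
  have hψm : Measurable fun v : Fin r → ℝ => ψ ∘ v :=
    measurable_pi_lambda _ fun c => hψ.measurable.comp (measurable_pi_apply c)
  have hsub : ∀ {a b A C : ℝ}, |a| ≤ A → |b| ≤ C → |a - b| ≤ A + C := fun ha hb =>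
    (abs_sub _ _).trans (add_le_add ha hb)
  have h1 := cutLE_sub_comp_of_real_ne_le hP hQ hδ hB
  have h2 := (CutLE.comp hψ hs (measurable_of_finite _)
    fun i => hsub (hf1 (x ∘ i)) (hB (P ∘ x ∘ i))).neg
  have h3 := CutLE.comp hψ hfT (measurable_of_finite _) fun i => hsub (hf1 (x ∘ i)) (hT i)
  have m2 : Measurable fun v : Fin r → ℝ => -(f (x ∘ ψ ∘ v) - h (P ∘ x ∘ ψ ∘ v)) :=
    (measurable_of_finite fun i : Fin r → Fin n => -(f (x ∘ i) - h (P ∘ x ∘ i))).comp hψm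
  have m3 : Measurable fun v : Fin r → ℝ => f (x ∘ ψ ∘ v) - T (ψ ∘ v) :=
    (measurable_of_finite fun i : Fin r → Fin n => f (x ∘ i) - T i).comp hψm
  have e1 := hfh.add h1 (hf.sub (hm hP)) ((hm hP).sub (hm hQ))
    (fun v => hsub (hf1 v) (hB _)) (fun v => hsub (hB _) (hB _))
  have e2 := e1.add h2 ((hf.sub (hm hP)).add ((hm hP).sub (hm hQ))) m2
    (fun v => (abs_add_le _ _).trans (add_le_add (hsub (hf1 v) (hB _)) (hsub (hB _) (hB _))))
    (fun v => by rw [abs_neg]; exact hsub (hf1 _) (hB _))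
  have e3 := e2.add h3 (((hf.sub (hm hP)).add ((hm hP).sub (hm hQ))).add m2) m3
    (fun v => (abs_add_le _ _).trans (add_le_add ((abs_add_le _ _).trans
      (add_le_add (hsub (hf1 v) (hB _)) (hsub (hB _) (hB _))))
        (by rw [abs_neg]; exact hsub (hf1 _) (hB _))))
    (fun v => hsub (hf1 _) (hT _))
  refine fun S hS => le_of_eq_of_le ?_ (e3 S hS)
  congr 2
  ext v
  have : (fun v => P (x (ψ v))) ∘ v = P ∘ x ∘ ψ ∘ v := rfl
  simp only [this]
  ring

end Recoloring

section CutNorm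

lemma cutNormD_nonneg (d : ℕ) (f : (Fin (d + 1) → ℝ) → ℝ) : 0 ≤ cutNormD d f := by
  refine Real.sSup_nonneg ?_
  rintro _ ⟨S, -, rfl⟩
  exact abs_nonneg _

lemma CutLE.cutNormD_le {d : ℕ} {f : (Fin (d + 1) → ℝ) → ℝ} {ε : ℝ} (h : CutLE unifI f ε) :
    cutNormD d f ≤ ε := by
  refine csSup_le ⟨_, fun _ => Set.univ, fun _ => MeasurableSet.univ, rfl⟩ ?_
  rintro _ ⟨S, hS, rfl⟩
  exact h S hS

lemma cutLE_cutNormD {d : ℕ} {f : (Fin (d + 1) → ℝ) → ℝ} {B : ℝ} (hB : ∀ v, |f v| ≤ B) :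
    CutLE unifI f (cutNormD d f) := fun S hS => by
  refine le_csSup ⟨B, ?_⟩ ⟨S, hS, rfl⟩
  rintro _ ⟨S, hS, rfl⟩
  exact abs_setIntegral_le_of_abs_le hB (MeasurableSet.univ_pi hS)

end CutNorm

section SampleDist

variable {n : ℕ}

/-- The weighted cut distance, in dimensions `1, …, d`, between a multiset function and a family of
faces on `[n]` pulled back to `[0,1]` along `ψ`. -/
def sampleCutDist (d : ℕ) (α : ℕ → ℝ) (g : Multiset ℝ → ℝ)
    (F : Finset (Finset (Fin n))) (ψ : ℝ → Fin n) : ℝ :=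
  ∑ j ∈ Finset.Icc 1 d, α j *
    cutNormD j (fun v => g (mTup v) - faceTensor F (ψ ∘ v))

/-- The infimum of `sampleCutDist` over measure-preserving maps `[0,1] → [n]`. -/
def sampleDist (d : ℕ) (α : ℕ → ℝ) (g : Multiset ℝ → ℝ)
    (F : Finset (Finset (Fin n))) : ℝ :=
  ⨅ ψ : {ψ : ℝ → Fin n // MeasurePreserving ψ unifI (unifFin n)}, sampleCutDist d α g F ψ

variable {d : ℕ} {α : ℕ → ℝ} {g : Multiset ℝ → ℝ}

lemma sampleCutDist_nonneg (hα : ∀ j, 0 ≤ α j) (F : Finset (Finset (Fin n))) (ψ : ℝ → Fin n) :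
    0 ≤ sampleCutDist d α g F ψ :=
  Finset.sum_nonneg fun j _ => mul_nonneg (hα j) (cutNormD_nonneg _ _)

lemma sampleDist_nonneg (hα : ∀ j, 0 ≤ α j) (F : Finset (Finset (Fin n))) :
    0 ≤ sampleDist d α g F :=
  Real.iInf_nonneg fun _ => sampleCutDist_nonneg hα F _

lemma sampleDist_le (hα : ∀ j, 0 ≤ α j) (F : Finset (Finset (Fin n))) {ψ : ℝ → Fin n}
    (hψ : MeasurePreserving ψ unifI (unifFin n)) :
    sampleDist d α g F ≤ sampleCutDist d α g F ψ :=
  ciInf_le (f := fun ψ : {ψ : ℝ → Fin n // MeasurePreserving ψ unifI (unifFin n)} =>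
    sampleCutDist d α g F ψ) ⟨0, by rintro _ ⟨ψ, rfl⟩; exact sampleCutDist_nonneg hα F _⟩ ⟨ψ, hψ⟩

lemma sampleDist_le_of_cutLE (hα : ∀ j, 0 ≤ α j) {F : Finset (Finset (Fin n))} {ψ : ℝ → Fin n}
    (hψ : MeasurePreserving ψ unifI (unifFin n)) {b : ℕ → ℝ}
    (h : ∀ j ∈ Finset.Icc 1 d,
      CutLE unifI (fun v : Fin (j + 1) → ℝ => g (mTup v) - faceTensor F (ψ ∘ v)) (b j)) :
    sampleDist d α g F ≤ ∑ j ∈ Finset.Icc 1 d, α j * b j :=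
  (sampleDist_le hα F hψ).trans
    (Finset.sum_le_sum fun j hj => mul_le_mul_of_nonneg_left (h j hj).cutNormD_le (hα j))

lemma exists_measurePreserving_unifFin (n : ℕ) [NeZero n] :
    ∃ ψ : ℝ → Fin n, MeasurePreserving ψ unifI (unifFin n) := by
  obtain ⟨δ, -, -, h, -⟩ := exists_alignment_bound (n := n) (P := fun _ : ℝ => ()) measurable_const
  obtain ⟨ψ, hψ, -⟩ := h fun _ => 0
  exact ⟨ψ, hψ⟩

lemma card_pi_fin_le {d k₀ : ℕ} {m k : ℕ → ℕ} (hm : ∀ j, m j ≤ 2 ^ ((j + 1) * k j))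
    (hk : ∀ j, k j ≤ k₀) :
    Fintype.card ((j : Fin (d + 1)) → Fin (m j)) ≤ 2 ^ ((d + 1) ^ 2 * k₀) := by
  rw [Fintype.card_pi]
  calc ∏ j : Fin (d + 1), Fintype.card (Fin (m j))
      ≤ ∏ _j : Fin (d + 1), 2 ^ ((d + 1) * k₀) := by
        refine Finset.prod_le_prod' fun j _ => ?_
        rw [Fintype.card_fin]
        exact (hm j).trans (Nat.pow_le_pow_right (by norm_num)
          (Nat.mul_le_mul (by omega) (hk j)))
    _ = _ := by
        rw [Finset.prod_const, Finset.card_univ, Fintype.card_fin, ← pow_mul]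
        congr 1; ring

theorem Complexon.integral_sampleDist_le (W : Complexon) {d n q : ℕ} [NeZero n] {ε M : ℝ}
    (hR : ((d + 1 : ℕ) : ℝ) ^ 2 ≤ n) (hε : 0 < ε) (hq : 0 < q)
    (hM : (2 : ℝ) ^ ((d + 1) ^ 2 * ⌊1 / ε ^ 2⌋₊) ≤ M) {α : ℕ → ℝ} (hα : ∀ j, 0 ≤ α j) {R K : ℝ}
    (hRd : R = (d + 1 : ℕ)) (hK : K = 1 + 1 / ε) :
    ∫ x, ∫ u, sampleDist d α (facetFun W.toFun) (skelFaces W.toFun n d x u)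
        ∂piUnif (Finset (Fin n)) ∂piUnif (Fin n) ≤
      (∑ j ∈ Finset.Icc 1 d, α j) * (ε + 2 * (1 / ε) * (R * √(M * (n : ℝ)⁻¹ / 2)) +
        (ε + K * ((R ^ 2 + R * (R * (q * R))) / n) +
          √((R * q + 1) * (4 * K ^ 2 * R ^ 2 / n) / 2) + R * (K / √q)) +
        (R ^ 2 / n + √((R * n + 1) * (R ^ 2 / n) ^ 2 / 2))) := by
  have hn : (0 : ℝ) < n := by exact_mod_cast Nat.pos_of_ne_zero (NeZero.ne n)
  have hK0 : 0 < K := by rw [hK]; positivity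
  have habs : ∀ j, ∀ v : Fin (j + 1) → ℝ, |facetFun W.toFun (mTup v)| ≤ 1 := fun j v => by
    have := W.facetFun_mem_Icc v
    rw [abs_of_nonneg this.1]; exact this.2
  choose k m P h hP hk hm hh hcut using fun j : ℕ =>
    exists_step_approximation (r := j + 1) W.measurable_facetFun (habs j) hε
  have hkε : ∀ j, k j * ε ≤ 1 / ε := fun j => by
    rw [le_div_iff₀ hε]; have := hk j; nlinarith
  have hk₀ : ∀ j, k j ≤ ⌊1 / ε ^ 2⌋₊ := fun j => by
    refine Nat.le_floor ?_
    rw [le_div_iff₀ (by positivity)]; exact hk j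
  have hhB : ∀ j a, |h j a| ≤ 1 / ε := fun j a => (hh j a).trans (hkε j)
  let Q : ℝ → (j : Fin (d + 1)) → Fin (m j) := fun v j => P j v
  have hQ : Measurable Q := measurable_pi_lambda _ fun j => hP j
  obtain ⟨δ, hδm, hδ1, hδ, hδi⟩ := exists_alignment_bound (n := n) hQ
  have hcard : (Fintype.card ((j : Fin (d + 1)) → Fin (m j)) : ℝ) ≤ M :=
    le_trans (by exact_mod_cast card_pi_fin_le hm hk₀) hM
  have hres : ∀ j, Measurable fun v : Fin (j + 1) → ℝ =>
      facetFun W.toFun (mTup v) - h j (P j ∘ v) := fun j =>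
    W.measurable_facetFun.sub ((measurable_of_finite (h j)).comp
      (measurable_pi_lambda _ fun c => (hP j).comp (measurable_pi_apply c)))
  choose N₁ hN₁m hN₁B hN₁ hN₁i using fun j : ℕ =>
    exists_sample_cut_bound (n := n) (q := q) (Nat.succ_pos j) hq (hres j) hK0
      (fun v => (abs_sub _ _).trans ((add_le_add (habs j v) (hhB j _)).trans_eq hK.symm)) (hcut j)
  have hedge : ∀ (j : ℕ) (x : Fin n → ℝ), ∃ N : (Finset (Fin n) → ℝ) → ℝ, Measurable N ∧
      (∀ u, |N u| ≤ 1) ∧ (j ≤ d → ∀ u, CutLE (unifFin n) (fun i : Fin (j + 1) → Fin n =>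
        facetFun W.toFun (mTup (x ∘ i)) - faceTensor (skelFaces W.toFun n d x u) i) (N u)) ∧
      ∫ u, N u ∂piUnif (Finset (Fin n)) ≤ R ^ 2 / n + √((R * n + 1) * (R ^ 2 / n) ^ 2 / 2) := by
    intro j x
    by_cases hj : j ≤ d
    · have hjR : ((j + 1 : ℕ) : ℝ) ≤ (d + 1 : ℕ) := by exact_mod_cast Nat.succ_le_succ hj
      obtain ⟨N, h1, h2, h3, h4⟩ := W.exists_edge_cut_bound (d := d) (Nat.succ_pos j)
        (Nat.succ_le_succ hj) (le_trans (by gcongr) hR) x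
      refine ⟨N, h1, h2, fun _ => h3, h4.trans ?_⟩
      rw [hRd]
      gcongr
    · exact ⟨fun _ => 0, measurable_const, by simp, fun h => absurd h hj, by
        rw [integral_zero]; rw [hRd]; positivity⟩
  choose N₂ hN₂m hN₂B hN₂ hN₂i using hedge
  have hpt : ∀ x u, sampleDist d α (facetFun W.toFun) (skelFaces W.toFun n d x u) ≤
      ∑ j ∈ Finset.Icc 1 d, α j *
        (ε + 2 * (1 / ε) * ((j + 1 : ℕ) * δ x) + N₁ j x + N₂ j x u) := fun x u => by
    obtain ⟨ψ, hψ, hψδ⟩ := hδ x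
    refine sampleDist_le_of_cutLE hα hψ fun j hj => ?_
    have hjd : j ≤ d := (Finset.mem_Icc.1 hj).2
    exact CutLE.of_sample (P := Q) (h := fun c => h j fun i => c i ⟨j, Nat.lt_succ_of_le hjd⟩)
      W.measurable_facetFun (habs j) hQ (fun a => hhB j _) (hcut j) hψ hψδ (hN₁ j x)
      (abs_faceTensor_le _) (hN₂ j x hjd u)
  set c₂ := R ^ 2 / n + √((R * n + 1) * (R ^ 2 / n) ^ 2 / 2) with hc₂
  have hN₂int : ∀ j x, Integrable (N₂ j x) (piUnif (Finset (Fin n))) := fun j x =>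
    integrable_of_bounded (hN₂m j x) (hN₂B j x)
  have hN₁int : ∀ j, Integrable (N₁ j) (piUnif (Fin n)) := fun j =>
    integrable_of_bounded (hN₁m j) (hN₁B j)
  have hδint : Integrable δ (piUnif (Fin n)) := integrable_of_bounded hδm hδ1
  have hin : ∀ x, ∫ u, sampleDist d α (facetFun W.toFun) (skelFaces W.toFun n d x u)
      ∂piUnif (Finset (Fin n)) ≤ ∑ j ∈ Finset.Icc 1 d, α j *
        (ε + 2 * (1 / ε) * ((j + 1 : ℕ) * δ x) + N₁ j x + c₂) := fun x => by
    have hint : ∀ j, Integrable (fun u => α j *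
        (ε + 2 * (1 / ε) * ((j + 1 : ℕ) * δ x) + N₁ j x + N₂ j x u))
        (piUnif (Finset (Fin n))) := fun j =>
      ((integrable_const _).add (hN₂int j x)).const_mul _
    refine (integral_mono_of_nonneg (ae_of_all _ fun u => sampleDist_nonneg hα _)
      (integrable_finsetSum _ fun j _ => hint j) (ae_of_all _ (hpt x))).trans ?_
    rw [integral_finsetSum _ fun j _ => hint j]
    refine Finset.sum_le_sum fun j _ => ?_
    rw [integral_const_mul, integral_add (integrable_const _) (hN₂int j x)]
    simp only [integral_const, probReal_univ, one_smul]
    exact mul_le_mul_of_nonneg_left (add_le_add le_rfl (hN₂i j x)) (hα j)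
  have hint : ∀ j, Integrable (fun x => α j *
      (ε + 2 * (1 / ε) * ((j + 1 : ℕ) * δ x) + N₁ j x + c₂)) (piUnif (Fin n)) := fun j =>
    ((((integrable_const _).add ((hδint.const_mul _).const_mul _)).add (hN₁int j)).add
      (integrable_const _)).const_mul _
  refine (integral_mono_of_nonneg (ae_of_all _ fun x => integral_nonneg fun u =>
    sampleDist_nonneg hα _) (integrable_finsetSum _ fun j _ => hint j)
      (ae_of_all _ hin)).trans ?_
  rw [integral_finsetSum _ fun j _ => hint j, Finset.sum_mul]
  refine Finset.sum_le_sum fun j hj => ?_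
  rw [integral_const_mul]
  refine mul_le_mul_of_nonneg_left ?_ (hα j)
  have i₁ : Integrable (fun x => 2 * (1 / ε) * (((j + 1 : ℕ) : ℝ) * δ x)) (piUnif (Fin n)) :=
    (hδint.const_mul _).const_mul _
  have i₂ : Integrable (fun x => ε + 2 * (1 / ε) * (((j + 1 : ℕ) : ℝ) * δ x)) (piUnif (Fin n)) :=
    (integrable_const _).add i₁
  have i₃ : Integrable (fun x => ε + 2 * (1 / ε) * (((j + 1 : ℕ) : ℝ) * δ x) + N₁ j x)
    (piUnif (Fin n)) := i₂.add (hN₁int j)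
  rw [integral_add i₃ (integrable_const _), integral_add i₂ (hN₁int j),
    integral_add (integrable_const _) i₁, integral_const_mul, integral_const_mul]
  simp only [integral_const, probReal_univ, one_smul]
  have hjR : ((j + 1 : ℕ) : ℝ) ≤ R := by
    rw [hRd]; exact_mod_cast Nat.succ_le_succ (Finset.mem_Icc.1 hj).2
  have hR0 : 0 ≤ R := by rw [hRd]; positivity
  have hδR : ((j + 1 : ℕ) : ℝ) * ∫ x, δ x ∂piUnif (Fin n) ≤ R * √(M * (n : ℝ)⁻¹ / 2) := by
    refine (mul_le_mul_of_nonneg_left (hδi.trans ?_) (Nat.cast_nonneg _)).trans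
      (mul_le_mul_of_nonneg_right hjR (Real.sqrt_nonneg _))
    gcongr
  refine add_le_add (add_le_add (add_le_add le_rfl ?_) ((hN₁i j).trans ?_)) le_rfl
  · gcongr
  · gcongr

end SampleDist

section Concentration

variable {d n : ℕ} [NeZero n]

lemma sampleDist_le_add {α : ℕ → ℝ} (hα : ∀ j, 0 ≤ α j) (W : Complexon)
    {F F' : Finset (Finset (Fin n))} {e : ℝ}
    (h : ∀ j ∈ Finset.Icc 1 d, ∫ i : Fin (j + 1) → Fin n, |faceTensor F' i - faceTensor F i|
      ∂(Measure.pi fun _ => unifFin n) ≤ e) :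
    sampleDist d α (facetFun W.toFun) F ≤
      sampleDist d α (facetFun W.toFun) F' + (∑ j ∈ Finset.Icc 1 d, α j) * e := by
  obtain ⟨ψ₀, hψ₀⟩ := exists_measurePreserving_unifFin n
  have hne : Nonempty {ψ : ℝ → Fin n // MeasurePreserving ψ unifI (unifFin n)} := ⟨⟨ψ₀, hψ₀⟩⟩
  rw [← sub_le_iff_le_add]
  refine le_ciInf fun ⟨ψ, hψ⟩ => ?_
  rw [sub_le_iff_le_add, sampleCutDist, Finset.sum_mul, ← Finset.sum_add_distrib]
  simp only [← mul_add]
  refine sampleDist_le_of_cutLE hα hψ fun j hj => ?_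
  have hsub : ∀ {a b A C : ℝ}, |a| ≤ A → |b| ≤ C → |a - b| ≤ A + C := fun ha hb =>
    (abs_sub _ _).trans (add_le_add ha hb)
  have habs : ∀ v : Fin (j + 1) → ℝ, |facetFun W.toFun (mTup v)| ≤ 1 := fun v => by
    have := W.facetFun_mem_Icc v
    rw [abs_of_nonneg this.1]; exact this.2
  have hψm : Measurable fun v : Fin (j + 1) → ℝ => ψ ∘ v :=
    measurable_pi_lambda _ fun c => hψ.measurable.comp (measurable_pi_apply c)
  have h1 := cutLE_cutNormD (d := j)
    (f := fun v => facetFun W.toFun (mTup v) - faceTensor F' (ψ ∘ v))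
    fun v => hsub (habs v) (abs_faceTensor_le _ _)
  have hb := fun i : Fin (j + 1) → Fin n => hsub (abs_faceTensor_le F' i) (abs_faceTensor_le F i)
  have h2 := CutLE.comp hψ (CutLE.of_integral_abs_le (measurable_of_finite _) hb (h j hj))
    (measurable_of_finite _) hb
  refine fun S hS => le_of_eq_of_le ?_ (h1.add h2
    (W.measurable_facetFun.sub ((measurable_of_finite (faceTensor F')).comp hψm))
    ((measurable_of_finite fun i : Fin (j + 1) → Fin n =>
      faceTensor F' i - faceTensor F i).comp hψm)
    (fun v => hsub (habs v) (abs_faceTensor_le _ _)) (fun v => hb _) S hS)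
  congr 2
  ext v
  ring

lemma abs_sampleDist_sub_le {α : ℕ → ℝ} (hα : ∀ j, 0 ≤ α j) (W : Complexon)
    {F F' : Finset (Finset (Fin n))} {e : ℝ}
    (E : (j : ℕ) → Set (Fin (j + 1) → Fin n))
    (hE : ∀ j ∈ Finset.Icc 1 d, (Measure.pi fun _ => unifFin n).real (E j) ≤ e)
    (hF : ∀ j, ∀ i ∉ E j, Finset.univ.image i ∈ F ↔ Finset.univ.image i ∈ F') :
    |sampleDist d α (facetFun W.toFun) F - sampleDist d α (facetFun W.toFun) F'| ≤
      (∑ j ∈ Finset.Icc 1 d, α j) * e := by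
  have key : ∀ j ∈ Finset.Icc 1 d, ∫ i : Fin (j + 1) → Fin n, |faceTensor F' i - faceTensor F i|
      ∂(Measure.pi fun _ => unifFin n) ≤ e := fun j hj => by
    have := abs_integral_sub_integral_le_of_eq_off (G := fun _ => 0) (K := 1)
      (F := fun i : Fin (j + 1) → Fin n => |faceTensor F' i - faceTensor F i|) (E := E j)
      (fun i hi => by rw [faceTensor_congr (hF j i hi), sub_self, abs_zero]) fun i => by
        have h1 := faceTensor_mem_Icc F i
        have h2 := faceTensor_mem_Icc F' i
        rw [sub_zero, abs_abs, abs_le]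
        constructor <;> linarith [h1.1, h1.2, h2.1, h2.2]
    rw [integral_zero, sub_zero, one_mul] at this
    exact (le_abs_self _).trans (this.trans (hE j hj))
  rw [abs_le]
  have h1 := sampleDist_le_add hα W key
  have h2 := sampleDist_le_add (F := F') (F' := F) hα W fun j hj => by
    simpa only [abs_sub_comm] using key j hj
  constructor <;> linarith

theorem Complexon.skelLaw_real_sampleDist_gt_le (W : Complexon)
    (hR : ((d + 1 : ℕ) : ℝ) ^ 2 ≤ n) {α : ℕ → ℝ} (hα : ∀ j, 0 ≤ α j) {a : ℝ}
    (ha : ∑ j ∈ Finset.Icc 1 d, α j = a) (ha0 : 0 < a) {b t : ℝ} (ht : 0 ≤ t)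
    (hb : ∫ x, ∫ u, sampleDist d α (facetFun W.toFun) (skelFaces W.toFun n d x u)
        ∂piUnif (Finset (Fin n)) ∂piUnif (Fin n) ≤ b) :
    (skelLaw W.toFun n d).real {F | b + t < sampleDist d α (facetFun W.toFun) F} ≤
      Real.exp (-2 * t ^ 2 / (a ^ 2 * (3 * ((d + 1 : ℕ) : ℝ) ^ 2 / n))) := by
  classical
  have hn : (0 : ℝ) < n := by exact_mod_cast Nat.pos_of_ne_zero (NeZero.ne n)
  set G : Finset (Finset (Fin n)) → ℝ := sampleDist d α (facetFun W.toFun) with hG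
  have hGm : Measurable G := measurable_from_top
  have hs := W.measurable_skelFaces n d
  let e := MeasurableEquiv.sumPiEquivProdPi fun _ : Fin n ⊕ Finset (Fin n) => ℝ
  have he : MeasurePreserving e (piUnif (Fin n ⊕ Finset (Fin n)))
      ((piUnif (Fin n)).prod (piUnif (Finset (Fin n)))) :=
    measurePreserving_sumPiEquivProdPi fun _ => unifI
  let f : (Fin n ⊕ Finset (Fin n) → ℝ) → ℝ := fun z =>
    G (skelFaces W.toFun n d (fun i => z (Sum.inl i)) fun τ => z (Sum.inr τ))
  have hfe : f = fun z => G (skelFaces W.toFun n d (e z).1 (e z).2) := rfl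
  have hfm : Measurable f := hGm.comp (hs.comp e.measurable)
  let c : Fin n ⊕ Finset (Fin n) → ℝ := Sum.elim (fun _ => a * (((d + 1 : ℕ) : ℝ) / n))
    fun τ => a * if τ.Nonempty then (((d + 1 : ℕ) : ℝ) / n) ^ τ.card else 0
  have hc : ∀ z i v, |f (Function.update z i v) - f z| ≤ c i := by
    rintro z (i | τ) v
    · have h1 : (fun k => Function.update z (Sum.inl i) v (Sum.inl k)) =
          Function.update (fun k => z (Sum.inl k)) i v := by
        ext k; simp [Function.update_apply]
      have h2 : (fun τ => Function.update z (Sum.inl i) v (Sum.inr τ)) =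
          fun τ => z (Sum.inr τ) := by
        ext k; simp
      simp only [f, h1, h2, c, Sum.elim_inl, ← ha]
      refine abs_sampleDist_sub_le hα W (fun j => {s | ∃ c, s c = i})
        (fun j hj => (unifFin_pi_hit_le i).trans ?_) fun j s hs => ?_
      · gcongr
        exact (Finset.mem_Icc.1 hj).2
      · exact skelFaces_update_point (by simpa using hs) v
    · have h1 : (fun σ => Function.update z (Sum.inr τ) v (Sum.inr σ)) =
          Function.update (fun σ => z (Sum.inr σ)) τ v := by
        ext k; simp [Function.update_apply]
      have h2 : (fun k => Function.update z (Sum.inr τ) v (Sum.inl k)) =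
          fun k => z (Sum.inl k) := by
        ext k; simp
      simp only [f, h1, h2, c, Sum.elim_inr, ← ha]
      by_cases hτ : τ.Nonempty
      · rw [if_pos hτ]
        refine abs_sampleDist_sub_le hα W (fun j => {s | τ ⊆ Finset.univ.image s})
          (fun j hj => (unifFin_pi_subset_image_le τ).trans ?_) fun j s hs => ?_
        · gcongr
          exact (Finset.mem_Icc.1 hj).2
        · exact skelFaces_update_label (fun _ => hs) v
      · rw [if_neg hτ]
        exact abs_sampleDist_sub_le hα W (fun j => ∅) (fun j hj => by simp)
          fun j s _ => skelFaces_update_label (fun h => absurd h hτ) v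
  have hσ : ∑ i, c i ^ 2 ≤ a ^ 2 * (3 * ((d + 1 : ℕ) : ℝ) ^ 2 / n) := by
    rw [Fintype.sum_sum_type]
    simp only [c, Sum.elim_inl, Sum.elim_inr, mul_pow, ← Finset.mul_sum]
    rw [Finset.sum_const, Finset.card_univ, Fintype.card_fin, nsmul_eq_mul, ← mul_add]
    refine mul_le_mul_of_nonneg_left ?_ (sq_nonneg a)
    have h1 : (n : ℝ) * (((d + 1 : ℕ) : ℝ) / n) ^ 2 = ((d + 1 : ℕ) : ℝ) ^ 2 / n := by
      field_simp
    rw [h1]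
    refine (add_le_add le_rfl (sum_label_sq_le hR)).trans (le_of_eq ?_)
    ring
  have hfi : ∫ z, f z ∂piUnif (Fin n ⊕ Finset (Fin n)) ≤ b := by
    rw [hfe, he.integral_comp' fun p : (Fin n → ℝ) × (Finset (Fin n) → ℝ) =>
      G (skelFaces W.toFun n d p.1 p.2), integral_prod]
    · exact hb
    · have := Measure.isFiniteMeasure_map ((piUnif (Fin n)).prod (piUnif (Finset (Fin n))))
        fun p => skelFaces W.toFun n d p.1 p.2
      exact (Integrable.of_finite (f := G)).comp_measurable hs
  have hmain := measure_gt_le_of_bounded_differences unifI c hfm hc hσ (by positivity) ht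
  have hset : MeasurableSet {F : Finset (Finset (Fin n)) | b + t < G F} :=
    MeasurableSpace.measurableSet_top
  refine le_trans ?_ hmain
  rw [skelLaw, map_measureReal_apply hs hset,
    ← he.measureReal_preimage (hs hset).nullMeasurableSet]
  refine measureReal_mono fun z hz => ?_
  have hz' : b + t < f z := hz
  have hfi' : ∫ z, f z ∂(Measure.pi fun _ => unifI) ≤ b := hfi
  simp only [Set.mem_ofPred_eq]
  linarith

end Concentration

section Numerics

lemma four_mul_pow_div_pow_le {x y : ℝ} {a b c : ℕ} (hx : 2 ≤ x) (hy : x ^ 8 ≤ y)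
    (h : a + c + 2 ≤ 8 * b) : 4 * x ^ a / y ^ b ≤ 1 / x ^ c := by
  have hx0 : 0 < x := by linarith
  have hy0 : 0 < y := lt_of_lt_of_le (by positivity) hy
  rw [div_le_div_iff₀ (by positivity) (by positivity), one_mul]
  calc 4 * x ^ a * x ^ c = 2 ^ 2 * (x ^ a * x ^ c) := by ring
    _ ≤ x ^ 2 * (x ^ a * x ^ c) := by gcongr
    _ = x ^ (a + c + 2) := by ring
    _ ≤ x ^ (8 * b) := pow_le_pow_right₀ (by linarith) h
    _ = (x ^ 8) ^ b := pow_mul _ _ _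
    _ ≤ y ^ b := by gcongr

lemma sample_error_le {x y n q R K : ℝ} (hx : 2 ≤ x) (hy : x ^ 8 ≤ y) (hn : n = y ^ 4)
    (hR0 : 0 ≤ R) (hR : R ≤ x) (hK0 : 0 ≤ K) (hK : K ≤ x) (hq : y ^ 2 / 4 ≤ q) (hq' : q ≤ y ^ 2) :
    K * ((R ^ 2 + R * (R * (q * R))) / n) ≤ 1 / x ∧
    √((R * q + 1) * (4 * K ^ 2 * R ^ 2 / n) / 2) ≤ 1 / x ∧ R * (K / √q) ≤ 1 / x ∧
    R ^ 2 / n ≤ 1 / x ∧ √((R * n + 1) * (R ^ 2 / n) ^ 2 / 2) ≤ 1 / x := by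
  have hx0 : 0 < x := by linarith
  have hy1 : 1 ≤ y := le_trans (one_le_pow₀ (by linarith)) hy
  have hy0 : 0 < y := by linarith
  have hq0 : 0 < q := lt_of_lt_of_le (by positivity) hq
  have hxy : 1 ≤ x * y ^ 2 := one_le_mul_of_one_le_of_one_le (by linarith) (one_le_pow₀ hy1)
  have hsq : ∀ {A : ℝ}, A ≤ 1 / x ^ 2 → √A ≤ 1 / x := fun {A} hA => by
    rw [Real.sqrt_le_left (by positivity), div_pow, one_pow]; exact hA
  subst hn
  refine ⟨?_, hsq ?_, ?_, ?_, hsq ?_⟩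
  · calc K * ((R ^ 2 + R * (R * (q * R))) / y ^ 4)
        ≤ x * ((x ^ 2 + x * (x * (y ^ 2 * x))) / y ^ 4) := by gcongr
      _ ≤ x * ((x ^ 2 * (x * y ^ 2) + x * (x * (y ^ 2 * x))) / y ^ 4) := by
          gcongr; exact le_mul_of_one_le_right (by positivity) hxy
      _ = 2 * x ^ 4 / y ^ 2 := by field_simp; ring
      _ ≤ 4 * x ^ 4 / y ^ 2 := by gcongr; norm_num
      _ ≤ 1 / x ^ 1 := four_mul_pow_div_pow_le hx hy (by norm_num)
      _ = 1 / x := by rw [pow_one]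
  · calc (R * q + 1) * (4 * K ^ 2 * R ^ 2 / y ^ 4) / 2
        ≤ (x * y ^ 2 + x * y ^ 2) * (4 * x ^ 2 * x ^ 2 / y ^ 4) / 2 := by gcongr
      _ = 4 * x ^ 5 / y ^ 2 := by field_simp; ring
      _ ≤ 1 / x ^ 2 := four_mul_pow_div_pow_le hx hy (by norm_num)
  · have : y / 2 ≤ √q := Real.le_sqrt_of_sq_le (by rw [div_pow]; linarith)
    calc R * (K / √q) ≤ x * (x / (y / 2)) := by gcongr
      _ = 2 * x ^ 2 / y ^ 1 := by field_simp
      _ ≤ 4 * x ^ 2 / y ^ 1 := by gcongr; norm_num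
      _ ≤ 1 / x ^ 1 := four_mul_pow_div_pow_le hx hy (by norm_num)
      _ = 1 / x := by rw [pow_one]
  · calc R ^ 2 / y ^ 4 ≤ 4 * x ^ 2 / y ^ 4 := by gcongr; nlinarith
      _ ≤ 1 / x ^ 1 := four_mul_pow_div_pow_le hx hy (by norm_num)
      _ = 1 / x := by rw [pow_one]
  · have hxy4 : 1 ≤ x * y ^ 4 := one_le_mul_of_one_le_of_one_le (by linarith) (one_le_pow₀ hy1)
    calc (R * y ^ 4 + 1) * (R ^ 2 / y ^ 4) ^ 2 / 2
        ≤ (x * y ^ 4 + x * y ^ 4) * (x ^ 2 / y ^ 4) ^ 2 / 2 := by gcongr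
      _ = x ^ 5 / y ^ 4 := by field_simp; ring
      _ ≤ 4 * x ^ 5 / y ^ 4 := by gcongr; nlinarith [pow_pos hx0 5]
      _ ≤ 1 / x ^ 2 := four_mul_pow_div_pow_le hx hy (by norm_num)

lemma pow_eight_le_two_rpow {x : ℝ} (hx : 32 ≤ x) : x ^ 8 ≤ 2 ^ (x ^ 2 / 4) := by
  have h1 : x ≤ 2 ^ x := by
    have := Real.add_one_le_exp (x * Real.log 2 - 1)
    have h2 : Real.exp (x * Real.log 2) = 2 ^ x := by
      rw [Real.rpow_def_of_pos (by norm_num), mul_comm]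
    rw [sub_add_cancel, Real.exp_sub, h2, le_div_iff₀ (Real.exp_pos 1)] at this
    have h3 : 1 ≤ Real.log 2 * Real.exp 1 := by
      have := Real.log_two_gt_d9; have := Real.exp_one_gt_d9; nlinarith
    nlinarith
  calc x ^ 8 ≤ (2 ^ x) ^ 8 := by gcongr
    _ = 2 ^ (x * 8) := by rw [← Real.rpow_mul_natCast (by norm_num)]; norm_num
    _ ≤ 2 ^ (x ^ 2 / 4) := Real.rpow_le_rpow_of_exponent_le (by norm_num) (by nlinarith)

theorem Complexon.integral_sampleDist_le_of_large (W : Complexon) {d n : ℕ} [NeZero n] (hd : 1 ≤ d)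
    {x : ℝ} (hx : x = √(Real.logb 2 n)) (hxd : 16 * 2 ^ d + 2 ≤ x) {α : ℕ → ℝ}
    (hα : ∀ j, 0 ≤ α j) :
    ((d + 1 : ℕ) : ℝ) ^ 2 ≤ n ∧
    ∫ z, ∫ u, sampleDist d α (facetFun W.toFun) (skelFaces W.toFun n d z u)
        ∂piUnif (Finset (Fin n)) ∂piUnif (Fin n) ≤
      (∑ j ∈ Finset.Icc 1 d, α j) * (7 * 2 ^ d / x) := by
  have hn : (0 : ℝ) < n := by exact_mod_cast Nat.pos_of_ne_zero (NeZero.ne n)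
  set D : ℝ := 2 ^ d with hD
  have hD2 : 2 ≤ D := by
    calc (2 : ℝ) = 2 ^ 1 := (pow_one 2).symm
      _ ≤ 2 ^ d := pow_le_pow_right₀ (by norm_num) hd
  have hRD : ((d + 1 : ℕ) : ℝ) ≤ D := by
    rw [hD]; exact_mod_cast Nat.lt_two_pow_self
  have hx34 : 34 ≤ x := by linarith
  have hx0 : 0 < x := by linarith
  have hL : Real.logb 2 n = x ^ 2 := by
    rw [hx, Real.sq_sqrt]
    by_contra h
    rw [Real.sqrt_eq_zero_of_nonpos (by linarith)] at hx
    linarith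
  set y : ℝ := 2 ^ (x ^ 2 / 4) with hy
  have hxy : x ^ 8 ≤ y := pow_eight_le_two_rpow (by linarith)
  have hny : (n : ℝ) = y ^ 4 := by
    rw [hy, ← Real.rpow_mul_natCast (by norm_num)]
    rw [Real.logb_eq_iff_rpow_eq (by norm_num) (by norm_num) hn] at hL
    rw [← hL]; congr 1; push_cast; ring
  have hy2 : (2 : ℝ) ^ (x ^ 2 / 2) = y ^ 2 := by
    rw [hy, ← Real.rpow_mul_natCast (by norm_num)]
    congr 1; push_cast; ring
  have hx8 : x ≤ x ^ 8 := le_self_pow₀ (by linarith) (by norm_num)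
  have hy2' : 2 ≤ y := by linarith
  set q : ℕ := n.sqrt with hq
  have hqle : (q : ℝ) ≤ y ^ 2 := by
    have h1 : ((q * q : ℕ) : ℝ) ≤ n := by exact_mod_cast Nat.sqrt_le n
    push_cast at h1
    exact le_of_sq_le_sq (by rw [hny] at h1; nlinarith) (by positivity)
  have hqge : y ^ 2 / 4 ≤ q := by
    have h1 : (n : ℝ) ≤ (((q + 1) * (q + 1) : ℕ) : ℝ) := by exact_mod_cast (Nat.lt_succ_sqrt n).le
    push_cast at h1
    have : y ^ 2 ≤ q + 1 := le_of_sq_le_sq (by rw [hny] at h1; nlinarith) (by positivity)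
    nlinarith
  have hq0 : 0 < q := by
    have : (0 : ℝ) < q := lt_of_lt_of_le (by positivity) hqge
    exact_mod_cast this
  set ε : ℝ := 2 * D / x with hε
  have hε0 : 0 < ε := by positivity
  have hK : 1 + 1 / ε ≤ x := by
    have : 1 / ε ≤ x / 4 := by
      rw [hε, one_div_div]; gcongr; linarith
    linarith
  have hR : ((d + 1 : ℕ) : ℝ) ≤ x := by linarith
  obtain ⟨e1, e2, e3, e4, e5⟩ := sample_error_le (by linarith) hxy hny (Nat.cast_nonneg (d + 1)) hR
    (by positivity) hK hqge hqle
  have hRn : ((d + 1 : ℕ) : ℝ) ^ 2 ≤ n := by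
    rw [hny]
    calc ((d + 1 : ℕ) : ℝ) ^ 2 ≤ y ^ 2 := by gcongr; linarith
      _ ≤ y ^ 4 := pow_le_pow_right₀ (by linarith) (by norm_num)
  refine ⟨hRn, ?_⟩
  have hM : (2 : ℝ) ^ ((d + 1) ^ 2 * ⌊1 / ε ^ 2⌋₊) ≤ y ^ 2 := by
    rw [← hy2, ← Real.rpow_natCast]
    refine Real.rpow_le_rpow_of_exponent_le (by norm_num) ?_
    have h1 : (⌊1 / ε ^ 2⌋₊ : ℝ) ≤ x ^ 2 / (4 * D ^ 2) := by
      refine (Nat.floor_le (by positivity)).trans (le_of_eq ?_)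
      rw [hε]; field_simp; ring
    push_cast at hRD ⊢
    calc ((d : ℝ) + 1) ^ 2 * ⌊1 / ε ^ 2⌋₊ ≤ D ^ 2 * (x ^ 2 / (4 * D ^ 2)) := by gcongr
      _ = x ^ 2 / 4 := by field_simp
      _ ≤ x ^ 2 / 2 := by gcongr; norm_num
  have e0 : 2 * (1 / ε) * (((d + 1 : ℕ) : ℝ) * √(y ^ 2 * (n : ℝ)⁻¹ / 2)) ≤ 1 / x := by
    have h1 : √(y ^ 2 * (n : ℝ)⁻¹ / 2) ≤ 1 / y := by
      rw [Real.sqrt_le_left (by positivity), hny]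
      have : y ^ 2 * (y ^ 4)⁻¹ = (1 / y) ^ 2 := by field_simp
      rw [this]
      nlinarith [sq_nonneg (1 / y)]
    calc 2 * (1 / ε) * (((d + 1 : ℕ) : ℝ) * √(y ^ 2 * (n : ℝ)⁻¹ / 2))
        ≤ 2 * (1 / ε) * (D * (1 / y)) := by gcongr
      _ = x ^ 1 / y ^ 1 := by rw [hε]; field_simp
      _ ≤ 4 * x ^ 1 / y ^ 1 := by gcongr; linarith
      _ ≤ 1 / x ^ 1 := four_mul_pow_div_pow_le (by linarith) hxy (by norm_num)
      _ = 1 / x := by rw [pow_one]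
  refine (W.integral_sampleDist_le hRn hε0 hq0 hM hα rfl rfl).trans
    (mul_le_mul_of_nonneg_left ?_ (Finset.sum_nonneg fun j _ => hα j))
  have h6 : 6 * (1 / x) ≤ 3 * D / x := by
    rw [mul_one_div]; gcongr; linarith
  have h7 : 7 * D / x = 2 * ε + 3 * D / x := by rw [hε]; ring
  rw [h7]
  linarith

end Numerics

section Gluing

variable {n : ℕ} [NeZero n]

lemma exists_comp_ae_eq {ψ ψ' : ℝ → Fin n} (hψ : MeasurePreserving ψ unifI (unifFin n))
    (hψ' : MeasurePreserving ψ' unifI (unifFin n)) :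
    ∃ φ : ℝ → ℝ, MeasurePreserving φ unifI unifI ∧ (fun v => ψ' (φ v)) =ᵐ[unifI] ψ := by
  have hfib : ∀ {χ : ℝ → Fin n}, MeasurePreserving χ unifI (unifFin n) → ∀ a,
      unifI (χ ⁻¹' {a}) = (n : ENNReal)⁻¹ := fun hχ a => by
    rw [hχ.measure_preimage (measurableSet_singleton a).nullMeasurableSet, unifFin_singleton]
  have hn0 : (n : ENNReal)⁻¹ ≠ 0 := ENNReal.inv_ne_zero.2 (ENNReal.natCast_ne_top n)
  have hnt : (n : ENNReal)⁻¹ ≠ ⊤ :=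
    ENNReal.inv_ne_top.2 (Nat.cast_ne_zero.2 (NeZero.ne n))
  let K : ProbabilityTheory.Kernel (Fin n) ℝ :=
    ProbabilityTheory.Kernel.ofFunOfCountable fun a => ProbabilityTheory.cond unifI (ψ' ⁻¹' {a})
  have hK : ProbabilityTheory.IsMarkovKernel K :=
    ⟨fun a => ProbabilityTheory.cond_isProbabilityMeasure (by rw [hfib hψ']; exact hn0)⟩
  obtain ⟨φ, hφ, h⟩ := exists_measurable_realizing hψ.measurable K
  have h' : ∀ a B, MeasurableSet B → unifI (ψ ⁻¹' {a} ∩ φ ⁻¹' B) = unifI (ψ' ⁻¹' {a} ∩ B) := by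
    intro a B hB
    have hKa : K a B = (unifI (ψ' ⁻¹' {a}))⁻¹ * unifI (ψ' ⁻¹' {a} ∩ B) :=
      ProbabilityTheory.cond_apply (hψ'.measurable (measurableSet_singleton a)) _ _
    rw [h a B hB, hKa, hfib hψ, hfib hψ', ← mul_assoc, ENNReal.mul_inv_cancel hn0 hnt, one_mul]
  have hsplit : ∀ {χ : ℝ → Fin n}, Measurable χ → ∀ B, MeasurableSet B →
      unifI B = ∑ a, unifI (χ ⁻¹' {a} ∩ B) := fun {χ} hχ B hB => by
    rw [← measure_biUnion_finset]
    · congr 1; ext v; simp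
    · intro a _ b _ hab
      refine Set.disjoint_left.2 fun v hv hv' => hab ?_
      exact (Set.mem_singleton_iff.1 hv.1).symm.trans (Set.mem_singleton_iff.1 hv'.1)
    · exact fun a _ => (hχ (measurableSet_singleton a)).inter hB
  refine ⟨φ, ⟨hφ, ?_⟩, ?_⟩
  · ext B hB
    rw [Measure.map_apply hφ hB, hsplit hψ.measurable _ (hφ hB), hsplit hψ'.measurable _ hB]
    exact Finset.sum_congr rfl fun a _ => h' a B hB
  · have : ∀ a, ∀ᵐ v ∂unifI, ψ v = a → ψ' (φ v) = a := fun a => by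
      have h0 := h' a (ψ' ⁻¹' {a})ᶜ (hψ'.measurable (measurableSet_singleton a)).compl
      rw [Set.inter_compl_self, measure_empty] at h0
      rw [ae_iff]
      refine measure_mono_null (fun v hv => ?_) h0
      simpa using hv
    filter_upwards [ae_all_iff.2 this] with v hv using hv _ rfl

omit [NeZero n] in
lemma cutDistD_compFun_le (U W : Complexon) {F : Finset (Finset (Fin n))} {ψ ψ' : ℝ → Fin n}
    (hψ : MeasurePreserving ψ unifI (unifFin n)) (hψ' : MeasurePreserving ψ' unifI (unifFin n))
    {φ : ℝ → ℝ} (hφ : MeasurePreserving φ unifI unifI)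
    (h : (fun v => ψ' (φ v)) =ᵐ[unifI] ψ) (j : ℕ) :
    cutDistD j (facetFun U.toFun) (compFun (facetFun W.toFun) φ) ≤
      cutNormD j (fun v => facetFun U.toFun (mTup v) - faceTensor F (ψ ∘ v)) +
        cutNormD j (fun v => facetFun W.toFun (mTup v) - faceTensor F (ψ' ∘ v)) := by
  have hb : ∀ (V : Complexon) (χ : ℝ → Fin n) (v : Fin (j + 1) → ℝ),
      |facetFun V.toFun (mTup v) - faceTensor F (χ ∘ v)| ≤ 1 := fun V χ v => by
    have h1 := V.facetFun_mem_Icc v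
    have h2 := faceTensor_mem_Icc F (χ ∘ v)
    rw [abs_le]
    constructor <;> linarith [h1.1, h1.2, h2.1, h2.2]
  have hm : ∀ (V : Complexon) {χ : ℝ → Fin n}, Measurable χ →
      Measurable fun v : Fin (j + 1) → ℝ => facetFun V.toFun (mTup v) - faceTensor F (χ ∘ v) :=
    fun V χ hχ => V.measurable_facetFun.sub ((measurable_of_finite (faceTensor F)).comp
      (measurable_pi_lambda _ fun c => hχ.comp (measurable_pi_apply c)))
  have hφm : Measurable fun v : Fin (j + 1) → ℝ => φ ∘ v :=
    measurable_pi_lambda _ fun c => hφ.measurable.comp (measurable_pi_apply c)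
  have h1 := cutLE_cutNormD (hb U ψ)
  have h2 := (CutLE.comp hφ (cutLE_cutNormD (hb W ψ')) (hm W hψ'.measurable) (hb W ψ')).neg
  have h3 := h1.add h2 (hm U hψ.measurable) ((hm W hψ'.measurable).comp hφm).neg (hb U ψ)
    fun v => by rw [abs_neg]; exact hb W ψ' _
  refine (h3.congr_ae ?_).cutNormD_le
  have hae := Measure.ae_eq_pi (μ := fun _ : Fin (j + 1) => unifI) (f := fun _ v => ψ' (φ v))
    (f' := fun _ => ψ) fun _ => h
  filter_upwards [hae] with v hv
  have e1 : ψ' ∘ φ ∘ v = ψ ∘ v := hv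
  have e2 : compFun (facetFun W.toFun) φ (mTup v) = facetFun W.toFun (mTup (φ ∘ v)) := by
    rw [compFun, mTup, Multiset.map_map, mTup]
  rw [e1, e2]
  ring

end Gluing

section CutDist

lemma cutDist_eq_sum {α : ℕ → ℝ} {d : ℕ} (hα0 : ∀ j, d < j → α j = 0) (f g : Multiset ℝ → ℝ) :
    cutDist α f g = ∑ j ∈ Finset.Icc 1 d, α j * cutDistD j f g := by
  rw [cutDist, tsum_eq_sum (s := Finset.range d)]
  · rw [Finset.sum_bij (fun j _ => j + 1)]
    · intro j hj; simp at hj ⊢; omega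
    · intro i _ j _ h; omega
    · intro j hj
      have := Finset.mem_Icc.1 hj
      exact ⟨j - 1, by simp; omega, by omega⟩
    · intro j _; rfl
  · intro j hj
    rw [hα0 _ (by simp at hj; omega), zero_mul]

lemma uCutDist_le {α : ℕ → ℝ} (hα : ∀ j, 0 ≤ α j) {f g : Multiset ℝ → ℝ} {φ : ℝ → ℝ}
    (hφ : MeasurePreserving φ unifI unifI) : uCutDist α f g ≤ cutDist α f (compFun g φ) := by
  refine csInf_le ⟨0, ?_⟩ ⟨φ, hφ, rfl⟩
  rintro _ ⟨φ, -, rfl⟩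
  exact tsum_nonneg fun j => mul_nonneg (hα _) (cutNormD_nonneg _ _)

lemma uCutDist_facetFun_le_sum (U W : Complexon) {α : ℕ → ℝ} {d : ℕ} (hα : ∀ j, 0 ≤ α j)
    (hα0 : ∀ j, d < j → α j = 0) :
    uCutDist α (facetFun U.toFun) (facetFun W.toFun) ≤ ∑ j ∈ Finset.Icc 1 d, α j := by
  refine (uCutDist_le hα (MeasurePreserving.id unifI)).trans ?_
  rw [cutDist_eq_sum hα0]
  refine Finset.sum_le_sum fun j _ => mul_le_of_le_one_right (hα j) ?_
  refine CutLE.cutNormD_le fun S hS =>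
    abs_setIntegral_le_of_abs_le (fun v => ?_) (MeasurableSet.univ_pi hS)
  have h1 := U.facetFun_mem_Icc v
  have h2 := W.facetFun_mem_Icc v
  have e : compFun (facetFun W.toFun) id (mTup v) = facetFun W.toFun (mTup v) := by
    rw [compFun, Multiset.map_id]
  rw [e, abs_le]
  constructor <;> linarith [h1.1, h1.2, h2.1, h2.2]

end CutDist

lemma abs_sub_le_tvDist {X : Type*} [MeasurableSpace X] (μ ν : Measure X) [IsProbabilityMeasure μ]
    [IsProbabilityMeasure ν] {A : Set X} (hA : MeasurableSet A) :
    |μ.real A - ν.real A| ≤ tvDist μ ν := by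
  refine le_csSup ⟨1, ?_⟩ ⟨A, hA, rfl⟩
  rintro _ ⟨A, -, rfl⟩
  have h1 : μ.real A ≤ 1 := measureReal_le_one
  have h2 : ν.real A ≤ 1 := measureReal_le_one
  have h3 : 0 ≤ μ.real A := measureReal_nonneg
  have h4 : 0 ≤ ν.real A := measureReal_nonneg
  rw [abs_le]
  exact ⟨by change _ ≤ μ.real A - ν.real A; linarith, by change μ.real A - ν.real A ≤ _; linarith⟩

lemma Complexon.isProbabilityMeasure_skelLaw (W : Complexon) (n d : ℕ) :
    IsProbabilityMeasure (skelLaw W.toFun n d) :=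
  Measure.isProbabilityMeasure_map (W.measurable_skelFaces n d).aemeasurable

theorem Complexon.skelLaw_real_sampleDist_gt_le_of_large (W : Complexon) {d n : ℕ} [NeZero n]
    (hd : 1 ≤ d) {x : ℝ} (hx : x = √(Real.logb 2 n)) (hxd : 16 * 2 ^ d + 2 ≤ x) {α : ℕ → ℝ}
    (hα : ∀ j, 0 ≤ α j) {a : ℝ} (ha : ∑ j ∈ Finset.Icc 1 d, α j = a) (ha0 : 0 < a) :
    (skelLaw W.toFun n d).real {F | a * (8 * 2 ^ d / x) < sampleDist d α (facetFun W.toFun) F} ≤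
      Real.exp (-(n : ℝ) / (2 * Real.logb 2 n)) := by
  have hn : (0 : ℝ) < n := by exact_mod_cast Nat.pos_of_ne_zero (NeZero.ne n)
  obtain ⟨hR, hb⟩ := W.integral_sampleDist_le_of_large hd hx hxd hα
  rw [ha] at hb
  have hD0 : (0 : ℝ) < 2 ^ d := by positivity
  have hx0 : 0 < x := by linarith
  have hL : Real.logb 2 n = x ^ 2 := by
    rw [hx, Real.sq_sqrt]
    by_contra h
    rw [Real.sqrt_eq_zero_of_nonpos (by linarith)] at hx
    linarith
  have h := W.skelLaw_real_sampleDist_gt_le hR hα ha ha0 (t := a * (2 ^ d / x)) (by positivity) hb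
  have e : a * (7 * 2 ^ d / x) + a * (2 ^ d / x) = a * (8 * 2 ^ d / x) := by ring
  rw [e] at h
  refine h.trans (Real.exp_le_exp.2 ?_)
  have hRD : ((d + 1 : ℕ) : ℝ) ^ 2 ≤ (2 ^ d) ^ 2 := by
    gcongr; exact_mod_cast Nat.lt_two_pow_self
  have hR0 : (0 : ℝ) < (d + 1 : ℕ) := by positivity
  rw [hL]
  have e1 : -2 * (a * (2 ^ d / x)) ^ 2 / (a ^ 2 * (3 * ((d + 1 : ℕ) : ℝ) ^ 2 / n)) =
      -(n / x ^ 2 * (2 * (2 ^ d) ^ 2 / (3 * ((d + 1 : ℕ) : ℝ) ^ 2))) := by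
    field_simp
  have e2 : -(n : ℝ) / (2 * x ^ 2) = -(n / x ^ 2 * (1 / 2)) := by field_simp
  rw [e1, e2, neg_le_neg_iff]
  refine mul_le_mul_of_nonneg_left ?_ (by positivity)
  rw [div_le_div_iff₀ (by norm_num) (by positivity)]
  linarith [sq_nonneg ((2 : ℝ) ^ d)]

/-- If the laws of the `d`-skeleta of the samples from `U`
and `W` are close in total variation, then the faceted complexons are close in
the unlabeled cut-distance. -/
theorem tv_close_implies_cut_close (U W : Complexon) (d n : ℕ)
    (hd : 1 ≤ d) (hn : 2 ≤ n)
    (htv : tvDist (skelLaw U.toFun n d) (skelLaw W.toFun n d) <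
      1 - 2 * Real.exp (-(n : ℝ) / (2 * Real.logb 2 n)))
    (α : ℕ → ℝ) (hα : ∀ j, 0 ≤ α j) (hα0 : ∀ j, d < j → α j = 0) :
    uCutDist α (facetFun U.toFun) (facetFun W.toFun) ≤
      ((2 ^ (d + 4) + 2) / Real.sqrt (Real.logb 2 n)) *
        ∑ j ∈ Finset.Icc 1 d, α j := by
  have hn0 : NeZero n := ⟨by omega⟩
  set a := ∑ j ∈ Finset.Icc 1 d, α j with ha
  set x := √(Real.logb 2 n) with hx
  have ha_nonneg : 0 ≤ a := Finset.sum_nonneg fun j _ => hα j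
  have hx0 : 0 < x := Real.sqrt_pos.2
    (Real.logb_pos (by norm_num) (by exact_mod_cast (by omega : 1 < n)))
  have hpow : (2 : ℝ) ^ (d + 4) = 16 * 2 ^ d := by rw [pow_add]; ring
  rw [hpow]
  have htriv := uCutDist_facetFun_le_sum U W hα hα0
  rcases ha_nonneg.eq_or_lt with h0 | ha0
  · rw [← ha, ← h0] at htriv
    rw [← h0, mul_zero]; exact htriv
  rcases le_total x (16 * 2 ^ d + 2) with hxd | hxd
  · refine htriv.trans (le_mul_of_one_le_left ha_nonneg ?_)
    rwa [one_le_div hx0]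
  set e := Real.exp (-(n : ℝ) / (2 * Real.logb 2 n))
  have hU := U.skelLaw_real_sampleDist_gt_le_of_large hd hx hxd hα ha.symm ha0
  have hW := W.skelLaw_real_sampleDist_gt_le_of_large hd hx hxd hα ha.symm ha0
  have hpU := U.isProbabilityMeasure_skelLaw n d
  have hpW := W.isProbabilityMeasure_skelLaw n d
  obtain ⟨F, hFU, hFW⟩ : ∃ F : Finset (Finset (Fin n)),
      sampleDist d α (facetFun U.toFun) F ≤ a * (8 * 2 ^ d / x) ∧
      sampleDist d α (facetFun W.toFun) F ≤ a * (8 * 2 ^ d / x) := by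
    by_contra! hcon
    set B := {F : Finset (Finset (Fin n)) | a * (8 * 2 ^ d / x) <
      sampleDist d α (facetFun U.toFun) F} with hB
    have hBm : MeasurableSet B := MeasurableSpace.measurableSet_top
    have h1 : (skelLaw W.toFun n d).real Bᶜ ≤ e :=
      (measureReal_mono fun F hF => hcon F (not_lt.1 hF)).trans hW
    have h2 := probReal_compl_eq_one_sub (μ := skelLaw U.toFun n d) hBm
    have h3 := (le_abs_self _).trans
      (abs_sub_le_tvDist (skelLaw U.toFun n d) (skelLaw W.toFun n d) hBm.compl)
    linarith
  obtain ⟨ψ₀, hψ₀⟩ := exists_measurePreserving_unifFin n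
  have hne : Nonempty {ψ : ℝ → Fin n // MeasurePreserving ψ unifI (unifFin n)} := ⟨⟨ψ₀, hψ₀⟩⟩
  have hlt : a * (8 * 2 ^ d / x) < a * ((8 * 2 ^ d + 1) / x) := by gcongr; linarith
  obtain ⟨⟨ψ, hψ⟩, hψF⟩ := exists_lt_of_ciInf_lt (hFU.trans_lt hlt)
  obtain ⟨⟨ψ', hψ'⟩, hψF'⟩ := exists_lt_of_ciInf_lt (hFW.trans_lt hlt)
  obtain ⟨φ, hφ, hφψ⟩ := exists_comp_ae_eq hψ hψ'
  calc uCutDist α (facetFun U.toFun) (facetFun W.toFun)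
      ≤ ∑ j ∈ Finset.Icc 1 d, α j *
        cutDistD j (facetFun U.toFun) (compFun (facetFun W.toFun) φ) :=
        (uCutDist_le hα hφ).trans_eq (cutDist_eq_sum hα0 _ _)
    _ ≤ sampleCutDist d α (facetFun U.toFun) F ψ + sampleCutDist d α (facetFun W.toFun) F ψ' := by
        rw [sampleCutDist, sampleCutDist, ← Finset.sum_add_distrib]
        refine Finset.sum_le_sum fun j _ => ?_
        rw [← mul_add]
        exact mul_le_mul_of_nonneg_left (cutDistD_compFun_le U W hψ hψ' hφ hφψ j) (hα j)
    _ ≤ a * ((8 * 2 ^ d + 1) / x) + a * ((8 * 2 ^ d + 1) / x) := add_le_add hψF.le hψF'.le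
    _ = (16 * 2 ^ d + 2) / x * a := by ring
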